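/- Assume N = 3 and p > 5, or N ≥ 4 and 1 + 4/(N−2) < p < 1 + 4/(N−3). Then for every non-negative integer n ≥ 0 there exist a real ρ_n > 1 and an analytic positive function u_n on [0, ρ_n) which solves the equation (PDE) on (0, ρ_n) and such that u_n − u_∞ has exactly n+1 zeros on the interval (0,1). Moreover u_n(0) → +∞ as n → ∞. -/

import Mathlib

open Set Filter

noncomputable def alphaP (p : ℝ) : ℝ := 2 / (p - 1)

noncomputable def b0 (p : ℝ) : ℝ := (2 * (p + 1) / (p - 1) ^ 2) ^ ((1 : ℝ) / (p - 1))

noncomputable def bInf (N : ℕ) (p : ℝ) : ℝ :=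
  (alphaP p * ((N : ℝ) - 2 - alphaP p)) ^ (alphaP p / 2)

noncomputable def uInf (N : ℕ) (p : ℝ) (ρ : ℝ) : ℝ := bInf N p * ρ ^ (-(alphaP p))

/-- `u` solves `(1-ρ²)u'' + ((N-1)/ρ - 2(α+1)ρ)u' - α(α+1)u + |u|^{p-1}u = 0` on `s`. -/
def IsSolOn (N : ℕ) (p : ℝ) (u : ℝ → ℝ) (s : Set ℝ) : Prop :=
  ∀ ρ ∈ s,
    (1 - ρ ^ 2) * deriv (deriv u) ρ
      + (((N : ℝ) - 1) / ρ - 2 * (alphaP p + 1) * ρ) * deriv u ρ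
      - alphaP p * (alphaP p + 1) * u ρ + |u ρ| ^ (p - 1) * u ρ = 0

theorem exists_fixed_of_weighted_contraction {X F : Type*} [MetricSpace F] [CompleteSpace F]
    (D : Set X) (W : X → ℝ) (Good : (X → F) → Prop) (T : (X → F) → X → F)
    (hT : ∀ y, Good y → Good (T y))
    (hc : ∀ y y' e, Good y → Good y' → 0 ≤ e → (∀ t ∈ D, dist (y t) (y' t) ≤ e * W t) →
      ∀ t ∈ D, dist (T y t) (T y' t) ≤ e / 2 * W t)
    (hW : ∃ K, ∀ t ∈ D, W t ≤ K)
    (hcl : ∀ (Y : ℕ → X → F) (y : X → F), (∀ n, Good (Y n)) →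
      TendstoUniformlyOn Y y atTop D → Good y)
    (y₀ : X → F) (h₀ : Good y₀) (e : ℝ) (he : 0 ≤ e)
    (hd : ∀ t ∈ D, dist (y₀ t) (T y₀ t) ≤ e * W t) :
    ∃ y, Good y ∧ ∀ t ∈ D, T y t = y t := by
  classical
  obtain ⟨K, hK⟩ := hW
  let Y : ℕ → X → F := fun n => T^[n] y₀
  have hYs : ∀ n, Y (n + 1) = T (Y n) := fun n => Function.iterate_succ_apply' T n y₀
  have hYg : ∀ n, Good (Y n) := by
    intro n
    induction n with
    | zero => exact h₀
    | succ n ih => rw [hYs]; exact hT _ ih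
  have hstep : ∀ n, ∀ t ∈ D, dist (Y n t) (Y (n + 1) t) ≤ e / 2 ^ n * W t := by
    intro n
    induction n with
    | zero => intro t ht; rw [hYs]; simpa [Y] using hd t ht
    | succ n ih =>
      intro t ht
      have := hc (Y n) (Y (n + 1)) (e / 2 ^ n) (hYg n) (hYg _) (by positivity) ih t ht
      rw [← hYs, ← hYs] at this
      refine this.trans (le_of_eq ?_)
      rw [pow_succ]; field_simp
  have hgeo : ∀ t ∈ D, ∀ n, dist (Y n t) (Y (n + 1) t) ≤ (2 * (e * W t)) / 2 / 2 ^ n := by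
    intro t ht n
    refine (hstep n t ht).trans (le_of_eq ?_)
    field_simp
  have hlim : ∀ t, ∃ l, t ∈ D → Tendsto (fun n => Y n t) atTop (nhds l) := by
    intro t
    by_cases ht : t ∈ D
    · obtain ⟨l, hl⟩ := cauchySeq_tendsto_of_complete (cauchySeq_of_le_geometric_two (hgeo t ht))
      exact ⟨l, fun _ => hl⟩
    · exact ⟨y₀ t, fun h => absurd h ht⟩
  choose y hy using hlim
  have hdist : ∀ n, ∀ t ∈ D, dist (Y n t) (y t) ≤ (2 * e / 2 ^ n) * W t := by
    intro n t ht
    refine (dist_le_of_le_geometric_two_of_tendsto (hgeo t ht) (hy t ht) n).trans (le_of_eq ?_)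
    field_simp
  have hpow : Tendsto (fun n : ℕ => 2 * e / 2 ^ n * K) atTop (nhds 0) := by
    have : Tendsto (fun n : ℕ => (2 * e * K) * (1 / 2 : ℝ) ^ n) atTop (nhds (2 * e * K * 0)) :=
      (tendsto_pow_atTop_nhds_zero_of_lt_one (by norm_num) (by norm_num)).const_mul _
    rw [mul_zero] at this
    refine this.congr fun n => ?_
    rw [one_div, inv_pow]; field_simp
  have hunif : TendstoUniformlyOn Y y atTop D := by
    rw [Metric.tendstoUniformlyOn_iff]
    intro ε hε
    filter_upwards [hpow.eventually (gt_mem_nhds hε)] with n hn t ht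
    rw [dist_comm]
    refine (hdist n t ht).trans_lt (lt_of_le_of_lt ?_ hn)
    exact mul_le_mul_of_nonneg_left (hK t ht) (by positivity)
  have hyg : Good y := hcl Y y hYg hunif
  refine ⟨y, hyg, fun t ht => ?_⟩
  have h1 : Tendsto (fun n => Y (n + 1) t) atTop (nhds (T y t)) := by
    rw [tendsto_iff_dist_tendsto_zero]
    refine squeeze_zero (fun _ => dist_nonneg) (g := fun n : ℕ => 2 * e / 2 ^ n * K) ?_ hpow
    intro n
    rw [hYs]
    refine (hc (Y n) y (2 * e / 2 ^ n) (hYg n) hyg (by positivity) (hdist n) t ht).trans ?_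
    have h3 : 2 * e / 2 ^ n / 2 * W t ≤ 2 * e / 2 ^ n / 2 * K :=
      mul_le_mul_of_nonneg_left (hK t ht) (by positivity)
    have hK0 : 0 ≤ 2 * e / 2 ^ n * W t := dist_nonneg.trans (hdist n t ht)
    have : 2 * e / 2 ^ n * W t ≤ 2 * e / 2 ^ n * K :=
      mul_le_mul_of_nonneg_left (hK t ht) (by positivity)
    linarith
  exact tendsto_nhds_unique h1 ((tendsto_add_atTop_iff_nat 1).2 (hy t ht))

/-- The operator `k ↦ ∫₀¹ s^(κ-1) k(s t) ds`, which inverts `t d/dt + κ`. -/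
noncomputable def eulerInv (κ : ℝ) (k : ℂ → ℂ) (t : ℂ) : ℂ :=
  ∫ s in (0 : ℝ)..1, ((s ^ (κ - 1) : ℝ) : ℂ) * k (s * t)

theorem real_smul_mem_ball {r : ℝ} {t : ℂ} (ht : t ∈ Metric.ball (0 : ℂ) r) {s : ℝ}
    (hs : s ∈ Icc (0 : ℝ) 1) : (s : ℂ) * t ∈ Metric.ball (0 : ℂ) r := by
  rw [mem_ball_zero_iff] at ht ⊢
  rw [norm_mul, Complex.norm_real, Real.norm_eq_abs, abs_of_nonneg hs.1]
  nlinarith [hs.2, norm_nonneg t]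

theorem continuousOn_comp_real_mul {r : ℝ} {k : ℂ → ℂ} {t : ℂ}
    (hk : ContinuousOn k (Metric.ball 0 r)) (ht : t ∈ Metric.ball (0 : ℂ) r) :
    ContinuousOn (fun s : ℝ => k (s * t)) (Icc 0 1) :=
  hk.comp (by fun_prop) fun _ hs => real_smul_mem_ball ht hs

theorem intervalIntegrable_ofReal_rpow {κ : ℝ} (hκ : 0 < κ) :
    IntervalIntegrable (fun s : ℝ => ((s ^ (κ - 1) : ℝ) : ℂ)) MeasureTheory.volume 0 1 := by
  have h : IntervalIntegrable (fun s : ℝ => s ^ (κ - 1)) MeasureTheory.volume 0 1 :=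
    intervalIntegral.intervalIntegrable_rpow' (by linarith)
  exact ⟨h.1.ofReal, h.2.ofReal⟩

theorem eulerInv_intervalIntegrable {κ r : ℝ} (hκ : 0 < κ) {k : ℂ → ℂ} {t : ℂ}
    (hk : ContinuousOn k (Metric.ball 0 r)) (ht : t ∈ Metric.ball (0 : ℂ) r) :
    IntervalIntegrable (fun s : ℝ => ((s ^ (κ - 1) : ℝ) : ℂ) * k (s * t))
      MeasureTheory.volume 0 1 := by
  refine (intervalIntegrable_ofReal_rpow hκ).mul_continuousOn ?_
  rw [uIcc_of_le zero_le_one]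
  exact continuousOn_comp_real_mul hk ht

theorem norm_eulerInv_le {κ r B : ℝ} (hκ : 0 < κ) {k : ℂ → ℂ} {t : ℂ}
    (hB : ∀ z ∈ Metric.ball (0 : ℂ) r, ‖k z‖ ≤ B) (ht : t ∈ Metric.ball (0 : ℂ) r) :
    ‖eulerInv κ k t‖ ≤ B / κ := by
  have h1 : IntervalIntegrable (fun s : ℝ => s ^ (κ - 1) * B) MeasureTheory.volume 0 1 :=
    (intervalIntegral.intervalIntegrable_rpow' (by linarith)).mul_const _
  have := intervalIntegral.norm_integral_le_of_norm_le (zero_le_one' ℝ)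
    (f := fun s : ℝ => ((s ^ (κ - 1) : ℝ) : ℂ) * k (s * t)) (Eventually.of_forall fun s hs => by
      rw [norm_mul, Complex.norm_real, Real.norm_eq_abs, abs_of_nonneg (Real.rpow_nonneg hs.1.le _)]
      exact mul_le_mul_of_nonneg_left (hB _ (real_smul_mem_ball ht ⟨hs.1.le, hs.2⟩))
        (Real.rpow_nonneg hs.1.le _)) h1
  refine this.trans (le_of_eq ?_)
  rw [intervalIntegral.integral_mul_const, integral_rpow (Or.inl (by linarith))]
  simp [hκ.ne']
  ring

theorem norm_eulerInv_sub_le {κ r B : ℝ} (hκ : 0 < κ) {k k' : ℂ → ℂ} {t : ℂ}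
    (hk : ContinuousOn k (Metric.ball 0 r)) (hk' : ContinuousOn k' (Metric.ball 0 r))
    (hB : ∀ z ∈ Metric.ball (0 : ℂ) r, ‖k z - k' z‖ ≤ B) (ht : t ∈ Metric.ball (0 : ℂ) r) :
    ‖eulerInv κ k t - eulerInv κ k' t‖ ≤ B / κ := by
  have : eulerInv κ k t - eulerInv κ k' t = eulerInv κ (fun z => k z - k' z) t := by
    unfold eulerInv
    rw [← intervalIntegral.integral_sub (eulerInv_intervalIntegrable hκ hk ht)
      (eulerInv_intervalIntegrable hκ hk' ht)]
    simp only [mul_sub]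
  rw [this]
  exact norm_eulerInv_le hκ hB ht

theorem hasDerivAt_eulerInv {κ r : ℝ} (hκ : 0 < κ) {k : ℂ → ℂ} {t : ℂ}
    (hk : DifferentiableOn ℂ k (Metric.ball 0 r)) (ht : t ∈ Metric.ball (0 : ℂ) r) :
    ∃ d, HasDerivAt (eulerInv κ k) d t ∧ t * d + κ * eulerInv κ k t = k t := by
  have hopen : IsOpen (Metric.ball (0 : ℂ) r) := Metric.isOpen_ball
  have hk' : ContinuousOn (deriv k) (Metric.ball 0 r) := (hk.deriv hopen).continuousOn
  rw [mem_ball_zero_iff] at ht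
  obtain ⟨r', hr1, hr2⟩ := exists_between ht
  have hr'0 : 0 < r' := (norm_nonneg t).trans_lt hr1
  have hsub : Metric.closedBall (0 : ℂ) r' ⊆ Metric.ball 0 r := Metric.closedBall_subset_ball hr2
  obtain ⟨M, hM⟩ := (isCompact_closedBall (0 : ℂ) r').exists_bound_of_continuousOn (hk'.mono hsub)
  have hmem : ∀ x ∈ Metric.ball (0 : ℂ) r', x ∈ Metric.ball (0 : ℂ) r := fun x hx =>
    hsub (Metric.ball_subset_closedBall hx)
  have htr : t ∈ Metric.ball (0 : ℂ) r' := by rwa [mem_ball_zero_iff]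
  have key := intervalIntegral.hasDerivAt_integral_of_dominated_loc_of_deriv_le
    (μ := MeasureTheory.volume) (a := 0) (b := 1)
    (F := fun (x : ℂ) (s : ℝ) => ((s ^ (κ - 1) : ℝ) : ℂ) * k (s * x))
    (F' := fun (x : ℂ) (s : ℝ) => ((s ^ (κ - 1) : ℝ) : ℂ) * (deriv k (s * x) * s))
    (x₀ := t) (s := Metric.ball 0 r') (bound := fun s => s ^ (κ - 1) * M)
    (Metric.isOpen_ball.mem_nhds htr)
    (by
      filter_upwards [Metric.isOpen_ball.mem_nhds htr] with x hx
      exact (intervalIntegrable_iff.1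
        (eulerInv_intervalIntegrable hκ hk.continuousOn (hmem x hx))).aestronglyMeasurable)
    (eulerInv_intervalIntegrable hκ hk.continuousOn (hmem t htr))
    (by
      refine (intervalIntegrable_iff.1 ((intervalIntegrable_ofReal_rpow hκ).mul_continuousOn
        (g := fun s : ℝ => deriv k (s * t) * s) ?_)).aestronglyMeasurable
      rw [uIcc_of_le zero_le_one]
      exact (continuousOn_comp_real_mul hk' (hmem t htr)).mul (by fun_prop))
    (by
      refine Eventually.of_forall fun s hs x hx => ?_
      rw [uIoc_of_le zero_le_one] at hs
      have h0 := Real.rpow_nonneg hs.1.le (κ - 1)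
      rw [norm_mul, norm_mul, Complex.norm_real, Complex.norm_real, Real.norm_eq_abs,
        Real.norm_eq_abs, abs_of_nonneg h0, abs_of_nonneg hs.1.le]
      refine mul_le_mul_of_nonneg_left ?_ h0
      have h2 := hM _ (Metric.ball_subset_closedBall (real_smul_mem_ball hx ⟨hs.1.le, hs.2⟩))
      nlinarith [norm_nonneg (deriv k (s * x)), hs.1, hs.2])
    ((intervalIntegral.intervalIntegrable_rpow' (by linarith)).mul_const _)
    (by
      refine Eventually.of_forall fun s hs x hx => ?_
      rw [uIoc_of_le zero_le_one] at hs
      have hm := hmem _ (real_smul_mem_ball hx ⟨hs.1.le, hs.2⟩)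
      have h1 : HasDerivAt k (deriv k (s * x)) (s * x) :=
        (hk.differentiableAt (hopen.mem_nhds hm)).hasDerivAt
      have h2 : HasDerivAt (fun x : ℂ => (s : ℂ) * x) s x := by
        simpa using (hasDerivAt_id x).const_mul (s : ℂ)
      exact (h1.comp x h2).const_mul _)
  refine ⟨_, key.2, ?_⟩
  have hInt := key.1
  have hfund : ∫ s in (0 : ℝ)..1, (t * (((s ^ (κ - 1) : ℝ) : ℂ) * (deriv k (s * t) * s))
      + κ * (((s ^ (κ - 1) : ℝ) : ℂ) * k (s * t))) =
      ((1 : ℝ) ^ κ : ℝ) * k ((1 : ℝ) * t) - ((0 : ℝ) ^ κ : ℝ) * k ((0 : ℝ) * t) := by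
    refine intervalIntegral.integral_eq_sub_of_hasDerivAt_of_le zero_le_one
      (f := fun s : ℝ => ((s ^ κ : ℝ) : ℂ) * k (s * t)) ?_ ?_ ?_
    · refine ContinuousOn.mul ?_ (continuousOn_comp_real_mul hk.continuousOn (hmem t htr))
      exact (Complex.continuous_ofReal.comp (Real.continuous_rpow_const hκ.le)).continuousOn
    · intro s hs
      have hm := hmem _ (real_smul_mem_ball htr ⟨hs.1.le, hs.2.le⟩)
      have h1 : HasDerivAt k (deriv k (s * t)) (s * t) :=
        (hk.differentiableAt (hopen.mem_nhds hm)).hasDerivAt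
      have h2 : HasDerivAt (fun x : ℂ => x * t) t (s : ℂ) := by
        simpa using (hasDerivAt_id (s : ℂ)).mul_const t
      have h3 : HasDerivAt (fun x : ℝ => k (x * t)) (deriv k (s * t) * t) s :=
        (h1.comp (s : ℂ) h2).comp_ofReal
      have h4 : HasDerivAt (fun x : ℝ => ((x ^ κ : ℝ) : ℂ)) ((κ * s ^ (κ - 1) : ℝ) : ℂ) s :=
        (Real.hasDerivAt_rpow_const (Or.inl hs.1.ne')).ofReal_comp
      refine (h4.mul h3).congr_deriv ?_
      have h5 : s ^ κ = s ^ (κ - 1) * s := by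
        rw [← Real.rpow_add_one hs.1.ne']; simp
      rw [h5]; push_cast; ring
    · exact (hInt.const_mul t).add
        ((eulerInv_intervalIntegrable hκ hk.continuousOn (hmem t htr)).const_mul _)
  rw [intervalIntegral.integral_add (hInt.const_mul t)
    ((eulerInv_intervalIntegrable hκ hk.continuousOn (hmem t htr)).const_mul _),
    intervalIntegral.integral_const_mul, intervalIntegral.integral_const_mul] at hfund
  rw [Real.zero_rpow hκ.ne'] at hfund
  simpa [eulerInv] using hfund

theorem eulerInv_im_eq_zero {κ r : ℝ} {k : ℂ → ℂ} {t : ℂ}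
    (hk : ∀ z ∈ Metric.ball (0 : ℂ) r, z.im = 0 → (k z).im = 0) (ht : t ∈ Metric.ball (0 : ℂ) r)
    (him : t.im = 0) : (eulerInv κ k t).im = 0 := by
  have : eulerInv κ k t = ((∫ s in (0 : ℝ)..1, (s ^ (κ - 1) * (k (s * t)).re) : ℝ) : ℂ) := by
    rw [← intervalIntegral.integral_ofReal]
    refine intervalIntegral.integral_congr fun s hs => ?_
    rw [uIcc_of_le zero_le_one] at hs
    have h1 := hk _ (real_smul_mem_ball ht hs) (by simp [him])
    apply Complex.ext <;> simp [h1]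
  rw [this, Complex.ofReal_im]

theorem exists_holomorphic_singular_ode {H : ℂ × ℂ × ℂ → ℂ} {u₀ w₀ κ : ℝ} {m : ℂ → ℂ}
    (hκ : 0 < κ) (hm : Differentiable ℂ m) (hmr : ∀ z : ℂ, z.im = 0 → (m z).im = 0)
    (hH : AnalyticAt ℂ H (0, (u₀ : ℂ), 0))
    (hHr : ∀ᶠ p in nhds ((0, (u₀ : ℂ), 0) : ℂ × ℂ × ℂ),
      p.1.im = 0 → p.2.1.im = 0 → p.2.2.im = 0 → (H p).im = 0) :
    ∃ r > 0, ∃ y U : ℂ → ℂ, DifferentiableOn ℂ y (Metric.ball 0 r) ∧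
      (∀ t ∈ Metric.ball (0 : ℂ) r, t.im = 0 → (y t).im = 0 ∧ (U t).im = 0) ∧ U 0 = u₀ ∧
      ∀ t ∈ Metric.ball (0 : ℂ) r, HasDerivAt U (w₀ + m t * y t) t ∧
        t * deriv y t + κ * y t = H (t, U t, t * y t) := by
  set p₀ : ℂ × ℂ × ℂ := (0, (u₀ : ℂ), 0) with hp₀
  obtain ⟨L, s, hs, hL⟩ :=
    (hH.contDiffAt (n := 1)).exists_lipschitzOnWith
  have hdiff : ∀ᶠ p in nhds p₀, DifferentiableAt ℂ H p :=
    hH.eventually_analyticAt.mono fun p hp => hp.differentiableAt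
  have hbd : ∀ᶠ p in nhds p₀, ‖H p‖ < ‖H p₀‖ + 1 :=
    hH.continuousAt.norm.eventually (gt_mem_nhds (by linarith))
  obtain ⟨δ, hδ, hball⟩ := Metric.eventually_nhds_iff_ball.1
    (hdiff.and (hbd.and (hHr.and (eventually_mem_set.2 hs))))
  set B : ℝ := ‖H p₀‖ + 1 with hB
  have hB0 : 0 < B := by positivity
  set M : ℝ := B / κ with hM
  have hM0 : 0 < M := by positivity
  obtain ⟨Km, hKm⟩ := (isCompact_closedBall (0 : ℂ) 1).exists_bound_of_continuousOn
    hm.continuous.continuousOn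
  have hKm0 : 0 ≤ Km := (norm_nonneg _).trans (hKm 0 (by simp))
  have hL0 : (0 : ℝ) ≤ L := L.2
  obtain ⟨r, hr0, hr1, hrδ, hrL⟩ : ∃ r : ℝ, 0 < r ∧ r ≤ 1 ∧
      r * (|w₀| + Km * M + M + 1) < δ ∧ L * (r * (Km + 1)) / κ ≤ 1 / 2 := by
    refine ⟨min 1 (min (δ / (2 * (|w₀| + Km * M + M + 1))) (κ / (2 * (L * (Km + 1) + 1)))),
      by positivity, min_le_left _ _, ?_, ?_⟩
    · have h1 : min 1 (min (δ / (2 * (|w₀| + Km * M + M + 1))) (κ / (2 * (L * (Km + 1) + 1))))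
          ≤ δ / (2 * (|w₀| + Km * M + M + 1)) := (min_le_right _ _).trans (min_le_left _ _)
      refine lt_of_le_of_lt (mul_le_mul_of_nonneg_right h1 (by positivity)) ?_
      rw [div_mul_eq_mul_div, mul_comm (2 : ℝ), ← div_div, mul_div_assoc,
        div_self (by positivity), mul_one]
      linarith
    · have h1 : min 1 (min (δ / (2 * (|w₀| + Km * M + M + 1))) (κ / (2 * (L * (Km + 1) + 1))))
          ≤ κ / (2 * (L * (Km + 1) + 1)) := (min_le_right _ _).trans (min_le_right _ _)
      rw [div_le_iff₀ hκ]
      have h2 := mul_le_mul_of_nonneg_right h1 (show (0 : ℝ) ≤ L * (Km + 1) by positivity)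
      have h3 : κ / (2 * (L * (Km + 1) + 1)) * (L * (Km + 1)) ≤ 1 / 2 * κ := by
        rw [div_mul_eq_mul_div, div_le_iff₀ (by positivity)]
        nlinarith
      linarith
  set D : Set ℂ := Metric.ball 0 r with hD
  have hDn : ∀ t ∈ D, ‖t‖ < r := fun t ht => by simpa [hD] using ht
  let Uop : (ℂ → ℂ) → ℂ → ℂ := fun y t => u₀ + w₀ * t + t * eulerInv 1 (fun z => m z * y z) t
  let T : (ℂ → ℂ) → ℂ → ℂ := fun y => eulerInv κ (fun t => H (t, Uop y t, t * y t))
  let Good : (ℂ → ℂ) → Prop := fun y => DifferentiableOn ℂ y D ∧ (∀ t ∈ D, ‖y t‖ ≤ M) ∧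
    ∀ t ∈ D, t.im = 0 → (y t).im = 0
  have hmb : ∀ z ∈ D, ‖m z‖ ≤ Km := fun z hz => hKm z (by
    simpa using (hDn z hz).le.trans hr1)
  have hmy : ∀ y, Good y → DifferentiableOn ℂ (fun z => m z * y z) D := fun y hy =>
    hm.differentiableOn.mul hy.1
  have hUd : ∀ y, Good y → ∀ t ∈ D, HasDerivAt (Uop y) (w₀ + m t * y t) t := by
    intro y hy t ht
    obtain ⟨d, hd, he⟩ := hasDerivAt_eulerInv one_pos (hmy y hy) ht
    have h2 : HasDerivAt (fun t : ℂ => (u₀ : ℂ) + w₀ * t) w₀ t := by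
      simpa using ((hasDerivAt_id t).const_mul (w₀ : ℂ)).const_add (u₀ : ℂ)
    refine (h2.add ((hasDerivAt_id t).mul hd)).congr_deriv ?_
    rw [← he]; simp; ring
  have hmem : ∀ y, Good y → ∀ t ∈ D, (t, Uop y t, t * y t) ∈ Metric.ball p₀ δ := by
    intro y hy t ht
    have h1 : ‖eulerInv 1 (fun z => m z * y z) t‖ ≤ Km * M / 1 :=
      norm_eulerInv_le one_pos (fun z hz => by
        rw [norm_mul]
        exact mul_le_mul (hmb z hz) (hy.2.1 z hz) (norm_nonneg _) hKm0) ht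
    have ht' := (hDn t ht).le
    have hp : 0 ≤ Km * M := by positivity
    have hw := abs_nonneg w₀
    rw [mem_ball_iff_norm, hp₀, Prod.mk_sub_mk, Prod.mk_sub_mk, Prod.norm_def, Prod.norm_def]
    refine max_lt ?_ (max_lt ?_ ?_)
    · simp only [sub_zero]; nlinarith
    · simp only [Uop]
      have : (u₀ : ℂ) + w₀ * t + t * eulerInv 1 (fun z => m z * y z) t - u₀ =
        w₀ * t + t * eulerInv 1 (fun z => m z * y z) t := by ring
      rw [this]
      refine (norm_add_le _ _).trans_lt ?_
      rw [norm_mul, norm_mul, Complex.norm_real, Real.norm_eq_abs]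
      have h4 : |w₀| * ‖t‖ ≤ |w₀| * r := mul_le_mul_of_nonneg_left ht' hw
      have h5 : ‖t‖ * ‖eulerInv 1 (fun z => m z * y z) t‖ ≤ r * (Km * M) :=
        mul_le_mul ht' (by simpa using h1) (norm_nonneg _) hr0.le
      nlinarith
    · simp only [sub_zero]
      rw [norm_mul]
      have h5 : ‖t‖ * ‖y t‖ ≤ r * M := mul_le_mul ht' (hy.2.1 t ht) (norm_nonneg _) hr0.le
      nlinarith
  have hHd : ∀ y, Good y → DifferentiableOn ℂ (fun t => H (t, Uop y t, t * y t)) D := by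
    intro y hy t ht
    have h1 := (hball _ (hmem y hy t ht)).1
    have h2 : DifferentiableAt ℂ y t := hy.1.differentiableAt (Metric.isOpen_ball.mem_nhds ht)
    have h3 : DifferentiableAt ℂ (fun t => (t, Uop y t, t * y t)) t :=
      differentiableAt_id.prodMk
        ((hUd y hy t ht).differentiableAt.prodMk (differentiableAt_id.mul h2))
    exact (DifferentiableAt.comp t (g := H) h1 h3).differentiableWithinAt
  have hUr : ∀ y, Good y → ∀ t ∈ D, t.im = 0 → (Uop y t).im = 0 := by
    intro y hy t ht him
    have := eulerInv_im_eq_zero (κ := 1) (k := fun z => m z * y z) (r := r) (fun z hz hzi => by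
      simp [hmr z hzi, hy.2.2 z hz hzi]) ht him
    simp [Uop, him, this]
  have hfix := exists_fixed_of_weighted_contraction D (fun _ => 1) Good T
    (by
      intro y hy
      refine ⟨fun t ht => ?_, fun t ht => ?_, fun t ht him => ?_⟩
      · obtain ⟨d, hd, -⟩ := hasDerivAt_eulerInv hκ (hHd y hy) ht
        exact hd.differentiableAt.differentiableWithinAt
      · exact norm_eulerInv_le hκ (fun z hz => (hball _ (hmem y hy z hz)).2.1.le) ht
      · exact eulerInv_im_eq_zero (r := r) (fun z hz hzi =>
          (hball _ (hmem y hy z hz)).2.2.1 hzi (hUr y hy z hz hzi)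
            (by simp [hzi, hy.2.2 z hz hzi])) ht him)
    (by
      intro y y' e hy hy' he hyy t ht
      simp only [mul_one] at hyy ⊢
      rw [dist_eq_norm]
      have key : ∀ z ∈ D, ‖H (z, Uop y z, z * y z) - H (z, Uop y' z, z * y' z)‖ ≤
          L * (r * (Km + 1) * e) := by
        intro z hz
        have h1 := hL.norm_sub_le (hball _ (hmem y hy z hz)).2.2.2
          (hball _ (hmem y' hy' z hz)).2.2.2
        refine h1.trans (mul_le_mul_of_nonneg_left ?_ hL0)
        have hz' := (hDn z hz).le
        have hre : 0 ≤ r * e := by positivity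
        have hrk : 0 ≤ r * e * Km := by positivity
        have hee : ‖eulerInv 1 (fun z => m z * y z) z - eulerInv 1 (fun z => m z * y' z) z‖
            ≤ Km * e / 1 := norm_eulerInv_sub_le one_pos (hmy y hy).continuousOn
              (hmy y' hy').continuousOn (fun x hx => by
                rw [← mul_sub, norm_mul]
                refine mul_le_mul (hmb x hx) ?_ (norm_nonneg _) hKm0
                simpa [dist_eq_norm] using hyy x hx) hz
        rw [Prod.mk_sub_mk, Prod.mk_sub_mk, Prod.norm_def, Prod.norm_def]
        refine max_le ?_ (max_le ?_ ?_)
        · simp only [sub_self, norm_zero]; positivity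
        · have : Uop y z - Uop y' z = z * (eulerInv 1 (fun z => m z * y z) z -
            eulerInv 1 (fun z => m z * y' z) z) := by simp only [Uop]; ring
          simp only [this, norm_mul]
          have := mul_le_mul hz' hee (norm_nonneg _) hr0.le
          rw [div_one] at this
          linarith
        · simp only [← mul_sub, norm_mul]
          have := mul_le_mul hz' (hyy z hz) dist_nonneg hr0.le
          rw [dist_eq_norm] at this
          linarith
      refine (norm_eulerInv_sub_le hκ (hHd y hy).continuousOn (hHd y' hy').continuousOn
        key ht).trans ?_
      have := mul_le_mul_of_nonneg_right hrL he
      calc L * (r * (Km + 1) * e) / κ = L * (r * (Km + 1)) / κ * e := by ring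
        _ ≤ _ := by linarith)
    ⟨1, fun _ _ => le_rfl⟩
    (by
      intro Y y hY hlim
      have hpt : ∀ t ∈ D, Tendsto (fun n => Y n t) atTop (nhds (y t)) :=
        fun t ht => hlim.tendsto_at ht
      refine ⟨hlim.tendstoLocallyUniformlyOn.differentiableOn
        (Eventually.of_forall fun n => (hY n).1) Metric.isOpen_ball, fun t ht => ?_,
        fun t ht him => ?_⟩
      · exact le_of_tendsto (hpt t ht).norm (Eventually.of_forall fun n => (hY n).2.1 t ht)
      · have h1 := (Complex.continuous_im.tendsto _).comp (hpt t ht)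
        exact tendsto_nhds_unique h1 (tendsto_const_nhds.congr fun n =>
          ((hY n).2.2 t ht him).symm))
    (fun _ => 0) ⟨differentiableOn_const _, by simp [hM0.le], by simp⟩ M hM0.le
    (by
      intro t ht
      rw [dist_comm, dist_eq_norm, sub_zero, mul_one]
      have hg : Good (fun _ => 0) := ⟨differentiableOn_const _, by simp [hM0.le], by simp⟩
      exact norm_eulerInv_le hκ (fun z hz => (hball _ (hmem _ hg z hz)).2.1.le) ht)
  obtain ⟨y, hy, hTy⟩ := hfix
  refine ⟨r, hr0, y, Uop y, hy.1, fun t ht him => ⟨hy.2.2 t ht him, hUr y hy t ht him⟩, ?_,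
    fun t ht => ⟨hUd y hy t ht, ?_⟩⟩
  · simp [Uop]
  · obtain ⟨d, hd, he⟩ := hasDerivAt_eulerInv hκ (hHd y hy) ht
    have h1 : y =ᶠ[nhds t] T y := by
      filter_upwards [Metric.isOpen_ball.mem_nhds ht] with z hz using (hTy z hz).symm
    rw [h1.deriv_eq, hd.deriv, ← hTy t ht]
    have : T y t = eulerInv κ (fun t => H (t, Uop y t, t * y t)) t := rfl
    rw [this, he, ← this, hTy t ht]

theorem exists_real_analytic_singular_ode {H : ℂ × ℂ × ℂ → ℂ} {u₀ w₀ κ : ℝ} {m : ℂ → ℂ}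
    {mr : ℝ → ℝ} (hκ : 0 < κ) (hm : Differentiable ℂ m) (hmr : ∀ x : ℝ, m x = mr x)
    (hH : AnalyticAt ℂ H (0, (u₀ : ℂ), 0)) {h : ℝ → ℝ → ℝ → ℝ}
    (hHr : ∀ᶠ p in nhds ((0, u₀, 0) : ℝ × ℝ × ℝ), H (p.1, p.2.1, p.2.2) = h p.1 p.2.1 p.2.2) :
    ∃ r > 0, ∃ y U : ℝ → ℝ, AnalyticOnNhd ℝ U (Ioo (-r) r) ∧ U 0 = u₀ ∧
      ∀ t ∈ Ioo (-r) r, HasDerivAt U (w₀ + mr t * y t) t ∧ DifferentiableAt ℝ y t ∧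
        t * deriv y t + κ * y t = h t (U t) (t * y t) := by
  have hre : Tendsto (fun p : ℂ × ℂ × ℂ => (p.1.re, p.2.1.re, p.2.2.re))
      (nhds (0, (u₀ : ℂ), 0)) (nhds (0, u₀, 0)) := by
    have : Continuous (fun p : ℂ × ℂ × ℂ => (p.1.re, p.2.1.re, p.2.2.re)) := by fun_prop
    simpa using this.tendsto (0, (u₀ : ℂ), 0)
  obtain ⟨r, hr, y, U, hy, him, hU0, hode⟩ := exists_holomorphic_singular_ode (w₀ := w₀) hκ hm
    (fun z hz => by
      have : z = (z.re : ℂ) := Complex.ext rfl (by simp [hz])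
      rw [this, hmr, Complex.ofReal_im]) hH
    (by
      filter_upwards [hre.eventually hHr] with p hp h1 h2 h3
      have e : p = ((p.1.re : ℂ), (p.2.1.re : ℂ), (p.2.2.re : ℂ)) := by
        refine Prod.ext ?_ (Prod.ext ?_ ?_) <;> apply Complex.ext <;> simp [h1, h2, h3]
      rw [e, hp, Complex.ofReal_im])
  have hball : ∀ x ∈ Ioo (-r) r, (x : ℂ) ∈ Metric.ball (0 : ℂ) r := by
    intro x hx
    rw [mem_ball_zero_iff, Complex.norm_real, Real.norm_eq_abs]
    exact abs_lt.2 hx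
  have hreal : ∀ x ∈ Ioo (-r) r, y x = ((y x).re : ℂ) ∧ U x = ((U x).re : ℂ) := by
    intro x hx
    obtain ⟨h1, h2⟩ := him x (hball x hx) (by simp)
    exact ⟨Complex.ext rfl (by simp [h1]), Complex.ext rfl (by simp [h2])⟩
  have hyd : ∀ x ∈ Ioo (-r) r, HasDerivAt (fun x : ℝ => (y x).re) (deriv y x).re x := fun x hx =>
    (hy.differentiableAt (Metric.isOpen_ball.mem_nhds (hball x hx))).hasDerivAt.real_of_complex
  have hUdiff : DifferentiableOn ℂ U (Metric.ball 0 r) := fun t ht =>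
    (hode t ht).1.differentiableAt.differentiableWithinAt
  have hUd : ∀ x ∈ Ioo (-r) r,
      HasDerivAt (fun x : ℝ => (U x).re) (w₀ + mr x * (y x).re) x := by
    intro x hx
    have := (hode x (hball x hx)).1.real_of_complex
    rw [hmr, (hreal x hx).1] at this
    simpa using this
  have hcont : ContinuousAt (fun x : ℝ => ((x, (U x).re, x * (y x).re) : ℝ × ℝ × ℝ)) 0 := by
    have h0 : (0 : ℝ) ∈ Ioo (-r) r := ⟨by linarith, hr⟩
    exact continuousAt_id.prodMk ((hUd 0 h0).continuousAt.prodMk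
      (continuousAt_id.mul (hyd 0 h0).continuousAt))
  have hev := hcont.tendsto.eventually (p := fun p : ℝ × ℝ × ℝ =>
    H (p.1, p.2.1, p.2.2) = h p.1 p.2.1 p.2.2) (by simpa [hU0] using hHr)
  obtain ⟨r', hr', hev⟩ := Metric.eventually_nhds_iff_ball.1 hev
  have hsub : ∀ x ∈ Ioo (-(min r r')) (min r r'), x ∈ Ioo (-r) r ∧ x ∈ Metric.ball (0 : ℝ) r' := by
    intro x hx
    rw [mem_ball_zero_iff, Real.norm_eq_abs]
    have h1 := abs_lt.2 hx
    exact ⟨abs_lt.1 (h1.trans_le (min_le_left _ _)), h1.trans_le (min_le_right _ _)⟩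
  refine ⟨min r r', lt_min hr hr', fun x => (y x).re, fun x => (U x).re, ?_, ?_, ?_⟩
  · intro x hx
    have h1 : AnalyticAt ℂ U x := hUdiff.analyticAt (Metric.isOpen_ball.mem_nhds
      (hball x (hsub x hx).1))
    exact h1.re_ofReal
  · simp [hU0]
  · intro x hx
    obtain ⟨hx1, hx2⟩ := hsub x hx
    refine ⟨hUd x hx1, (hyd x hx1).differentiableAt, ?_⟩
    have h1 := (hode x (hball x hx1)).2
    have h2 := hev x hx2
    simp only at h2
    rw [(hreal x hx1).2, (hreal x hx1).1] at h1
    have h3 : H (↑x, ↑(U ↑x).re, ↑x * ↑(y ↑x).re) = ((h x (U x).re (x * (y x).re) : ℝ) : ℂ) := by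
      rw [← h2]; push_cast; rfl
    rw [h3] at h1
    rw [(hyd x hx1).deriv]
    simpa using congrArg Complex.re h1

/-- The weight `x^d (1-x²)^(κ-1)`. -/
noncomputable def wB (d : ℕ) (κ x : ℝ) : ℝ := x ^ d * (1 - x ^ 2) ^ (κ - 1)

/-- The weight `x^d (1-x²)^κ`. -/
noncomputable def wA (d : ℕ) (κ x : ℝ) : ℝ := x ^ d * (1 - x ^ 2) ^ κ

noncomputable def fluxOp (d : ℕ) (κ : ℝ) (g : ℝ → ℝ) (x : ℝ) : ℝ :=
  ∫ y in (0 : ℝ)..x, wB d κ y * g y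

noncomputable def solOp (d : ℕ) (κ : ℝ) (g : ℝ → ℝ) (x : ℝ) : ℝ :=
  ∫ y in (0 : ℝ)..x, fluxOp d κ g y / wA d κ y

section Volterra

variable {d : ℕ} {κ : ℝ}

theorem wB_nonneg {x : ℝ} (hx : x ∈ Icc (0 : ℝ) 1) : 0 ≤ wB d κ x :=
  mul_nonneg (pow_nonneg hx.1 _) (Real.rpow_nonneg (by nlinarith [hx.1, hx.2]) _)

theorem wA_pos {x : ℝ} (hx : x ∈ Ioo (0 : ℝ) 1) : 0 < wA d κ x :=
  mul_pos (pow_pos hx.1 _) (Real.rpow_pos_of_pos (by nlinarith [hx.1, hx.2]) _)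

theorem wA_eq {x : ℝ} (hx : x ∈ Ioo (0 : ℝ) 1) : wA d κ x = wB d κ x * (1 - x ^ 2) := by
  have h : (0 : ℝ) < 1 - x ^ 2 := by nlinarith [hx.1, hx.2]
  rw [wA, wB, mul_assoc, ← Real.rpow_add_one h.ne', sub_add_cancel]

theorem one_sub_rpow_intervalIntegrable {s : ℝ} (hs : -1 < s) (a b : ℝ) :
    IntervalIntegrable (fun y : ℝ => (1 - y) ^ s) MeasureTheory.volume a b := by
  have := (intervalIntegral.intervalIntegrable_rpow' (a := 1 - a) (b := 1 - b) hs).comp_sub_left 1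
  simpa using this

theorem hasDerivAt_one_sub_rpow {s x : ℝ} (hx : x < 1) :
    HasDerivAt (fun y : ℝ => (1 - y) ^ s) (-(s * (1 - x) ^ (s - 1))) x := by
  have h1 : HasDerivAt (fun y : ℝ => 1 - y) (-1) x := by
    simpa using (hasDerivAt_id x).const_sub 1
  have := h1.rpow_const (p := s) (Or.inl (by linarith))
  convert! this using 1
  ring

theorem wB_le (hκ1 : κ < 1) {y t : ℝ} (hy : 0 ≤ y) (hyt : y ≤ t) (ht : t ≤ 1) :
    wB d κ y ≤ t ^ d * (1 - y) ^ (κ - 1) := by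
  rcases eq_or_lt_of_le (hyt.trans ht) with h | h
  · subst h
    have : t = 1 := le_antisymm ht hyt
    simp [wB, this]
  · refine mul_le_mul (pow_le_pow_left₀ hy hyt _) ?_ (Real.rpow_nonneg (by nlinarith) _)
      (pow_nonneg (hy.trans hyt) _)
    exact Real.rpow_le_rpow_of_nonpos (by linarith) (by nlinarith) (by linarith)

theorem wB_intervalIntegrable (hκ : 0 < κ) (hκ1 : κ < 1) :
    IntervalIntegrable (wB d κ) MeasureTheory.volume 0 1 := by
  refine (one_sub_rpow_intervalIntegrable (s := κ - 1) (by linarith) 0 1).mono_fun ?_ ?_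
  · exact (Measurable.aestronglyMeasurable (by unfold wB; fun_prop))
  · rw [EventuallyLE, MeasureTheory.ae_restrict_iff' measurableSet_uIoc]
    refine Eventually.of_forall fun y hy => ?_
    rw [uIoc_of_le zero_le_one] at hy
    rw [Real.norm_eq_abs, Real.norm_eq_abs, abs_of_nonneg (wB_nonneg ⟨hy.1.le, hy.2⟩),
      abs_of_nonneg (Real.rpow_nonneg (by linarith [hy.2]) _)]
    simpa using wB_le (d := d) hκ1 hy.1.le hy.2 le_rfl

theorem wB_mul_intervalIntegrable (hκ : 0 < κ) (hκ1 : κ < 1) {g : ℝ → ℝ}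
    (hg : ContinuousOn g (Icc 0 1)) :
    IntervalIntegrable (fun y => wB d κ y * g y) MeasureTheory.volume 0 1 :=
  (wB_intervalIntegrable hκ hκ1).mul_continuousOn (by rwa [uIcc_of_le zero_le_one])

theorem intervalIntegrable_sub_Icc {F : ℝ → ℝ}
    (h : IntervalIntegrable F MeasureTheory.volume 0 1) {a b : ℝ} (ha : a ∈ Icc (0 : ℝ) 1)
    (hb : b ∈ Icc (0 : ℝ) 1) : IntervalIntegrable F MeasureTheory.volume a b := by
  refine h.mono_set ?_
  rw [uIcc_of_le zero_le_one]
  exact uIcc_subset_Icc ha hb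

theorem continuousOn_primitive_Icc {F : ℝ → ℝ}
    (h : IntervalIntegrable F MeasureTheory.volume 0 1) :
    ContinuousOn (fun x => ∫ y in (0 : ℝ)..x, F y) (Icc 0 1) := by
  have := intervalIntegral.continuousOn_primitive_interval (f := F) (a := 0) (b := 1)
    (μ := MeasureTheory.volume)
    (by rw [uIcc_of_le zero_le_one]; exact (intervalIntegrable_iff_integrableOn_Icc_of_le
      zero_le_one).1 h)
  rwa [uIcc_of_le zero_le_one] at this

theorem hasDerivAt_primitive_Ioo {F : ℝ → ℝ}
    (h : IntervalIntegrable F MeasureTheory.volume 0 1) (hF : ContinuousOn F (Ioo 0 1)) {x : ℝ}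
    (hx : x ∈ Ioo (0 : ℝ) 1) : HasDerivAt (fun x => ∫ y in (0 : ℝ)..x, F y) (F x) x :=
  intervalIntegral.integral_hasDerivAt_right
    (intervalIntegrable_sub_Icc h ⟨le_rfl, zero_le_one⟩ ⟨hx.1.le, hx.2.le⟩)
    (hF.stronglyMeasurableAtFilter isOpen_Ioo x hx) (hF.continuousAt (isOpen_Ioo.mem_nhds hx))

theorem continuousOn_wB : ContinuousOn (wB d κ) (Ioo 0 1) := by
  unfold wB
  refine ContinuousOn.mul (by fun_prop) (ContinuousOn.rpow_const (by fun_prop) fun x hx => ?_)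
  left; nlinarith [hx.1, hx.2]

theorem continuousOn_wA : ContinuousOn (wA d κ) (Ioo 0 1) := by
  unfold wA
  refine ContinuousOn.mul (by fun_prop) (ContinuousOn.rpow_const (by fun_prop) fun x hx => ?_)
  left; nlinarith [hx.1, hx.2]

theorem continuousOn_fluxOp (hκ : 0 < κ) (hκ1 : κ < 1) {g : ℝ → ℝ}
    (hg : ContinuousOn g (Icc 0 1)) : ContinuousOn (fluxOp d κ g) (Icc 0 1) :=
  continuousOn_primitive_Icc (wB_mul_intervalIntegrable hκ hκ1 hg)

theorem hasDerivAt_fluxOp (hκ : 0 < κ) (hκ1 : κ < 1) {g : ℝ → ℝ}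
    (hg : ContinuousOn g (Icc 0 1)) {x : ℝ} (hx : x ∈ Ioo (0 : ℝ) 1) :
    HasDerivAt (fluxOp d κ g) (wB d κ x * g x) x :=
  hasDerivAt_primitive_Ioo (wB_mul_intervalIntegrable hκ hκ1 hg)
    (continuousOn_wB.mul (hg.mono Ioo_subset_Icc_self)) hx

theorem abs_fluxOp_le (hκ : 0 < κ) (hκ1 : κ < 1) {g : ℝ → ℝ} {x G : ℝ} (hx : x ∈ Icc (0 : ℝ) 1)
    (hG0 : 0 ≤ G) (hG : ∀ y ∈ Icc 0 x, |g y| ≤ G) : |fluxOp d κ g x| ≤ G * (x ^ (d + 1) / κ) := by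
  have hInt : IntervalIntegrable (fun y : ℝ => x ^ d * (1 - y) ^ (κ - 1) * G)
      MeasureTheory.volume 0 x :=
    ((one_sub_rpow_intervalIntegrable (by linarith) 0 x).const_mul _).mul_const _
  have h1 : ‖fluxOp d κ g x‖ ≤ ∫ y in (0 : ℝ)..x, x ^ d * (1 - y) ^ (κ - 1) * G := by
    refine intervalIntegral.norm_integral_le_of_norm_le hx.1
      (Eventually.of_forall fun y hy => ?_) hInt
    rw [norm_mul, Real.norm_eq_abs, Real.norm_eq_abs,
      abs_of_nonneg (wB_nonneg ⟨hy.1.le, hy.2.trans hx.2⟩)]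
    exact mul_le_mul (wB_le hκ1 hy.1.le hy.2 hx.2) (hG y ⟨hy.1.le, hy.2⟩) (abs_nonneg _)
      (mul_nonneg (pow_nonneg hx.1 _) (Real.rpow_nonneg (by linarith [hy.2, hx.2]) _))
  have h2 : ∫ y in (0 : ℝ)..x, (1 - y) ^ (κ - 1) = (1 - (1 - x) ^ κ) / κ := by
    have := intervalIntegral.integral_comp_sub_left (fun y : ℝ => y ^ (κ - 1)) (a := 0) (b := x) 1
    rw [this, integral_rpow (Or.inl (by linarith))]
    simp
  rw [intervalIntegral.integral_mul_const, intervalIntegral.integral_const_mul, h2,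
    Real.norm_eq_abs] at h1
  refine h1.trans ?_
  have h3 : 1 - x ≤ (1 - x) ^ κ := by
    rcases eq_or_lt_of_le (sub_nonneg.2 hx.2) with h | h
    · rw [← h, Real.zero_rpow hκ.ne']
    · have := Real.rpow_le_rpow_of_exponent_ge h (by linarith [hx.1]) hκ1.le
      rwa [Real.rpow_one] at this
  have h4 : x ^ d * ((1 - (1 - x) ^ κ) / κ) ≤ x ^ (d + 1) / κ := by
    rw [pow_succ, mul_div_assoc]
    exact mul_le_mul_of_nonneg_left (div_le_div_of_nonneg_right (by linarith) hκ.le)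
      (pow_nonneg hx.1 _)
  nlinarith

theorem abs_fluxOp_div_le (hκ : 0 < κ) (hκ1 : κ < 1) {g : ℝ → ℝ} {x G : ℝ}
    (hx : x ∈ Icc (0 : ℝ) 1) (hG0 : 0 ≤ G) (hG : ∀ y ∈ Icc 0 x, |g y| ≤ G) :
    |fluxOp d κ g x / wA d κ x| ≤ G * (x * ((1 - x) ^ (-κ) / κ)) := by
  have hrhs : 0 ≤ G * (x * ((1 - x) ^ (-κ) / κ)) :=
    mul_nonneg hG0 (mul_nonneg hx.1 (div_nonneg (Real.rpow_nonneg (by linarith [hx.2]) _) hκ.le))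
  rcases eq_or_lt_of_le hx.1 with h0 | h0
  · simp [← h0, fluxOp]
  rcases eq_or_lt_of_le hx.2 with h1 | h1
  · have : wA d κ x = 0 := by simp [wA, h1, Real.zero_rpow hκ.ne']
    rw [this, div_zero, abs_zero]
    exact hrhs
  have hA := wA_pos (d := d) (κ := κ) ⟨h0, h1⟩
  rw [abs_div, abs_of_pos hA, div_le_iff₀ hA]
  refine (abs_fluxOp_le hκ hκ1 hx hG0 hG).trans ?_
  have h2 : (1 - x) ^ κ ≤ (1 - x ^ 2) ^ κ :=
    Real.rpow_le_rpow (by linarith) (by nlinarith) hκ.le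
  have h3 : (1 - x) ^ (-κ) * (1 - x) ^ κ = 1 := by
    rw [← Real.rpow_add (by linarith)]; simp
  have h4 : 0 < (1 - x) ^ (-κ) := Real.rpow_pos_of_pos (by linarith) _
  have h5 : 1 ≤ (1 - x) ^ (-κ) * (1 - x ^ 2) ^ κ := by
    exact h3.symm.le.trans (mul_le_mul_of_nonneg_left h2 h4.le)
  have h6 : G * (x * ((1 - x) ^ (-κ) / κ)) * wA d κ x =
      G * (x ^ (d + 1) / κ) * ((1 - x) ^ (-κ) * (1 - x ^ 2) ^ κ) := by
    rw [wA]; ring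
  rw [h6]
  exact le_mul_of_one_le_right (mul_nonneg hG0 (div_nonneg (pow_nonneg hx.1 _) hκ.le)) h5

theorem continuousOn_fluxOp_div (hκ : 0 < κ) (hκ1 : κ < 1) {g : ℝ → ℝ}
    (hg : ContinuousOn g (Icc 0 1)) :
    ContinuousOn (fun y => fluxOp d κ g y / wA d κ y) (Ioo 0 1) :=
  ((continuousOn_fluxOp hκ hκ1 hg).mono Ioo_subset_Icc_self).div continuousOn_wA
    fun _ hx => (wA_pos hx).ne'

theorem fluxOp_div_intervalIntegrable (hκ : 0 < κ) (hκ1 : κ < 1) {g : ℝ → ℝ}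
    (hg : ContinuousOn g (Icc 0 1)) :
    IntervalIntegrable (fun y => fluxOp d κ g y / wA d κ y) MeasureTheory.volume 0 1 := by
  obtain ⟨G, hG⟩ := isCompact_Icc.exists_bound_of_continuousOn hg
  have hG0 : 0 ≤ G := (norm_nonneg _).trans (hG 0 ⟨le_rfl, zero_le_one⟩)
  have hb : IntervalIntegrable (fun x : ℝ => G * ((1 - x) ^ (-κ) / κ)) MeasureTheory.volume 0 1 :=
    ((one_sub_rpow_intervalIntegrable (s := -κ) (by linarith) 0 1).div_const _).const_mul _
  refine hb.mono_fun ?_ ?_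
  · rw [uIoc_of_le zero_le_one, ← MeasureTheory.restrict_Ioo_eq_restrict_Ioc]
    exact (continuousOn_fluxOp_div hκ hκ1 hg).aestronglyMeasurable measurableSet_Ioo
  · rw [EventuallyLE, MeasureTheory.ae_restrict_iff' measurableSet_uIoc]
    refine Eventually.of_forall fun y hy => ?_
    rw [uIoc_of_le zero_le_one] at hy
    have hk : 0 ≤ (1 - y) ^ (-κ) / κ := div_nonneg (Real.rpow_nonneg (by linarith [hy.2]) _) hκ.le
    rw [Real.norm_eq_abs, Real.norm_eq_abs, abs_of_nonneg (mul_nonneg hG0 hk)]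
    refine (abs_fluxOp_div_le hκ hκ1 ⟨hy.1.le, hy.2⟩ hG0
      (fun z hz => hG z ⟨hz.1, hz.2.trans hy.2⟩)).trans ?_
    refine mul_le_mul_of_nonneg_left ?_ hG0
    exact mul_le_of_le_one_left hk hy.2

theorem continuousOn_solOp (hκ : 0 < κ) (hκ1 : κ < 1) {g : ℝ → ℝ}
    (hg : ContinuousOn g (Icc 0 1)) : ContinuousOn (solOp d κ g) (Icc 0 1) :=
  continuousOn_primitive_Icc (fluxOp_div_intervalIntegrable hκ hκ1 hg)

theorem hasDerivAt_solOp (hκ : 0 < κ) (hκ1 : κ < 1) {g : ℝ → ℝ}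
    (hg : ContinuousOn g (Icc 0 1)) {x : ℝ} (hx : x ∈ Ioo (0 : ℝ) 1) :
    HasDerivAt (solOp d κ g) (fluxOp d κ g x / wA d κ x) x :=
  hasDerivAt_primitive_Ioo (fluxOp_div_intervalIntegrable hκ hκ1 hg)
    (continuousOn_fluxOp_div hκ hκ1 hg) hx

theorem fluxOp_sub (hκ : 0 < κ) (hκ1 : κ < 1) {g g' : ℝ → ℝ} (hg : ContinuousOn g (Icc 0 1))
    (hg' : ContinuousOn g' (Icc 0 1)) {x : ℝ} (hx : x ∈ Icc (0 : ℝ) 1) :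
    fluxOp d κ g x - fluxOp d κ g' x = fluxOp d κ (fun y => g y - g' y) x := by
  have h0 : (0 : ℝ) ∈ Icc (0 : ℝ) 1 := ⟨le_rfl, zero_le_one⟩
  unfold fluxOp
  rw [← intervalIntegral.integral_sub
    (intervalIntegrable_sub_Icc (wB_mul_intervalIntegrable hκ hκ1 hg) h0 hx)
    (intervalIntegrable_sub_Icc (wB_mul_intervalIntegrable hκ hκ1 hg') h0 hx)]
  simp only [mul_sub]

theorem solOp_sub (hκ : 0 < κ) (hκ1 : κ < 1) {g g' : ℝ → ℝ} (hg : ContinuousOn g (Icc 0 1))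
    (hg' : ContinuousOn g' (Icc 0 1)) {x : ℝ} (hx : x ∈ Icc (0 : ℝ) 1) :
    solOp d κ g x - solOp d κ g' x = solOp d κ (fun y => g y - g' y) x := by
  have h0 : (0 : ℝ) ∈ Icc (0 : ℝ) 1 := ⟨le_rfl, zero_le_one⟩
  unfold solOp
  rw [← intervalIntegral.integral_sub
    (intervalIntegrable_sub_Icc (fluxOp_div_intervalIntegrable hκ hκ1 hg) h0 hx)
    (intervalIntegrable_sub_Icc (fluxOp_div_intervalIntegrable hκ hκ1 hg') h0 hx)]
  refine intervalIntegral.integral_congr fun y hy => ?_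
  have hy' : y ∈ Icc (0 : ℝ) 1 := uIcc_subset_Icc h0 hx hy
  simp only [← fluxOp_sub hκ hκ1 hg hg' hy', sub_div]

/-- Exponential weight for which the solution operator is a contraction. -/
noncomputable def expWeight (κ L x : ℝ) : ℝ :=
  Real.exp (L * ((1 - (1 - x) ^ (1 - κ)) / (κ * (1 - κ))))

theorem expWeight_mono (hκ : 0 < κ) (hκ1 : κ < 1) {L x y : ℝ} (hL : 0 ≤ L) (hxy : x ≤ y)
    (hy : y ≤ 1) : expWeight κ L x ≤ expWeight κ L y := by
  refine Real.exp_le_exp.2 (mul_le_mul_of_nonneg_left ?_ hL)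
  refine div_le_div_of_nonneg_right ?_ (mul_pos hκ (by linarith)).le
  have := Real.rpow_le_rpow (x := 1 - y) (y := 1 - x) (z := 1 - κ) (by linarith) (by linarith)
    (by linarith)
  linarith

theorem expWeight_zero (L : ℝ) : expWeight κ L 0 = 1 := by simp [expWeight]

theorem one_le_expWeight (hκ : 0 < κ) (hκ1 : κ < 1) {L x : ℝ} (hL : 0 ≤ L)
    (hx : x ∈ Icc (0 : ℝ) 1) : 1 ≤ expWeight κ L x := by
  simpa [expWeight_zero] using expWeight_mono hκ hκ1 hL hx.1 hx.2

theorem expWeight_pos (L x : ℝ) : 0 < expWeight κ L x := Real.exp_pos _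

theorem continuous_expWeight (hκ1 : κ < 1) (L : ℝ) : Continuous (expWeight κ L) := by
  unfold expWeight
  have : Continuous fun x : ℝ => (1 - x) ^ (1 - κ) :=
    (continuous_const.sub continuous_id).rpow_const fun _ => Or.inr (by linarith)
  fun_prop

theorem abs_solOp_le (hκ : 0 < κ) (hκ1 : κ < 1) {g : ℝ → ℝ} {L e x : ℝ} (hL : 0 < L) (he : 0 ≤ e)
    (hge : ∀ y ∈ Icc (0 : ℝ) 1, |g y| ≤ e * expWeight κ L y)
    (hx : x ∈ Icc (0 : ℝ) 1) : |solOp d κ g x| ≤ e / L * expWeight κ L x := by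
  have h0 : (0 : ℝ) ∈ Icc (0 : ℝ) 1 := ⟨le_rfl, zero_le_one⟩
  have hInt : IntervalIntegrable (fun y : ℝ => expWeight κ L y * ((1 - y) ^ (-κ) / κ))
      MeasureTheory.volume 0 x :=
    ((one_sub_rpow_intervalIntegrable (s := -κ) (by linarith) 0 x).div_const _).continuousOn_mul
      (continuous_expWeight hκ1 L).continuousOn
  have h1 : ‖solOp d κ g x‖ ≤
      ∫ y in (0 : ℝ)..x, e * (expWeight κ L y * ((1 - y) ^ (-κ) / κ)) := by
    refine intervalIntegral.norm_integral_le_of_norm_le hx.1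
      (Eventually.of_forall fun y hy => ?_) (hInt.const_mul e)
    have hy' : y ∈ Icc (0 : ℝ) 1 := ⟨hy.1.le, hy.2.trans hx.2⟩
    have hW := expWeight_pos (κ := κ) L y
    have hk : 0 ≤ (1 - y) ^ (-κ) / κ := div_nonneg (Real.rpow_nonneg (by linarith [hy'.2]) _) hκ.le
    rw [Real.norm_eq_abs]
    refine (abs_fluxOp_div_le hκ hκ1 hy' (G := e * expWeight κ L y) (by positivity)
      (fun z hz => (hge z ⟨hz.1, hz.2.trans hy'.2⟩).trans
        (mul_le_mul_of_nonneg_left (expWeight_mono hκ hκ1 hL.le hz.2 hy'.2) he))).trans ?_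
    rw [← mul_assoc e]
    exact mul_le_mul_of_nonneg_left (mul_le_of_le_one_left hk hy'.2) (by positivity)
  have h2 : ∫ y in (0 : ℝ)..x, L * (expWeight κ L y * ((1 - y) ^ (-κ) / κ)) =
      expWeight κ L x - expWeight κ L 0 := by
    refine intervalIntegral.integral_eq_sub_of_hasDerivAt_of_le hx.1
      (continuous_expWeight hκ1 L).continuousOn (fun y hy => ?_) (hInt.const_mul L)
    have hk : (1 - κ) ≠ 0 := by linarith
    have h3 := hasDerivAt_one_sub_rpow (s := 1 - κ) (x := y) (by linarith [hy.2, hx.2])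
    have h4 := (((h3.const_sub 1).div_const (κ * (1 - κ))).const_mul L).exp
    refine h4.congr_deriv ?_
    rw [expWeight, show (1 - κ - 1) = -κ by ring]
    field_simp
  rw [intervalIntegral.integral_const_mul] at h1 h2
  rw [Real.norm_eq_abs, expWeight_zero] at *
  have h5 : ∫ y in (0 : ℝ)..x, expWeight κ L y * ((1 - y) ^ (-κ) / κ) ≤ expWeight κ L x / L := by
    rw [le_div_iff₀ hL]; linarith
  calc _ ≤ _ := h1
    _ ≤ e * (expWeight κ L x / L) := mul_le_mul_of_nonneg_left h5 he
    _ = _ := by ring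

theorem exists_volterra_solution (hκ : 0 < κ) (hκ1 : κ < 1) {h : ℝ → ℝ} {l : ℝ} (hl : 0 < l)
    (hlip : ∀ a b, |h a - h b| ≤ l * |a - b|) :
    ∃ φ : ℝ → ℝ, ContinuousOn φ (Icc 0 1) ∧
      ∀ x ∈ Icc (0 : ℝ) 1, φ x = 1 + solOp d κ (fun y => h (φ y)) x := by
  have hcont : Continuous h := by
    refine (LipschitzWith.of_dist_le_mul (K := l.toNNReal) fun a b => ?_).continuous
    rw [Real.dist_eq, Real.dist_eq, Real.coe_toNNReal _ hl.le]
    exact hlip a b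
  have hW : ∀ x ∈ Icc (0 : ℝ) 1, expWeight κ (2 * l) x ≤ expWeight κ (2 * l) 1 := fun x hx =>
    expWeight_mono hκ hκ1 (by positivity) hx.2 le_rfl
  have hTg : ∀ y : ℝ → ℝ, ContinuousOn y (Icc 0 1) →
      ContinuousOn (fun x => 1 + solOp d κ (fun z => h (y z)) x) (Icc 0 1) := fun y hy =>
    continuousOn_const.add (continuousOn_solOp hκ hκ1 (hcont.comp_continuousOn hy))
  have hc1 : ContinuousOn (fun _ : ℝ => (1 : ℝ)) (Icc 0 1) := continuousOn_const
  have hb : ContinuousOn (fun x => dist (1 : ℝ) (1 + solOp d κ (fun _ => h 1) x))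
      (Icc (0 : ℝ) 1) :=
    continuous_dist.comp_continuousOn (hc1.prodMk (hTg _ hc1))
  obtain ⟨C, hC⟩ := isCompact_Icc.exists_bound_of_continuousOn hb
  have hC0 : 0 ≤ C := (norm_nonneg _).trans (hC 0 ⟨le_rfl, zero_le_one⟩)
  obtain ⟨φ, h1, h2⟩ := exists_fixed_of_weighted_contraction (Icc (0 : ℝ) 1)
    (expWeight κ (2 * l)) (fun y : ℝ → ℝ => ContinuousOn y (Icc 0 1))
    (fun y x => 1 + solOp d κ (fun z => h (y z)) x) hTg
    (by
      intro y y' e hy hy' he hyy x hx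
      rw [Real.dist_eq, add_sub_add_left_eq_sub, solOp_sub hκ hκ1
        (g := fun z => h (y z)) (g' := fun z => h (y' z)) (hcont.comp_continuousOn hy)
        (hcont.comp_continuousOn hy') hx]
      refine (abs_solOp_le hκ hκ1 (L := 2 * l) (e := l * e) (by positivity) (by positivity)
        (fun z hz => ?_) hx).trans (le_of_eq ?_)
      · refine (hlip _ _).trans ?_
        have := hyy z hz
        rw [Real.dist_eq] at this
        rw [mul_assoc]
        exact mul_le_mul_of_nonneg_left this hl.le
      · field_simp)
    ⟨_, hW⟩
    (fun Y y hY hlim => hlim.continuousOn (Eventually.of_forall hY).frequently)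
    (fun _ => 1) hc1 C hC0
    (by
      intro x hx
      have h3 := hC x hx
      rw [Real.norm_eq_abs, abs_of_nonneg dist_nonneg] at h3
      exact h3.trans (le_mul_of_one_le_right hC0 (one_le_expWeight hκ hκ1 (by positivity) hx)))
  exact ⟨φ, h1, fun x hx => (h2 x hx).symm⟩

theorem volterra_stability (hκ : 0 < κ) (hκ1 : κ < 1) {φ ψ g g' : ℝ → ℝ} {l η a : ℝ} (hl : 1 ≤ l)
    (hη : 0 ≤ η) (hφc : ContinuousOn φ (Icc 0 1)) (hψc : ContinuousOn ψ (Icc 0 1))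
    (hgc : ContinuousOn g (Icc 0 1)) (hgc' : ContinuousOn g' (Icc 0 1))
    (hφ : ∀ x ∈ Icc (0 : ℝ) 1, φ x = a + solOp d κ g x)
    (hψ : ∀ x ∈ Icc (0 : ℝ) 1, ψ x = a + solOp d κ g' x)
    (hg : ∀ x ∈ Icc (0 : ℝ) 1, |g x - g' x| ≤ l * |φ x - ψ x| + η) {x : ℝ}
    (hx : x ∈ Icc (0 : ℝ) 1) : |φ x - ψ x| ≤ η * expWeight κ (2 * l) 1 := by
  have hl0 : 0 < l := by linarith
  set W := expWeight κ (2 * l) with hW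
  have hWp : ∀ x, 0 < W x := fun x => expWeight_pos _ _
  have hc : ContinuousOn (fun x => |φ x - ψ x| / W x) (Icc 0 1) :=
    (hφc.sub hψc).abs.div (continuous_expWeight hκ1 _).continuousOn fun x _ => (hWp x).ne'
  obtain ⟨z, hz, hmax⟩ := isCompact_Icc.exists_isMaxOn ⟨0, ⟨le_rfl, zero_le_one⟩⟩ hc
  set e := |φ z - ψ z| / W z with he
  have he0 : 0 ≤ e := div_nonneg (abs_nonneg _) (hWp z).le
  have hd : ∀ x ∈ Icc (0 : ℝ) 1, |φ x - ψ x| ≤ e * W x := fun x hx => by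
    have := hmax hx
    simp only [mem_ofPred_eq] at this
    rwa [div_le_iff₀ (hWp x)] at this
  have hd2 : ∀ x ∈ Icc (0 : ℝ) 1, |φ x - ψ x| ≤ (l * e + η) / (2 * l) * W x := by
    intro x hx
    rw [hφ x hx, hψ x hx, add_sub_add_left_eq_sub, solOp_sub hκ hκ1 hgc hgc' hx]
    refine abs_solOp_le hκ hκ1 (by positivity) (by positivity) (fun y hy => ?_) hx
    refine (hg y hy).trans ?_
    have h1 := mul_le_mul_of_nonneg_left (hd y hy) hl0.le
    have h2 := one_le_expWeight hκ hκ1 (L := 2 * l) (by positivity) hy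
    have h3 : η ≤ η * W y := le_mul_of_one_le_right hη h2
    rw [hW] at *
    nlinarith
  have h1 : e ≤ (l * e + η) / (2 * l) := by
    rw [he, div_le_iff₀ (hWp z), ← he]; exact hd2 z hz
  have h2 : e ≤ η := by
    rw [le_div_iff₀ (by positivity)] at h1
    nlinarith
  refine (hd x hx).trans (mul_le_mul h2 ?_ (hWp x).le hη)
  exact expWeight_mono hκ hκ1 (by positivity) hx.2 le_rfl

end Volterra

/-- Relations between the dimension `d + 1`, the exponent `p`, `α = 2/(p-1)` and
`κ = α - (d-2)/2`. -/
structure ProfileParams (d : ℕ) (p α κ : ℝ) : Prop where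
  two_le : 2 ≤ d
  one_lt : 1 < p
  alpha_mul : α * (p - 1) = 2
  kappa_eq : κ = α - ((d : ℝ) - 2) / 2
  kappa_pos : 0 < κ
  kappa_lt : κ < 1 / 2

/-- Globally Lipschitz modification of `α(α+1)x - μ x^p`. -/
noncomputable def clampNl (p α μ x : ℝ) : ℝ :=
  α * (α + 1) * min x 1 - μ * (max 0 (min x 1)) ^ p

theorem clampNl_of_mem {p α μ x : ℝ} (h0 : 0 ≤ x) (h1 : x ≤ 1) :
    clampNl p α μ x = α * (α + 1) * x - μ * x ^ p := by
  rw [clampNl, min_eq_left h1, max_eq_right h0]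

theorem abs_rpow_sub_rpow_le {p x y : ℝ} (hp : 1 < p) (hx : x ∈ Icc (0 : ℝ) 1)
    (hy : y ∈ Icc (0 : ℝ) 1) : |x ^ p - y ^ p| ≤ p * |x - y| := by
  have := Convex.norm_image_sub_le_of_norm_hasDerivWithin_le (f := fun x : ℝ => x ^ p)
    (f' := fun x => p * x ^ (p - 1)) (s := Icc (0 : ℝ) 1) (x := y) (y := x) (C := p)
    (fun z _ => (Real.hasDerivAt_rpow_const (Or.inr hp.le)).hasDerivWithinAt)
    (fun z hz => ?_) (convex_Icc 0 1) hy hx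
  · simpa [Real.norm_eq_abs] using this
  · rw [norm_mul, Real.norm_eq_abs, Real.norm_eq_abs, abs_of_pos (by linarith),
      abs_of_nonneg (Real.rpow_nonneg hz.1 _)]
    have := Real.rpow_le_one hz.1 hz.2 (by linarith : 0 ≤ p - 1)
    nlinarith

theorem abs_clampNl_sub_le {p α μ x y : ℝ} (hp : 1 < p) (hα : 0 < α) (hμ : 0 ≤ μ) :
    |clampNl p α μ x - clampNl p α μ y| ≤ (α * (α + 1) + μ * p) * |x - y| := by
  have h1 : |min x 1 - min y 1| ≤ |x - y| := by
    simpa using abs_min_sub_min_le_max x 1 y 1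
  have h2 : |max 0 (min x 1) - max 0 (min y 1)| ≤ |x - y| := by
    refine le_trans ?_ h1
    simpa using abs_max_sub_max_le_max 0 (min x 1) 0 (min y 1)
  have hm : ∀ z : ℝ, max 0 (min z 1) ∈ Icc (0 : ℝ) 1 := fun z =>
    ⟨le_max_left _ _, max_le zero_le_one (min_le_right _ _)⟩
  have h3 := abs_rpow_sub_rpow_le hp (hm x) (hm y)
  have h4 : clampNl p α μ x - clampNl p α μ y = α * (α + 1) * (min x 1 - min y 1) -
      μ * ((max 0 (min x 1)) ^ p - (max 0 (min y 1)) ^ p) := by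
    unfold clampNl; ring
  rw [h4]
  refine (abs_sub _ _).trans ?_
  rw [abs_mul (α * (α + 1)), abs_mul μ, abs_of_nonneg hμ,
    abs_of_pos (by positivity : 0 < α * (α + 1))]
  have h5 := mul_le_mul_of_nonneg_left h1 (by positivity : 0 ≤ α * (α + 1))
  have h6 := mul_le_mul_of_nonneg_left (h3.trans (mul_le_mul_of_nonneg_left h2 (by linarith))) hμ
  linarith

theorem continuous_clampNl {p α μ : ℝ} (hp : 1 < p) : Continuous (clampNl p α μ) := by
  unfold clampNl
  have : Continuous fun x : ℝ => (max 0 (min x 1)) ^ p :=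
    (by fun_prop : Continuous fun x : ℝ => max 0 (min x 1)).rpow_const
      fun _ => Or.inr (by linarith)
  fun_prop

/-- `φ` is the solution, normalized by `φ 0 = 1`, with parameter `μ`. -/
structure IsNormalizedProfile (d : ℕ) (p α κ μ : ℝ) (φ : ℝ → ℝ) : Prop where
  continuousOn : ContinuousOn φ (Icc 0 1)
  eq : ∀ x ∈ Icc (0 : ℝ) 1, φ x = 1 + solOp d κ (fun y => clampNl p α μ (φ y)) x

/-- The derivative of a normalized profile. -/
noncomputable def profDeriv (d : ℕ) (p α κ μ : ℝ) (φ : ℝ → ℝ) (x : ℝ) : ℝ :=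
  fluxOp d κ (fun y => clampNl p α μ (φ y)) x / wA d κ x

theorem hasDerivAt_wA {d : ℕ} {κ x : ℝ} (hx : x ∈ Ioo (0 : ℝ) 1) :
    HasDerivAt (wA d κ) (wA d κ x * (d / x - 2 * κ * x / (1 - x ^ 2))) x := by
  have h : (0 : ℝ) < 1 - x ^ 2 := by nlinarith [hx.1, hx.2]
  have h0 : x ≠ 0 := hx.1.ne'
  have h1 : HasDerivAt (fun y : ℝ => 1 - y ^ 2) (-(2 * x)) x := by
    simpa using ((hasDerivAt_id x).pow 2).const_sub 1
  have h2 := (hasDerivAt_pow d x).mul (h1.rpow_const (p := κ) (Or.inl h.ne'))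
  refine h2.congr_deriv ?_
  rw [wA, Real.rpow_sub_one h.ne']
  rcases d with _ | d
  · simp; field_simp
  · simp only [Nat.add_sub_cancel]
    push_cast
    field_simp
    ring

/-- A function on `(0,1)` with nonpositive derivative stays below its limit at `0`. -/
theorem le_limit_of_deriv_nonpos {e e' : ℝ → ℝ} {l : ℝ}
    (hd : ∀ x ∈ Ioo (0 : ℝ) 1, HasDerivAt e (e' x) x) (hn : ∀ x ∈ Ioo (0 : ℝ) 1, e' x ≤ 0)
    (hl : Tendsto e (nhdsWithin 0 (Ioi 0)) (nhds l)) {x : ℝ} (hx : x ∈ Ioo (0 : ℝ) 1) :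
    e x ≤ l := by
  have hanti : AntitoneOn e (Ioo 0 1) := by
    refine antitoneOn_of_deriv_nonpos (convex_Ioo 0 1)
      (fun y hy => (hd y hy).continuousAt.continuousWithinAt) (fun y hy => ?_) fun y hy => ?_
    · rw [interior_Ioo] at hy
      exact (hd y hy).differentiableAt.differentiableWithinAt
    · rw [interior_Ioo] at hy
      rw [(hd y hy).deriv]; exact hn y hy
  refine ge_of_tendsto hl ?_
  filter_upwards [Ioo_mem_nhdsGT hx.1] with y hy
  exact hanti ⟨hy.1, hy.2.trans hx.2⟩ hx hy.2.le

namespace ProfileParams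

variable {d : ℕ} {p α κ : ℝ}

theorem alpha_pos (hP : ProfileParams d p α κ) : 0 < α := by
  have h1 := hP.one_lt; have h2 := hP.alpha_mul
  by_contra h
  nlinarith

theorem two_alpha (hP : ProfileParams d p α κ) : 2 * α = d - 2 + 2 * κ := by
  have := hP.kappa_eq; linarith

theorem two_le_real (hP : ProfileParams d p α κ) : (2 : ℝ) ≤ d := by exact_mod_cast hP.two_le

theorem kappa_lt_one (hP : ProfileParams d p α κ) : κ < 1 := by linarith [hP.kappa_lt]

theorem beta_pos (hP : ProfileParams d p α κ) : 0 < α * ((d : ℝ) - 1 - α) := by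
  have := hP.two_alpha; have := hP.kappa_lt; have := hP.alpha_pos
  exact mul_pos hP.alpha_pos (by linarith)

theorem exists_normalizedProfile (hP : ProfileParams d p α κ) {μ : ℝ} (hμ : 0 ≤ μ) :
    ∃ φ, IsNormalizedProfile d p α κ μ φ := by
  have hα := hP.alpha_pos
  have hp := hP.one_lt
  obtain ⟨φ, h1, h2⟩ := exists_volterra_solution (d := d) hP.kappa_pos hP.kappa_lt_one
    (l := α * (α + 1) + μ * p) (h := clampNl p α μ) (by positivity)
    fun a b => abs_clampNl_sub_le hp hα hμ
  exact ⟨φ, h1, h2⟩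

end ProfileParams

namespace IsNormalizedProfile

variable {d : ℕ} {p α κ μ : ℝ} {φ : ℝ → ℝ}

theorem zero (hφ : IsNormalizedProfile d p α κ μ φ) : φ 0 = 1 := by
  rw [hφ.eq 0 ⟨le_rfl, zero_le_one⟩]; simp [solOp]

theorem continuousOn_nl (hP : ProfileParams d p α κ) (hφ : IsNormalizedProfile d p α κ μ φ) :
    ContinuousOn (fun y => clampNl p α μ (φ y)) (Icc 0 1) :=
  (continuous_clampNl hP.one_lt).comp_continuousOn hφ.continuousOn

theorem hasDerivAt (hP : ProfileParams d p α κ) (hφ : IsNormalizedProfile d p α κ μ φ) {x : ℝ}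
    (hx : x ∈ Ioo (0 : ℝ) 1) : HasDerivAt φ (profDeriv d p α κ μ φ x) x := by
  refine ((hasDerivAt_solOp (d := d) hP.kappa_pos hP.kappa_lt_one (hφ.continuousOn_nl hP)
    hx).const_add 1).congr_of_eventuallyEq ?_
  filter_upwards [isOpen_Ioo.mem_nhds hx] with y hy
  exact hφ.eq y (Ioo_subset_Icc_self hy)

theorem hasDerivAt_profDeriv (hP : ProfileParams d p α κ)
    (hφ : IsNormalizedProfile d p α κ μ φ) {x : ℝ} (hx : x ∈ Ioo (0 : ℝ) 1) :
    HasDerivAt (profDeriv d p α κ μ φ) ((clampNl p α μ (φ x) -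
      (d / x - 2 * (α + 1) * x) * profDeriv d p α κ μ φ x) / (1 - x ^ 2)) x := by
  have hA := wA_pos (d := d) (κ := κ) hx
  have h1 := (hasDerivAt_fluxOp (d := d) hP.kappa_pos hP.kappa_lt_one (hφ.continuousOn_nl hP)
    hx).div (hasDerivAt_wA hx) hA.ne'
  refine h1.congr_deriv ?_
  have hx2 : 1 - x ^ 2 ≠ 0 := by nlinarith [hx.1, hx.2]
  have hx0 : x ≠ 0 := hx.1.ne'
  have hB : wB d κ x = wA d κ x / (1 - x ^ 2) := by
    rw [wA_eq hx]; field_simp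
  rw [hB, profDeriv]
  have := hP.two_alpha
  have h2 : 2 * (α + 1) = d + 2 * κ := by linarith
  rw [h2]
  field_simp
  ring

theorem tendsto_profDeriv_zero (hP : ProfileParams d p α κ)
    (hφ : IsNormalizedProfile d p α κ μ φ) :
    Tendsto (profDeriv d p α κ μ φ) (nhdsWithin 0 (Ioi 0)) (nhds 0) := by
  obtain ⟨G, hG⟩ := isCompact_Icc.exists_bound_of_continuousOn (hφ.continuousOn_nl hP)
  have hG0 : 0 ≤ G := (norm_nonneg _).trans (hG 0 ⟨le_rfl, zero_le_one⟩)
  have hlim : Tendsto (fun x : ℝ => G * (x * ((1 - x) ^ (-κ) / κ))) (nhdsWithin 0 (Ioi 0))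
      (nhds (G * (0 * ((1 - 0) ^ (-κ) / κ)))) := by
    refine tendsto_nhdsWithin_of_tendsto_nhds (ContinuousAt.tendsto
      (f := fun x : ℝ => G * (x * ((1 - x) ^ (-κ) / κ))) ?_)
    have : ContinuousAt (fun x : ℝ => (1 - x) ^ (-κ)) 0 :=
      ContinuousAt.rpow_const (by fun_prop) (Or.inl (by norm_num))
    fun_prop
  rw [zero_mul, mul_zero] at hlim
  refine squeeze_zero_norm' ?_ hlim
  filter_upwards [Ioo_mem_nhdsGT (zero_lt_one' ℝ)] with x hx
  exact abs_fluxOp_div_le hP.kappa_pos hP.kappa_lt_one (Ioo_subset_Icc_self hx) hG0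
    fun y hy => hG y ⟨hy.1, hy.2.trans hx.2.le⟩

theorem tendsto_zero (hφ : IsNormalizedProfile d p α κ μ φ) :
    Tendsto φ (nhdsWithin 0 (Ioi 0)) (nhds 1) := by
  have := (hφ.continuousOn 0 ⟨le_rfl, zero_le_one⟩).tendsto
  rw [hφ.zero] at this
  refine this.mono_left ?_
  rw [← nhdsWithin_Ioo_eq_nhdsGT (zero_lt_one' ℝ)]
  exact nhdsWithin_mono _ Ioo_subset_Icc_self

theorem eq_one (hP : ProfileParams d p α κ)
    (hφ : IsNormalizedProfile d p α κ (α * (α + 1)) φ) {x : ℝ} (hx : x ∈ Icc (0 : ℝ) 1) :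
    φ x = 1 := by
  have hα := hP.alpha_pos
  have hp := hP.one_lt
  have h1 : clampNl p α (α * (α + 1)) 1 = 0 := by
    rw [clampNl_of_mem zero_le_one le_rfl]; simp
  have := volterra_stability (d := d) hP.kappa_pos hP.kappa_lt_one (φ := φ) (ψ := fun _ => 1)
    (g := fun y => clampNl p α (α * (α + 1)) (φ y)) (g' := fun _ => 0) (η := 0) (a := 1)
    (l := (α * (α + 1) + α * (α + 1) * p) + 1) (by nlinarith [mul_pos hα hα]) le_rfl
    hφ.continuousOn continuousOn_const (hφ.continuousOn_nl hP) continuousOn_const hφ.eq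
    (fun y _ => by simp [solOp, fluxOp]) (fun y _ => ?_) hx
  · rw [zero_mul] at this
    exact sub_eq_zero.1 (abs_nonpos_iff.1 this)
  · have h2 := abs_clampNl_sub_le (x := φ y) (y := 1) hp hα (μ := α * (α + 1)) (by positivity)
    rw [h1] at h2
    have := abs_nonneg (φ y - 1)
    linarith

theorem le_one (hP : ProfileParams d p α κ) (hμ : α * (α + 1) ≤ μ)
    (hφ : IsNormalizedProfile d p α κ μ φ) {x : ℝ} (hx : x ∈ Icc (0 : ℝ) 1) : φ x ≤ 1 := by
  rcases eq_or_lt_of_le hμ with h | hlt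
  · subst h
    exact (hφ.eq_one hP hx).le
  have hα := hP.alpha_pos
  have hp := hP.one_lt
  have hcl := continuous_clampNl (α := α) (μ := μ) hP.one_lt
  set D := profDeriv d p α κ μ φ with hD
  set e : ℝ → ℝ := fun x => (1 - x ^ 2) * D x ^ 2 / 2 - ∫ t in (1 : ℝ)..φ x, clampNl p α μ t
    with he
  have hprim : ∀ z, HasDerivAt (fun z => ∫ t in (1 : ℝ)..z, clampNl p α μ t)
      (clampNl p α μ z) z := fun z =>
    intervalIntegral.integral_hasDerivAt_right (hcl.intervalIntegrable _ _)
      (hcl.stronglyMeasurableAtFilter _ _) hcl.continuousAt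
  have hde : ∀ x ∈ Ioo (0 : ℝ) 1, HasDerivAt e (-((d / x - (2 * α + 1) * x) * D x ^ 2)) x := by
    intro x hx
    have h1 := hφ.hasDerivAt_profDeriv hP hx
    have h2 := (((((hasDerivAt_id x).pow 2).const_sub 1).mul (h1.pow 2)).div_const 2).sub
      ((hprim (φ x)).comp x (hφ.hasDerivAt hP hx))
    refine h2.congr_deriv ?_
    have hx2 : 1 - x ^ 2 ≠ 0 := by nlinarith [hx.1, hx.2]
    have hx0 : x ≠ 0 := hx.1.ne'
    simp only [id, Pi.pow_apply, ← hD]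
    field_simp
    ring
  have hlim : Tendsto e (nhdsWithin 0 (Ioi 0)) (nhds 0) := by
    have h1 : Tendsto (fun x : ℝ => (1 - x ^ 2)) (nhdsWithin 0 (Ioi 0)) (nhds (1 - 0 ^ 2)) :=
      tendsto_nhdsWithin_of_tendsto_nhds (ContinuousAt.tendsto (f := fun x : ℝ => 1 - x ^ 2)
        (by fun_prop))
    have h2 := ((h1.mul ((hφ.tendsto_profDeriv_zero hP).pow 2)).div_const 2).sub
      ((hprim 1).continuousAt.tendsto.comp hφ.tendsto_zero)
    simpa using h2
  have hin : ∀ x ∈ Ioo (0 : ℝ) 1, φ x ≤ 1 := by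
    intro x hx
    by_contra hgt
    push Not at hgt
    have h1 := le_limit_of_deriv_nonpos hde (fun y hy => ?_) hlim hx
    · have h2 : ∫ t in (1 : ℝ)..φ x, clampNl p α μ t = (φ x - 1) * (α * (α + 1) - μ) := by
        rw [intervalIntegral.integral_congr (g := fun _ => α * (α + 1) - μ)]
        · simp; ring
        · intro t ht
          rw [uIcc_of_le hgt.le] at ht
          simp [clampNl, min_eq_right ht.1]
      simp only [he, h2] at h1
      have h3 : 0 ≤ (1 - x ^ 2) * D x ^ 2 / 2 :=
        div_nonneg (mul_nonneg (by nlinarith [hx.1, hx.2]) (sq_nonneg _)) (by norm_num)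
      nlinarith [mul_pos (sub_pos.2 hgt) (sub_pos.2 hlt)]
    · have h2 : (d : ℝ) ≤ d / y := by
        rw [le_div_iff₀ hy.1]
        have := hP.two_le_real
        nlinarith [hy.2]
      have h3 := hP.two_alpha
      have h4 := hP.kappa_lt
      have h5 : (2 * α + 1) * y ≤ 2 * α + 1 := by nlinarith [hy.2]
      have := mul_nonneg (show 0 ≤ d / y - (2 * α + 1) * y by linarith) (sq_nonneg (D y))
      linarith
  have hcl' : Icc (0 : ℝ) 1 ⊆ closure (Ioo 0 1) := by rw [closure_Ioo zero_ne_one]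
  exact le_on_closure (f := φ) (g := fun _ => 1) (s := Ioo 0 1) hin
    (by rw [closure_Ioo zero_ne_one]; exact hφ.continuousOn) continuousOn_const (hcl' hx)

end IsNormalizedProfile

theorem antitoneOn_of_hasDerivAt_nonpos {e e' : ℝ → ℝ} {a b : ℝ}
    (hd : ∀ x ∈ Ioo a b, HasDerivAt e (e' x) x) (hn : ∀ x ∈ Ioo a b, e' x ≤ 0) :
    AntitoneOn e (Ioo a b) := by
  refine antitoneOn_of_deriv_nonpos (convex_Ioo a b)
    (fun y hy => (hd y hy).continuousAt.continuousWithinAt) (fun y hy => ?_) fun y hy => ?_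
  · rw [interior_Ioo] at hy
    exact (hd y hy).differentiableAt.differentiableWithinAt
  · rw [interior_Ioo] at hy
    rw [(hd y hy).deriv]; exact hn y hy

/-- Strict version of `le_limit_of_deriv_nonpos`. -/
theorem lt_limit_of_deriv_nonpos {e e' : ℝ → ℝ} {l : ℝ}
    (hd : ∀ x ∈ Ioo (0 : ℝ) 1, HasDerivAt e (e' x) x) (hn : ∀ x ∈ Ioo (0 : ℝ) 1, e' x ≤ 0)
    (hl : Tendsto e (nhdsWithin 0 (Ioi 0)) (nhds l))
    (hneg : ∀ᶠ x in nhdsWithin 0 (Ioi 0), e' x < 0) {x : ℝ} (hx : x ∈ Ioo (0 : ℝ) 1) :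
    e x < l := by
  obtain ⟨ε, hε, hε'⟩ := mem_nhdsGT_iff_exists_Ioo_subset.1 hneg
  have hε0 : 0 < ε := hε
  have hy : 0 < min x ε / 2 := by have := lt_min hx.1 hε0; linarith
  set y := min x ε / 2 with hyd
  have hyx : y < x := by have := min_le_left x ε; linarith
  have hyε : y < ε := by have := min_le_right x ε; linarith
  have hanti : StrictAntiOn e (Icc (y / 2) y) := by
    refine strictAntiOn_of_deriv_neg (convex_Icc _ _) (fun z hz => ?_) fun z hz => ?_
    · exact (hd z ⟨by linarith [hz.1], by linarith [hz.2, hx.2]⟩).continuousAt.continuousWithinAt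
    · rw [interior_Icc] at hz
      rw [(hd z ⟨by linarith [hz.1], by linarith [hz.2, hx.2]⟩).deriv]
      exact hε' ⟨by linarith [hz.1], by linarith [hz.2]⟩
  have h1 : e y < e (y / 2) :=
    hanti ⟨le_rfl, by linarith⟩ ⟨by linarith, le_rfl⟩ (by linarith)
  have h2 := le_limit_of_deriv_nonpos hd hn hl (x := y / 2) ⟨by linarith, by linarith [hx.2]⟩
  have h3 := antitoneOn_of_hasDerivAt_nonpos hd hn ⟨hy, by linarith [hx.2]⟩ hx hyx.le
  linarith

section Potential

/-- `v^p - β v` for `v ≥ 0`. -/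
noncomputable def potNl (p β v : ℝ) : ℝ := (max 0 v) ^ p - β * v

noncomputable def pot (p β v : ℝ) : ℝ := ∫ t in (0 : ℝ)..v, potNl p β t

variable {p β : ℝ}

theorem continuous_potNl (hp : 1 < p) : Continuous (potNl p β) := by
  unfold potNl
  have : Continuous fun x : ℝ => (max 0 x) ^ p :=
    (by fun_prop : Continuous fun x : ℝ => max 0 x).rpow_const fun _ => Or.inr (by linarith)
  fun_prop

theorem hasDerivAt_pot (hp : 1 < p) (v : ℝ) : HasDerivAt (pot p β) (potNl p β v) v :=
  intervalIntegral.integral_hasDerivAt_right ((continuous_potNl hp).intervalIntegrable _ _)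
    ((continuous_potNl hp).stronglyMeasurableAtFilter _ _) (continuous_potNl hp).continuousAt

theorem continuous_pot (hp : 1 < p) : Continuous (pot p β) :=
  continuous_iff_continuousAt.2 fun v => (hasDerivAt_pot hp v).continuousAt

theorem pot_zero : pot p β 0 = 0 := by simp [pot]

theorem potNl_of_pos {v : ℝ} (hv : 0 < v) : potNl p β v = v * (v ^ (p - 1) - β) := by
  rw [potNl, max_eq_right hv.le, Real.rpow_sub_one hv.ne']
  field_simp

variable {b : ℝ}

theorem potNl_neg (hbβ : b ^ (p - 1) = β) (hp : 1 < p)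
    {v : ℝ} (hv : 0 < v) (hvb : v < b) : potNl p β v < 0 := by
  rw [potNl_of_pos hv]
  have := Real.rpow_lt_rpow hv.le hvb (by linarith : 0 < p - 1)
  nlinarith

theorem potNl_pos (hb : 0 < b) (hbβ : b ^ (p - 1) = β) (hp : 1 < p)
    {v : ℝ} (hvb : b < v) : 0 < potNl p β v := by
  rw [potNl_of_pos (hb.trans hvb)]
  have := Real.rpow_lt_rpow hb.le hvb (by linarith : 0 < p - 1)
  nlinarith

theorem potNl_eq_zero (hb : 0 < b) (hbβ : b ^ (p - 1) = β) : potNl p β b = 0 := by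
  rw [potNl_of_pos hb, hbβ]; simp

theorem potNl_mul_sub_pos (hb : 0 < b) (hbβ : b ^ (p - 1) = β) (hp : 1 < p)
    {v : ℝ} (hv : 0 < v) (hvb : v ≠ b) :
    0 < potNl p β v * (v - b) := by
  rcases lt_or_gt_of_ne hvb with h | h
  · exact mul_pos_of_neg_of_neg (potNl_neg hbβ hp hv h) (by linarith)
  · exact mul_pos (potNl_pos hb hbβ hp h) (by linarith)

theorem pot_lt_pot (hb : 0 < b) (hbβ : b ^ (p - 1) = β) (hp : 1 < p)
    {v : ℝ} (hv : 0 ≤ v) (hvb : v ≠ b) : pot p β b < pot p β v := by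
  rcases lt_or_gt_of_ne hvb with h | h
  · refine strictAntiOn_of_deriv_neg (convex_Icc 0 b) (continuous_pot hp).continuousOn
      (fun z hz => ?_) ⟨hv, h.le⟩ ⟨hb.le, le_rfl⟩ h
    rw [interior_Icc] at hz
    rw [(hasDerivAt_pot hp z).deriv]
    exact potNl_neg hbβ hp hz.1 hz.2
  · refine strictMonoOn_of_deriv_pos (convex_Ici b) (continuous_pot hp).continuousOn
      (fun z hz => ?_) (mem_Ici.2 le_rfl) (mem_Ici.2 h.le) h
    rw [interior_Ici] at hz
    rw [(hasDerivAt_pot hp z).deriv]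
    exact potNl_pos hb hbβ hp hz

theorem pot_le_pot (hb : 0 < b) (hbβ : b ^ (p - 1) = β) (hp : 1 < p)
    {v : ℝ} (hv : 0 ≤ v) : pot p β b ≤ pot p β v := by
  rcases eq_or_ne v b with rfl | h
  · exact le_rfl
  · exact (pot_lt_pot hb hbβ hp hv h).le

theorem pot_min_neg (hb : 0 < b) (hbβ : b ^ (p - 1) = β) (hp : 1 < p) : pot p β b < 0 := by
  simpa [pot_zero] using pot_lt_pot hb hbβ hp le_rfl hb.ne

end Potential

/-- The normalized profile in self-similar variables, `c x^α φ(x)`. -/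
noncomputable def ssV (α c : ℝ) (φ : ℝ → ℝ) (x : ℝ) : ℝ := c * x ^ α * φ x

/-- Logarithmic derivative `x · d/dx` of `ssV`. -/
noncomputable def ssW (d : ℕ) (p α κ μ c : ℝ) (φ : ℝ → ℝ) (x : ℝ) : ℝ :=
  c * x ^ α * (α * φ x + x * profDeriv d p α κ μ φ x)

noncomputable def ssE (d : ℕ) (p α κ μ c : ℝ) (φ : ℝ → ℝ) (x : ℝ) : ℝ :=
  (1 - x ^ 2) * ssW d p α κ μ c φ x ^ 2 / 2 + pot p (α * (d - 1 - α)) (ssV α c φ x)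

namespace IsNormalizedProfile

variable {d : ℕ} {p α κ μ c : ℝ} {φ : ℝ → ℝ}

theorem hasDerivAt_ssV (hP : ProfileParams d p α κ) (hφ : IsNormalizedProfile d p α κ μ φ) {x : ℝ}
    (hx : x ∈ Ioo (0 : ℝ) 1) : HasDerivAt (ssV α c φ) (ssW d p α κ μ c φ x / x) x := by
  have h1 := ((Real.hasDerivAt_rpow_const (x := x) (p := α) (Or.inl hx.1.ne')).const_mul c).mul
    (hφ.hasDerivAt hP hx)
  refine h1.congr_deriv ?_
  have hx0 := hx.1.ne'
  rw [ssW, Real.rpow_sub_one hx0]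
  field_simp

theorem hasDerivAt_ssW (hP : ProfileParams d p α κ) (hμ : α * (α + 1) ≤ μ)
    (hφ : IsNormalizedProfile d p α κ μ φ) (hc : 0 < c) (hcμ : c ^ (p - 1) = μ) {x : ℝ}
    (hx : x ∈ Ioo (0 : ℝ) 1) : HasDerivAt (ssW d p α κ μ c φ)
      (-(((d - 1 - 2 * α) - x ^ 2) * ssW d p α κ μ c φ x +
        potNl p (α * (d - 1 - α)) (ssV α c φ x)) / (x * (1 - x ^ 2))) x := by
  have h1 := ((Real.hasDerivAt_rpow_const (x := x) (p := α) (Or.inl hx.1.ne')).const_mul c).mul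
    (((hφ.hasDerivAt hP hx).const_mul α).add
      ((hasDerivAt_id x).mul (hφ.hasDerivAt_profDeriv hP hx)))
  refine h1.congr_deriv ?_
  have hx0 := hx.1.ne'
  have hx2 : 1 - x ^ 2 ≠ 0 := by nlinarith [hx.1, hx.2]
  have hxα : 0 < x ^ α := Real.rpow_pos_of_pos hx.1 _
  have h2 : (max 0 (ssV α c φ x)) ^ p = c * x ^ α * (μ * x ^ 2 * (max 0 (φ x)) ^ p) := by
    have h3 : max 0 (ssV α c φ x) = c * x ^ α * max 0 (φ x) := by
      rw [mul_max_of_nonneg _ _ (by positivity), mul_zero, ssV]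
    rw [h3, Real.mul_rpow (by positivity) (le_max_left _ _), Real.mul_rpow hc.le hxα.le,
      ← Real.rpow_mul hx.1.le]
    have h4 : c ^ p = c * μ := by
      rw [← hcμ, Real.rpow_sub_one hc.ne']; field_simp
    have h5 : x ^ (α * p) = x ^ α * x ^ 2 := by
      rw [← Real.rpow_natCast, ← Real.rpow_add hx.1]
      congr 1
      have := hP.alpha_mul
      push_cast; linarith
    rw [h4, h5]; ring
  rw [potNl, h2, ssW, ssV, Real.rpow_sub_one hx0, clampNl,
    min_eq_left (hφ.le_one hP hμ (Ioo_subset_Icc_self hx))]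
  simp only [id, Pi.add_apply, Pi.mul_apply]
  field_simp
  ring

theorem hasDerivAt_ssE (hP : ProfileParams d p α κ) (hμ : α * (α + 1) ≤ μ)
    (hφ : IsNormalizedProfile d p α κ μ φ) (hc : 0 < c) (hcμ : c ^ (p - 1) = μ) {x : ℝ}
    (hx : x ∈ Ioo (0 : ℝ) 1) : HasDerivAt (ssE d p α κ μ c φ)
      (-((d - 1 - 2 * α) * ssW d p α κ μ c φ x ^ 2 / x)) x := by
  have h1 := (((((hasDerivAt_id x).pow 2).const_sub 1).mul
    ((hφ.hasDerivAt_ssW hP hμ hc hcμ hx).pow 2)).div_const 2).add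
      ((hasDerivAt_pot (β := α * (d - 1 - α)) hP.one_lt (ssV α c φ x)).comp x
        (hφ.hasDerivAt_ssV (c := c) hP hx))
  refine h1.congr_deriv ?_
  have hx0 := hx.1.ne'
  have hx2 : 1 - x ^ 2 ≠ 0 := by nlinarith [hx.1, hx.2]
  simp only [id, Pi.pow_apply]
  field_simp
  ring

theorem continuousOn_ssV (hP : ProfileParams d p α κ) (hφ : IsNormalizedProfile d p α κ μ φ) :
    ContinuousOn (ssV α c φ) (Icc 0 1) := by
  unfold ssV
  exact (continuousOn_const.mul (continuousOn_id.rpow_const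
    fun _ _ => Or.inr hP.alpha_pos.le)).mul hφ.continuousOn

theorem tendsto_log_deriv (hP : ProfileParams d p α κ) (hφ : IsNormalizedProfile d p α κ μ φ) :
    Tendsto (fun x => α * φ x + x * profDeriv d p α κ μ φ x) (nhdsWithin 0 (Ioi 0)) (nhds α) := by
  have h : Tendsto (fun x : ℝ => x) (nhdsWithin 0 (Ioi 0)) (nhds 0) :=
    tendsto_nhdsWithin_of_tendsto_nhds tendsto_id
  simpa using (hφ.tendsto_zero.const_mul α).add (h.mul (hφ.tendsto_profDeriv_zero hP))

theorem tendsto_rpow_zero (hα : 0 < α) :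
    Tendsto (fun x : ℝ => x ^ α) (nhdsWithin 0 (Ioi 0)) (nhds 0) := by
  have h : ContinuousAt (fun x : ℝ => x ^ α) 0 :=
    Real.continuousAt_rpow_const _ _ (Or.inr hα.le)
  have h2 := h.tendsto
  rw [Real.zero_rpow hα.ne'] at h2
  exact tendsto_nhdsWithin_of_tendsto_nhds h2

theorem ssE_neg (hP : ProfileParams d p α κ) (hμ : α * (α + 1) ≤ μ)
    (hφ : IsNormalizedProfile d p α κ μ φ) (hc : 0 < c) (hcμ : c ^ (p - 1) = μ) {x : ℝ}
    (hx : x ∈ Ioo (0 : ℝ) 1) : ssE d p α κ μ c φ x < 0 := by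
  have hγ : 0 < (d : ℝ) - 1 - 2 * α := by linarith [hP.two_alpha, hP.kappa_lt]
  have hx0 : Tendsto (fun x : ℝ => x) (nhdsWithin 0 (Ioi 0)) (nhds 0) :=
    tendsto_nhdsWithin_of_tendsto_nhds tendsto_id
  have hxα := (tendsto_rpow_zero hP.alpha_pos).const_mul c
  have hlog := hφ.tendsto_log_deriv hP
  refine lt_limit_of_deriv_nonpos (fun y hy => hφ.hasDerivAt_ssE hP hμ hc hcμ hy) (fun y hy => ?_)
    (l := 0) ?_ ?_ hx
  · have : 0 ≤ (d - 1 - 2 * α) * ssW d p α κ μ c φ y ^ 2 / y :=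
      div_nonneg (mul_nonneg hγ.le (sq_nonneg _)) hy.1.le
    linarith
  · unfold ssE ssW ssV
    have h1 := ((((hx0.pow 2).const_sub 1).mul ((hxα.mul hlog).pow 2)).div_const 2).add
      (((continuous_pot (β := α * (d - 1 - α)) hP.one_lt).tendsto _).comp
        (hxα.mul hφ.tendsto_zero))
    simpa [pot_zero, Function.comp_def] using h1
  · filter_upwards [hlog.eventually (lt_mem_nhds hP.alpha_pos), self_mem_nhdsWithin] with y h1 hy
    have hy : 0 < y := hy
    have : 0 < ssW d p α κ μ c φ y := by
      unfold ssW
      have := Real.rpow_pos_of_pos hy α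
      positivity
    have : 0 < (d - 1 - 2 * α) * ssW d p α κ μ c φ y ^ 2 / y := by positivity
    linarith

theorem antitoneOn_ssE (hP : ProfileParams d p α κ) (hμ : α * (α + 1) ≤ μ)
    (hφ : IsNormalizedProfile d p α κ μ φ) (hc : 0 < c) (hcμ : c ^ (p - 1) = μ) :
    AntitoneOn (ssE d p α κ μ c φ) (Ioo 0 1) := by
  have hγ : 0 < (d : ℝ) - 1 - 2 * α := by linarith [hP.two_alpha, hP.kappa_lt]
  refine antitoneOn_of_hasDerivAt_nonpos (fun y hy => hφ.hasDerivAt_ssE hP hμ hc hcμ hy)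
    fun y hy => ?_
  have : 0 ≤ (d - 1 - 2 * α) * ssW d p α κ μ c φ y ^ 2 / y :=
    div_nonneg (mul_nonneg hγ.le (sq_nonneg _)) hy.1.le
  linarith

theorem pot_ssV_le_ssE {x : ℝ} (hx : x ∈ Ioo (0 : ℝ) 1) :
    pot p (α * (d - 1 - α)) (ssV α c φ x) ≤ ssE d p α κ μ c φ x := by
  unfold ssE
  have : 0 ≤ (1 - x ^ 2) * ssW d p α κ μ c φ x ^ 2 / 2 :=
    div_nonneg (mul_nonneg (by nlinarith [hx.1, hx.2]) (sq_nonneg _)) (by norm_num)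
  linarith

theorem pos (hP : ProfileParams d p α κ) (hμ : α * (α + 1) ≤ μ)
    (hφ : IsNormalizedProfile d p α κ μ φ) {x : ℝ} (hx : x ∈ Icc (0 : ℝ) 1) : 0 < φ x := by
  have hα := hP.alpha_pos
  have hμ0 : 0 < μ := lt_of_lt_of_le (by positivity) hμ
  have hp := hP.one_lt
  set c := μ ^ (1 / (p - 1)) with hcd
  have hc : 0 < c := Real.rpow_pos_of_pos hμ0 _
  have hcμ : c ^ (p - 1) = μ := by
    rw [hcd, ← Real.rpow_mul hμ0.le, one_div_mul_cancel (by linarith), Real.rpow_one]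
  have hne : ∀ y ∈ Ioo (0 : ℝ) 1, φ y ≠ 0 := fun y hy h0 => by
    have h1 := hφ.ssE_neg hP hμ hc hcμ hy
    have h2 := pot_ssV_le_ssE (d := d) (p := p) (α := α) (κ := κ) (μ := μ) (c := c) (φ := φ) hy
    rw [ssV, h0, mul_zero, pot_zero] at h2
    linarith
  have hne1 : φ 1 ≠ 0 := fun h0 => by
    have hmid : (1 / 2 : ℝ) ∈ Ioo (0 : ℝ) 1 := by norm_num
    have h1 := hφ.ssE_neg hP hμ hc hcμ hmid
    have hcont := (continuous_pot (β := α * (d - 1 - α)) hp).comp_continuousOn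
      (hφ.continuousOn_ssV (c := c) hP)
    have h2 : pot p (α * (d - 1 - α)) (ssV α c φ 1) ≤ ssE d p α κ μ c φ (1 / 2) := by
      have hcl : closure (Ioo (1 / 2 : ℝ) 1) = Icc (1 / 2) 1 := closure_Ioo (by norm_num)
      refine le_on_closure (s := Ioo (1 / 2 : ℝ) 1)
        (f := fun y => pot p (α * (d - 1 - α)) (ssV α c φ y))
        (g := fun _ => ssE d p α κ μ c φ (1 / 2)) (fun y hy => ?_) ?_ continuousOn_const ?_
      · have hy' : y ∈ Ioo (0 : ℝ) 1 := ⟨by linarith [hy.1], hy.2⟩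
        exact (pot_ssV_le_ssE hy').trans (hφ.antitoneOn_ssE hP hμ hc hcμ hmid hy' hy.1.le)
      · rw [hcl]
        exact hcont.mono (Icc_subset_Icc (by norm_num) le_rfl)
      · rw [hcl]; norm_num
    rw [ssV, h0, mul_zero, pot_zero] at h2
    linarith
  by_contra hle
  push Not at hle
  have := intermediate_value_Icc' hx.1 (hφ.continuousOn.mono (Icc_subset_Icc le_rfl hx.2))
  obtain ⟨y, hy, hy0⟩ := this ⟨hle, by rw [hφ.zero]; exact zero_le_one⟩
  rcases eq_or_lt_of_le hy.1 with h | h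
  · rw [← h, hφ.zero] at hy0; exact one_ne_zero hy0
  rcases eq_or_lt_of_le (hy.2.trans hx.2) with h' | h'
  · rw [h'] at hy0; exact hne1 hy0
  · exact hne y ⟨h, h'⟩ hy0

end IsNormalizedProfile

theorem exists_continuous_log {a : ℝ} {Z : ℝ → ℝ → ℂ}
    (hZ : ContinuousOn (fun q : ℝ × ℝ => Z q.1 q.2) (Ici a ×ˢ Icc 0 1))
    (h0 : ∀ μ ∈ Ici a, ∀ x ∈ Icc (0 : ℝ) 1, Z μ x ≠ 0) {l : ℂ}
    (hl : ∀ μ ∈ Ici a, Z μ 0 = Complex.exp l) :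
    ∃ L : ℝ → ℝ → ℂ, ContinuousOn (fun q : ℝ × ℝ => L q.1 q.2) (Ici a ×ˢ Icc 0 1) ∧
      (∀ μ ∈ Ici a, L μ 0 = l) ∧
      ∀ μ ∈ Ici a, ∀ x ∈ Icc (0 : ℝ) 1, Complex.exp (L μ x) = Z μ x := by
  have hmem : ∀ m : ℝ, max a m ∈ Ici a := fun m => mem_Ici.2 (le_max_left _ _)
  let H : C(unitInterval × ℝ, {z : ℂ // z ≠ 0}) :=
    { toFun := fun q => ⟨Z (max a q.2) q.1, h0 _ (hmem _) _ q.1.2⟩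
      continuous_toFun := by
        refine Continuous.subtype_mk ?_ _
        exact hZ.comp_continuous (f := fun q : unitInterval × ℝ => (max a q.2, (q.1 : ℝ)))
          (by fun_prop) fun q => ⟨hmem _, q.1.2⟩ }
  have hH0 : ∀ m : ℝ, H (0, m) =
      (fun z : ℂ => (⟨Complex.exp z, z.exp_ne_zero⟩ : {z : ℂ // z ≠ 0}))
        ((ContinuousMap.const ℝ l) m) := fun m => Subtype.ext (hl _ (hmem m))
  let G := Complex.isCoveringMap_exp.liftHomotopy H (ContinuousMap.const ℝ l) hH0
  have hG : ∀ q, Complex.exp (G q) = Z (max a q.2) q.1 := fun q =>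
    congrArg Subtype.val (congrFun (Complex.isCoveringMap_exp.liftHomotopy_lifts H _ hH0) q)
  have hG0 : ∀ m, G (0, m) = l := fun m => Complex.isCoveringMap_exp.liftHomotopy_zero H _ hH0 m
  refine ⟨fun μ x => G (projIcc 0 1 zero_le_one x, μ), ?_, fun μ _ => ?_, fun μ hμ x hx => ?_⟩
  · have : Continuous fun q : ℝ × ℝ => G (projIcc 0 1 zero_le_one q.2, q.1) :=
      G.continuous.comp ((continuous_projIcc.comp continuous_snd).prodMk continuous_fst)
    exact this.continuousOn
  · simp only [projIcc_left]; exact hG0 μ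
  · simp only [hG]; rw [projIcc_of_mem zero_le_one hx, max_eq_right (mem_Ici.1 hμ)]

theorem hasDerivAt_of_exp_eq {L Z : ℝ → ℂ} {x₀ : ℝ} {Z' : ℂ} (hc : ContinuousAt L x₀)
    (he : ∀ᶠ x in nhds x₀, Complex.exp (L x) = Z x) (hZ : HasDerivAt Z Z' x₀) :
    HasDerivAt L (Z' / Z x₀) x₀ := by
  have he0 := he.self_of_nhds
  have hZ0 : Z x₀ ≠ 0 := by rw [← he0]; exact Complex.exp_ne_zero _
  have h1 : HasDerivAt (fun x => Complex.log (Z x / Z x₀)) (Z' / Z x₀ / (Z x₀ / Z x₀)) x₀ :=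
    (hZ.div_const _).clog_real (by rw [div_self hZ0]; exact Complex.one_mem_slitPlane)
  rw [div_self hZ0, div_one] at h1
  refine (h1.const_add (L x₀)).congr_of_eventuallyEq ?_
  have h2 : ∀ᶠ x in nhds x₀, ‖L x - L x₀‖ < Real.pi := by
    have := (hc.sub continuousAt_const : ContinuousAt (fun x => L x - L x₀) x₀).norm
    refine this.eventually_lt continuousAt_const ?_
    simpa using Real.pi_pos
  filter_upwards [he, h2] with x hx hx2
  have h3 := (Complex.abs_im_le_norm (L x - L x₀)).trans_lt hx2
  rw [abs_lt] at h3
  rw [← hx, ← he0, ← Complex.exp_sub, Complex.log_exp h3.1 h3.2.le]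
  ring

theorem encard_cos_eq_zero {θ : ℝ → ℝ} (hmono : StrictMonoOn θ (Icc 0 1))
    (hc : ContinuousOn θ (Icc 0 1)) (h0 : θ 0 = Real.pi) {n : ℕ}
    (h1 : θ 1 = (n + 2) * Real.pi) :
    {x ∈ Ioo (0 : ℝ) 1 | Real.cos (θ x) = 0}.encard = ((n + 1 : ℕ) : ℕ∞) := by
  have hpi := Real.pi_pos
  have hex : ∀ j : Fin (n + 1), ∃ x ∈ Ioo (0 : ℝ) 1,
      θ x = (2 * ((j : ℕ) + 1 : ℤ) + 1) * Real.pi / 2 := by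
    intro j
    have hj : (j : ℝ) ≤ n := by exact_mod_cast Nat.lt_succ_iff.1 j.2
    have hj0 : (0 : ℝ) ≤ j := by positivity
    refine intermediate_value_Ioo zero_le_one hc ⟨?_, ?_⟩
    · rw [h0]; push_cast; nlinarith
    · rw [h1]; push_cast; nlinarith
  choose ξ hξ hξθ using hex
  have hinj : Function.Injective ξ := fun i j hij => by
    have h2 := hξθ i
    rw [hij, hξθ j] at h2
    have h3 : ((j : ℕ) : ℝ) = (i : ℕ) := by
      push_cast at h2
      nlinarith
    exact (Fin.ext (by exact_mod_cast h3)).symm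
  have hS : {x ∈ Ioo (0 : ℝ) 1 | Real.cos (θ x) = 0} = range ξ := by
    ext x
    constructor
    · rintro ⟨hx, hcos⟩
      obtain ⟨k, hk⟩ := Real.cos_eq_zero_iff.1 hcos
      have hlo := hmono ⟨le_rfl, zero_le_one⟩ (Ioo_subset_Icc_self hx) hx.1
      have hhi := hmono (Ioo_subset_Icc_self hx) ⟨zero_le_one, le_rfl⟩ hx.2
      rw [h0, hk] at hlo
      rw [h1, hk] at hhi
      have hk1 : (1 : ℝ) < 2 * k + 1 := by nlinarith
      have hk2 : (2 * k + 1 : ℝ) < 2 * (n + 2) := by nlinarith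
      have hk1' : (1 : ℤ) < 2 * k + 1 := by exact_mod_cast hk1
      have hk2' : (2 * k + 1 : ℤ) < 2 * (n + 2) := by exact_mod_cast hk2
      obtain ⟨m, hm⟩ := Int.eq_ofNat_of_zero_le (show 0 ≤ k - 1 by omega)
      refine ⟨⟨m, by omega⟩, ?_⟩
      refine hmono.injOn (Ioo_subset_Icc_self (hξ _)) (Ioo_subset_Icc_self hx) ?_
      rw [hξθ, hk]
      have : (k : ℝ) = m + 1 := by
        have : k = (m : ℤ) + 1 := by omega
        exact_mod_cast this
      push_cast
      rw [this]
    · rintro ⟨j, rfl⟩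
      exact ⟨hξ j, Real.cos_eq_zero_iff.2 ⟨_, hξθ j⟩⟩
  rw [hS, ← image_univ, hinj.encard_image, encard_univ]
  simp

/-- Uniqueness at a singular endpoint for `δ' = O(t^{-s}Δ)`, `Δ' = O(t^{s-1}δ)`. -/
theorem eq_zero_of_singular_system {δ Δ δ' Δ' : ℝ → ℝ} {r C s : ℝ} (hr : 0 < r) (hC : 0 < C)
    (hs : 0 < s) (hδc : ContinuousOn δ (Icc 0 r)) (hΔc : ContinuousOn Δ (Icc 0 r))
    (hδ0 : δ 0 = 0) (hΔ0 : Δ 0 = 0)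
    (hδ : ∀ t ∈ Ioo 0 r, HasDerivAt δ (δ' t) t) (hΔ : ∀ t ∈ Ioo 0 r, HasDerivAt Δ (Δ' t) t)
    (hδ' : ∀ t ∈ Ioo 0 r, |δ' t| ≤ C * t ^ (-s) * |Δ t|)
    (hΔ' : ∀ t ∈ Ioo 0 r, |Δ' t| ≤ C * t ^ (s - 1) * |δ t|) :
    ∃ ε, 0 < ε ∧ ε ≤ r ∧ ∀ t ∈ Icc 0 ε, δ t = 0 ∧ Δ t = 0 := by
  have hcmp : ∀ (f f' g g' : ℝ → ℝ) (e : ℝ), 0 < e → e ≤ r → ContinuousOn f (Icc 0 r) →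
      ContinuousOn g (Icc 0 r) → f 0 = 0 → g 0 = 0 → (∀ t ∈ Ioo 0 e, HasDerivAt f (f' t) t) →
      (∀ t ∈ Ioo 0 e, HasDerivAt g (g' t) t) → (∀ t ∈ Ioo 0 e, |f' t| ≤ g' t) →
      ∀ t ∈ Icc 0 e, |f t| ≤ g t := by
    intro f f' g g' e he her hf hg hf0 hg0 hfd hgd hle t ht
    have hsub : Icc 0 e ⊆ Icc 0 r := Icc_subset_Icc le_rfl her
    have h0 : (0 : ℝ) ∈ Icc 0 e := ⟨le_rfl, he.le⟩
    have h1 : MonotoneOn (fun t => g t - f t) (Icc 0 e) := by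
      refine monotoneOn_of_deriv_nonneg (convex_Icc _ _) ((hg.sub hf).mono hsub)
        (fun z hz => ?_) fun z hz => ?_ <;> rw [interior_Icc] at hz
      · exact ((hgd z hz).sub (hfd z hz)).differentiableAt.differentiableWithinAt
      · have h : HasDerivAt (fun t => g t - f t) _ z := (hgd z hz).sub (hfd z hz)
        rw [HasDerivAt.deriv h]
        have := (abs_le.1 (hle z hz)).2; linarith
    have h2 : MonotoneOn (fun t => g t + f t) (Icc 0 e) := by
      refine monotoneOn_of_deriv_nonneg (convex_Icc _ _) ((hg.add hf).mono hsub)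
        (fun z hz => ?_) fun z hz => ?_ <;> rw [interior_Icc] at hz
      · exact ((hgd z hz).add (hfd z hz)).differentiableAt.differentiableWithinAt
      · have h : HasDerivAt (fun t => g t + f t) _ z := (hgd z hz).add (hfd z hz)
        rw [HasDerivAt.deriv h]
        have := (abs_le.1 (hle z hz)).1; linarith
    have h3 := h1 h0 ht ht.1
    have h4 := h2 h0 ht ht.1
    simp only [hf0, hg0] at h3 h4
    rw [abs_le]; constructor <;> linarith
  set ε := min r (s / (2 * C ^ 2)) with hε
  have hε0 : 0 < ε := lt_min hr (by positivity)
  have hεr : ε ≤ r := min_le_left _ _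
  have hε2 : C ^ 2 * ε / s ≤ 1 / 2 := by
    have : ε ≤ s / (2 * C ^ 2) := min_le_right _ _
    rw [le_div_iff₀ (by positivity)] at this
    rw [div_le_div_iff₀ hs (by norm_num)]
    linarith
  obtain ⟨z, hz, hmax⟩ := isCompact_Icc.exists_isMaxOn ⟨0, ⟨le_rfl, hε0.le⟩⟩
    ((hδc.mono (Icc_subset_Icc le_rfl hεr)).abs)
  set m := |δ z| with hm
  have hm0 : 0 ≤ m := abs_nonneg _
  have hδm : ∀ t ∈ Icc 0 ε, |δ t| ≤ m := fun t ht => hmax ht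
  have hΔm : ∀ t ∈ Icc 0 ε, |Δ t| ≤ C * m * (t ^ s / s) := by
    refine hcmp Δ Δ' (fun t => C * m * (t ^ s / s)) (fun t => C * m * t ^ (s - 1)) ε hε0 hεr hΔc
      ?_ hΔ0 (by simp [Real.zero_rpow hs.ne']) (fun t ht => hΔ t ⟨ht.1, ht.2.trans_le hεr⟩)
      (fun t ht => ?_) fun t ht => ?_
    · have : ContinuousOn (fun t : ℝ => t ^ s) (Icc 0 r) :=
        continuousOn_id.rpow_const fun _ _ => Or.inr hs.le
      fun_prop
    · refine (((Real.hasDerivAt_rpow_const (p := s) (Or.inl ht.1.ne')).div_const s).const_mul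
        (C * m)).congr_deriv ?_
      field_simp
    · refine (hΔ' t ⟨ht.1, ht.2.trans_le hεr⟩).trans ?_
      have h1 := Real.rpow_pos_of_pos ht.1 (s - 1)
      have h2 := hδm t (Ioo_subset_Icc_self ht)
      have := mul_le_mul_of_nonneg_left h2 (by positivity : 0 ≤ C * t ^ (s - 1))
      linarith
  have hδm2 : ∀ t ∈ Icc 0 ε, |δ t| ≤ C ^ 2 * m / s * t := by
    refine hcmp δ δ' (fun t => C ^ 2 * m / s * t) (fun _ => C ^ 2 * m / s) ε hε0 hεr hδc
      (by fun_prop) hδ0 (by simp) (fun t ht => hδ t ⟨ht.1, ht.2.trans_le hεr⟩)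
      (fun t _ => by simpa using (hasDerivAt_id t).const_mul (C ^ 2 * m / s)) fun t ht => ?_
    refine (hδ' t ⟨ht.1, ht.2.trans_le hεr⟩).trans ?_
    have h1 := Real.rpow_pos_of_pos ht.1 (-s)
    have h2 := mul_le_mul_of_nonneg_left (hΔm t (Ioo_subset_Icc_self ht))
      (by positivity : 0 ≤ C * t ^ (-s))
    refine h2.trans (le_of_eq ?_)
    have h3 : t ^ (-s) * t ^ s = 1 := by rw [← Real.rpow_add ht.1]; simp
    calc C * t ^ (-s) * (C * m * (t ^ s / s)) = C ^ 2 * m / s * (t ^ (-s) * t ^ s) := by ring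
      _ = _ := by rw [h3, mul_one]
  have hmz : m = 0 := by
    have h1 := hδm2 z hz
    have h2 : C ^ 2 * m / s * z ≤ C ^ 2 * m / s * ε :=
      mul_le_mul_of_nonneg_left hz.2 (by positivity)
    have h3 : C ^ 2 * m / s * ε = C ^ 2 * ε / s * m := by ring
    have h4 := mul_le_mul_of_nonneg_right hε2 hm0
    rw [← hm] at h1
    linarith
  refine ⟨ε, hε0, hεr, fun t ht => ⟨?_, ?_⟩⟩
  · have := hδm t ht
    rw [hmz] at this
    exact abs_nonpos_iff.1 this
  · have := hΔm t ht
    rw [hmz] at this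
    simpa using this

/-- `x^(d-1-2α) (1-x²)^κ` times `ssW`, extended continuously to `[0,1]`. -/
noncomputable def ssP (d : ℕ) (p α κ μ c : ℝ) (φ : ℝ → ℝ) (x : ℝ) : ℝ :=
  c * (α * (x ^ (d - 1 - α) * (1 - x ^ 2) ^ κ * φ x) +
    x ^ (-α) * fluxOp d κ (fun y => clampNl p α μ (φ y)) x)

theorem abs_rpow_mul_fluxOp_le {d : ℕ} {κ α G x : ℝ} (hκ : 0 < κ) (hκ1 : κ < 1)
    (hαd : α < d) {g : ℝ → ℝ} (hx : x ∈ Icc (0 : ℝ) 1) (hG0 : 0 ≤ G)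
    (hG : ∀ y ∈ Icc 0 x, |g y| ≤ G) : |x ^ (-α) * fluxOp d κ g x| ≤ G / κ * x := by
  rcases eq_or_lt_of_le hx.1 with h | h
  · rw [← h]; simp [fluxOp]
  have h1 := abs_fluxOp_le (d := d) hκ hκ1 hx hG0 hG
  have hxα := Real.rpow_pos_of_pos h (-α)
  rw [abs_mul, abs_of_pos hxα]
  have h2 : x ^ (-α) * x ^ d ≤ 1 := by
    rw [← Real.rpow_natCast, ← Real.rpow_add h]
    exact Real.rpow_le_one h.le hx.2 (by linarith)
  calc x ^ (-α) * |fluxOp d κ g x| ≤ x ^ (-α) * (G * (x ^ (d + 1) / κ)) :=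
        mul_le_mul_of_nonneg_left h1 hxα.le
    _ = (x ^ (-α) * x ^ d) * (G / κ * x) := by rw [pow_succ]; ring
    _ ≤ 1 * (G / κ * x) := mul_le_mul_of_nonneg_right h2 (mul_nonneg (by positivity) hx.1)
    _ = _ := one_mul _

theorem continuousOn_rpow_mul_fluxOp {d : ℕ} {κ α : ℝ} (hκ : 0 < κ) (hκ1 : κ < 1)
    (hαd : α < d) {g : ℝ → ℝ} (hg : ContinuousOn g (Icc 0 1)) :
    ContinuousOn (fun x => x ^ (-α) * fluxOp d κ g x) (Icc 0 1) := by
  intro x hx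
  rcases eq_or_lt_of_le hx.1 with h | h
  · obtain ⟨G, hG⟩ := isCompact_Icc.exists_bound_of_continuousOn hg
    have hG0 : 0 ≤ G := (norm_nonneg _).trans (hG 0 ⟨le_rfl, zero_le_one⟩)
    rw [← h]
    unfold ContinuousWithinAt
    have h0 : (0 : ℝ) ^ (-α) * fluxOp d κ g 0 = 0 := by simp [fluxOp]
    simp only [h0]
    have hlim : Tendsto (fun x : ℝ => G / κ * x) (nhdsWithin 0 (Icc 0 1)) (nhds (G / κ * 0)) :=
      tendsto_nhdsWithin_of_tendsto_nhds (Continuous.tendsto (by fun_prop) 0)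
    rw [mul_zero] at hlim
    refine squeeze_zero_norm' ?_ hlim
    filter_upwards [self_mem_nhdsWithin] with y hy
    exact abs_rpow_mul_fluxOp_le hκ hκ1 hαd hy hG0 fun z hz => hG z ⟨hz.1, hz.2.trans hy.2⟩
  · exact ((Real.continuousAt_rpow_const _ _ (Or.inl h.ne')).continuousWithinAt).mul
      (continuousOn_fluxOp hκ hκ1 hg x hx)

theorem ProfileParams.alpha_lt {d : ℕ} {p α κ : ℝ} (hP : ProfileParams d p α κ) :
    α < d - 1 := by
  linarith [hP.two_alpha, hP.alpha_pos, hP.kappa_lt]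

namespace IsNormalizedProfile

variable {d : ℕ} {p α κ μ c : ℝ} {φ : ℝ → ℝ}

theorem continuousOn_ssP (hP : ProfileParams d p α κ) (hφ : IsNormalizedProfile d p α κ μ φ) :
    ContinuousOn (ssP d p α κ μ c φ) (Icc 0 1) := by
  have hα := hP.alpha_lt
  refine continuousOn_const.mul ((continuousOn_const.mul (ContinuousOn.mul (ContinuousOn.mul
    (continuousOn_id.rpow_const fun _ _ => Or.inr (by linarith)) ?_) hφ.continuousOn)).add
    (continuousOn_rpow_mul_fluxOp hP.kappa_pos hP.kappa_lt_one (by linarith)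
      (hφ.continuousOn_nl hP)))
  exact ContinuousOn.rpow_const (by fun_prop) fun _ _ => Or.inr hP.kappa_pos.le

theorem ssP_eq {x : ℝ} (hx : x ∈ Ioo (0 : ℝ) 1) :
    ssP d p α κ μ c φ x = x ^ (d - 1 - 2 * α) * (1 - x ^ 2) ^ κ * ssW d p α κ μ c φ x := by
  have hx2 : (0 : ℝ) < 1 - x ^ 2 := by nlinarith [hx.1, hx.2]
  have h1 : x ^ (d - 1 - α) = x ^ (d - 1 - 2 * α) * x ^ α := by
    rw [← Real.rpow_add hx.1]; congr 1; ring
  have h2 : x ^ (-α) * x ^ d = x ^ (d - 1 - 2 * α) * x ^ α * x := by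
    rw [← Real.rpow_natCast, ← Real.rpow_add hx.1, ← Real.rpow_add hx.1,
      ← Real.rpow_add_one hx.1.ne']
    congr 1; ring
  have hQ : fluxOp d κ (fun y => clampNl p α μ (φ y)) x =
      x ^ d * (1 - x ^ 2) ^ κ * profDeriv d p α κ μ φ x := by
    rw [profDeriv, ← wA, mul_div_cancel₀]
    exact (wA_pos hx).ne'
  rw [ssP, ssW, hQ, h1]
  linear_combination c * (1 - x ^ 2) ^ κ * profDeriv d p α κ μ φ x * h2

theorem hasDerivAt_ssP (hP : ProfileParams d p α κ) (hμ : α * (α + 1) ≤ μ)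
    (hφ : IsNormalizedProfile d p α κ μ φ) (hc : 0 < c) (hcμ : c ^ (p - 1) = μ) {x : ℝ}
    (hx : x ∈ Ioo (0 : ℝ) 1) : HasDerivAt (ssP d p α κ μ c φ)
      (-(x ^ (d - 1 - 2 * α - 1) * (1 - x ^ 2) ^ (κ - 1) *
        potNl p (α * (d - 1 - α)) (ssV α c φ x))) x := by
  have hx2 : (0 : ℝ) < 1 - x ^ 2 := by nlinarith [hx.1, hx.2]
  have h1 : HasDerivAt (fun y : ℝ => 1 - y ^ 2) (-(2 * x)) x := by
    simpa using ((hasDerivAt_id x).pow 2).const_sub 1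
  have h2 := ((Real.hasDerivAt_rpow_const (x := x) (p := d - 1 - 2 * α) (Or.inl hx.1.ne')).mul
    (h1.rpow_const (p := κ) (Or.inl hx2.ne'))).mul (hφ.hasDerivAt_ssW hP hμ hc hcμ hx)
  have h3 : ssP d p α κ μ c φ =ᶠ[nhds x]
      fun y => y ^ (d - 1 - 2 * α) * (1 - y ^ 2) ^ κ * ssW d p α κ μ c φ y := by
    filter_upwards [isOpen_Ioo.mem_nhds hx] with y hy using ssP_eq hy
  refine (HasDerivAt.congr_deriv h2 ?_).congr_of_eventuallyEq h3
  have hx0 := hx.1.ne'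
  have hx2' := hx2.ne'
  have hγ : (d : ℝ) - 1 - 2 * α = 1 - 2 * κ := by linarith [hP.two_alpha]
  simp only [Pi.mul_apply]
  rw [hγ, Real.rpow_sub_one hx0, Real.rpow_sub_one hx2']
  field_simp
  ring

theorem hasDerivAt_ssV' (hP : ProfileParams d p α κ) (hφ : IsNormalizedProfile d p α κ μ φ)
    {x : ℝ} (hx : x ∈ Ioo (0 : ℝ) 1) : HasDerivAt (ssV α c φ)
      (x ^ (-(d - 1 - 2 * α) - 1) * (1 - x ^ 2) ^ (-κ) * ssP d p α κ μ c φ x) x := by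
  have hx2 : (0 : ℝ) < 1 - x ^ 2 := by nlinarith [hx.1, hx.2]
  refine (hφ.hasDerivAt_ssV hP hx).congr_deriv ?_
  have h1 := Real.rpow_pos_of_pos hx2 κ
  have h2 := Real.rpow_pos_of_pos hx.1 (d - 1 - 2 * α)
  have hx0 := hx.1.ne'
  rw [ssP_eq hx, Real.rpow_sub_one hx0, Real.rpow_neg hx.1.le, Real.rpow_neg hx2.le]
  field_simp

/-- If the trajectory meets the rest point at `x₀`, it stays there slightly to the left. -/
theorem rest_left (hP : ProfileParams d p α κ) (hμ : α * (α + 1) ≤ μ)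
    (hφ : IsNormalizedProfile d p α κ μ φ) (hc : 0 < c) (hcμ : c ^ (p - 1) = μ) {b : ℝ}
    (hb : 0 < b) (hbβ : b ^ (p - 1) = α * (d - 1 - α)) {x₀ : ℝ} (hx₀ : x₀ ∈ Ioc (0 : ℝ) 1)
    (hV : ssV α c φ x₀ = b) (hPz : ssP d p α κ μ c φ x₀ = 0) :
    ∃ x ∈ Ico 0 x₀, ssV α c φ x = b ∧ ssP d p α κ μ c φ x = 0 := by
  have hx₀' : x₀ ∈ Icc (0 : ℝ) 1 := Ioc_subset_Icc_self hx₀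
  obtain ⟨L, hL0, hL⟩ : ∃ L, 0 < L ∧ ∀ᶠ v in nhds b,
      |potNl p (α * (d - 1 - α)) v| ≤ L * |v - b| := by
    have h1 : HasDerivAt (fun v : ℝ => v * (v ^ (p - 1) - α * (d - 1 - α)))
        (1 * (b ^ (p - 1) - α * (d - 1 - α)) + b * ((p - 1) * b ^ (p - 1 - 1))) b :=
      (hasDerivAt_id b).mul ((Real.hasDerivAt_rpow_const (Or.inl hb.ne')).sub_const _)
    obtain ⟨L, hL0, hL⟩ := h1.isBigO_sub.exists_pos
    refine ⟨L, hL0, ?_⟩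
    filter_upwards [hL.bound, lt_mem_nhds hb] with v hv hv0
    rw [hbβ, sub_self, mul_zero, sub_zero] at hv
    rw [potNl_of_pos hv0]
    simpa [Real.norm_eq_abs] using hv
  have hVc := hφ.continuousOn_ssV (c := c) hP
  have h2 : ∀ᶠ x in nhdsWithin x₀ (Icc 0 1),
      |potNl p (α * (d - 1 - α)) (ssV α c φ x)| ≤ L * |ssV α c φ x - b| := by
    have := (hVc x₀ hx₀').tendsto
    rw [hV] at this
    exact this.eventually hL
  obtain ⟨η, hη, hη2⟩ := Metric.eventually_nhds_iff.1 (eventually_nhdsWithin_iff.1 h2)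
  set r := min (x₀ / 2) (η / 2) with hr
  have hr0 : 0 < r := lt_min (by linarith [hx₀.1]) (by linarith)
  have hr1 : r ≤ x₀ / 2 := min_le_left _ _
  have hr2 : r ≤ η / 2 := min_le_right _ _
  set K := (x₀ / 2) ^ (-2 : ℝ) with hK
  have hx2 : 0 < x₀ / 2 := by linarith [hx₀.1]
  have hK0 : 0 < K := Real.rpow_pos_of_pos hx2 _
  have hin : ∀ t ∈ Ioo 0 r, x₀ - t ∈ Ioo (0 : ℝ) 1 := fun t ht =>
    ⟨by linarith [ht.2], by linarith [ht.1, hx₀.2]⟩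
  have hin' : MapsTo (fun t => x₀ - t) (Icc 0 r) (Icc 0 1) := fun t ht =>
    ⟨by linarith [ht.2], by linarith [ht.1, hx₀.2]⟩
  have hpow : ∀ t ∈ Ioo 0 r, ∀ e : ℝ, -2 ≤ e → e ≤ 0 → (x₀ - t) ^ e ≤ K := fun t ht e he he0 => by
    have h3 : x₀ / 2 ≤ x₀ - t := by linarith [ht.2]
    refine (Real.rpow_le_rpow_of_nonpos hx2 h3 he0).trans ?_
    exact Real.rpow_le_rpow_of_exponent_ge hx2 (by linarith [hx₀.2]) he
  have hone : ∀ t ∈ Ioo 0 r, ∀ e : ℝ, e ≤ 0 → (1 - (x₀ - t) ^ 2) ^ e ≤ t ^ e := fun t ht e he => by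
    refine Real.rpow_le_rpow_of_nonpos ht.1 ?_ he
    have := hin t ht
    nlinarith [this.1, this.2, hx₀.2]
  have hγ : (d : ℝ) - 1 - 2 * α = 1 - 2 * κ := by linarith [hP.two_alpha]
  have hκ := hP.kappa_pos
  have hκ2 := hP.kappa_lt
  have hsub : ∀ t : ℝ, HasDerivAt (fun t => x₀ - t) (-1) t := fun t => by
    simpa using (hasDerivAt_id t).const_sub x₀
  obtain ⟨ε, hε0, hεr, hε⟩ := eq_zero_of_singular_system (δ := fun t => ssV α c φ (x₀ - t) - b)
    (Δ := fun t => ssP d p α κ μ c φ (x₀ - t)) (r := r) (C := K * (1 + L)) (s := κ) hr0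
    (by positivity) hκ
    ((hVc.comp (by fun_prop) hin').sub continuousOn_const)
    ((hφ.continuousOn_ssP hP).comp (by fun_prop) hin') (by simp [hV]) (by simp [hPz])
    (fun t ht => ((hφ.hasDerivAt_ssV' hP (hin t ht)).comp t (hsub t)).sub_const b)
    (fun t ht => (hφ.hasDerivAt_ssP hP hμ hc hcμ (hin t ht)).comp t (hsub t))
    (fun t ht => by
      have h3 := hpow t ht (-(d - 1 - 2 * α) - 1) (by linarith) (by linarith)
      have h4 := hone t ht (-κ) (by linarith)
      have h5 := Real.rpow_pos_of_pos (hin t ht).1 (-(d - 1 - 2 * α) - 1)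
      have h6 := Real.rpow_pos_of_pos (show 0 < 1 - (x₀ - t) ^ 2 by
        nlinarith [(hin t ht).1, (hin t ht).2]) (-κ)
      rw [mul_neg_one, abs_neg, abs_mul, abs_mul, abs_of_pos h5, abs_of_pos h6]
      refine mul_le_mul_of_nonneg_right ?_ (abs_nonneg _)
      refine mul_le_mul (h3.trans ?_) h4 h6.le (by positivity)
      nlinarith)
    (fun t ht => by
      have h3 := hpow t ht (d - 1 - 2 * α - 1) (by linarith) (by linarith)
      have h4 := hone t ht (κ - 1) (by linarith)
      have h5 := Real.rpow_pos_of_pos (hin t ht).1 (d - 1 - 2 * α - 1)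
      have h6 := Real.rpow_pos_of_pos (show 0 < 1 - (x₀ - t) ^ 2 by
        nlinarith [(hin t ht).1, (hin t ht).2]) (κ - 1)
      have h7 : |potNl p (α * (d - 1 - α)) (ssV α c φ (x₀ - t))| ≤
          L * |ssV α c φ (x₀ - t) - b| := by
        refine hη2 ?_ (Ioo_subset_Icc_self (hin t ht))
        rw [Real.dist_eq, abs_lt]
        constructor <;> linarith [ht.1, ht.2]
      rw [mul_neg_one, neg_neg, abs_mul, abs_mul, abs_of_pos h5, abs_of_pos h6]
      have h8 := Real.rpow_pos_of_pos ht.1 (κ - 1)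
      calc _ ≤ K * t ^ (κ - 1) * (L * |ssV α c φ (x₀ - t) - b|) :=
            mul_le_mul (mul_le_mul h3 h4 h6.le hK0.le) h7 (abs_nonneg _) (by positivity)
        _ ≤ K * t ^ (κ - 1) * ((1 + L) * |ssV α c φ (x₀ - t) - b|) := by
            refine mul_le_mul_of_nonneg_left ?_ (by positivity)
            exact mul_le_mul_of_nonneg_right (by linarith) (abs_nonneg _)
        _ = _ := by ring)
  have := hε ε ⟨hε0.le, le_rfl⟩
  exact ⟨x₀ - ε, ⟨by linarith, by linarith⟩, by linarith [this.1], this.2⟩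

theorem not_rest (hP : ProfileParams d p α κ) (hμ : α * (α + 1) ≤ μ)
    (hφ : IsNormalizedProfile d p α κ μ φ) (hc : 0 < c) (hcμ : c ^ (p - 1) = μ) {b : ℝ}
    (hb : 0 < b) (hbβ : b ^ (p - 1) = α * (d - 1 - α)) {x₀ : ℝ} (hx₀ : x₀ ∈ Icc (0 : ℝ) 1) :
    ¬(ssV α c φ x₀ = b ∧ ssP d p α κ μ c φ x₀ = 0) := by
  intro h
  set T : Set ℝ := Icc 0 1 ∩ (fun x => (ssV α c φ x, ssP d p α κ μ c φ x)) ⁻¹' {(b, 0)} with hT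
  have hTc : IsCompact T := by
    refine isCompact_Icc.of_isClosed_subset ?_ inter_subset_left
    exact ((hφ.continuousOn_ssV hP).prodMk (hφ.continuousOn_ssP hP)).preimage_isClosed_of_isClosed
      isClosed_Icc isClosed_singleton
  obtain ⟨m, hm, hmin⟩ := hTc.exists_isLeast ⟨x₀, hx₀, by simp [h.1, h.2]⟩
  have hm2 := hm.2
  simp only [mem_preimage, mem_singleton_iff, Prod.mk.injEq] at hm2
  have hm0 : m ≠ 0 := fun h0 => by
    have := hm2.1
    rw [h0, ssV, Real.zero_rpow hP.alpha_pos.ne'] at this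
    simp at this
    exact hb.ne this
  obtain ⟨x, hx, hx1, hx2⟩ := hφ.rest_left hP hμ hc hcμ hb hbβ
    ⟨lt_of_le_of_ne hm.1.1 hm0.symm, hm.1.2⟩ hm2.1 hm2.2
  have := hmin (a := x) ⟨⟨hx.1, hx.2.le.trans hm.1.2⟩, by simp [hx1, hx2]⟩
  exact absurd hx.2 (not_lt.2 this)

end IsNormalizedProfile

theorem continuousOn_uncurry_of_locally_lipschitz {F : ℝ → ℝ → ℝ} {a : ℝ} {t : Set ℝ}
    (hc : ∀ μ ∈ Ici a, ContinuousOn (F μ) t)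
    (hL : ∀ M, ∃ K, ∀ μ ∈ Icc a M, ∀ ν ∈ Icc a M, ∀ x ∈ t, |F μ x - F ν x| ≤ K * |μ - ν|) :
    ContinuousOn (fun q : ℝ × ℝ => F q.1 q.2) (Ici a ×ˢ t) := by
  rintro ⟨μ, x⟩ ⟨hμ, hx⟩
  obtain ⟨K, hK⟩ := hL (μ + 1)
  have h1 : ContinuousOn (fun q : ℝ × ℝ => F q.1 q.2) (Icc a (μ + 1) ×ˢ t) := by
    refine continuousOn_prod_of_continuousOn_lipschitzOnWith _ K.toNNReal
      (fun ν hν => hc ν hν.1) fun y hy => LipschitzOnWith.of_dist_le_mul fun ν hν ξ hξ => ?_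
    rw [Real.dist_eq, Real.dist_eq]
    exact (hK ν hν ξ hξ y hy).trans
      (mul_le_mul_of_nonneg_right (Real.le_coe_toNNReal K) (abs_nonneg _))
  refine (h1 (μ, x) ⟨⟨hμ, by simp⟩, hx⟩).mono_of_mem_nhdsWithin ?_
  have : Iio (μ + 1) ×ˢ univ ∈ nhds (μ, x) :=
    (isOpen_Iio.prod isOpen_univ).mem_nhds ⟨by simp, trivial⟩
  filter_upwards [self_mem_nhdsWithin, mem_nhdsWithin_of_mem_nhds this] with q hq hq2
  exact ⟨⟨hq.1, le_of_lt hq2.1⟩, hq.2⟩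

theorem abs_clampNl_sub_clampNl_le {p α μ ν x y : ℝ} (hp : 1 < p) (hα : 0 < α) (hμ : 0 ≤ μ) :
    |clampNl p α μ x - clampNl p α ν y| ≤ (α * (α + 1) + μ * p) * |x - y| + |μ - ν| := by
  have h1 := abs_clampNl_sub_le (x := x) (y := y) hp hα hμ
  have h2 : |clampNl p α μ y - clampNl p α ν y| ≤ |μ - ν| := by
    have h3 : 0 ≤ max 0 (min y 1) := le_max_left _ _
    have h4 : max 0 (min y 1) ^ p ≤ 1 :=
      Real.rpow_le_one h3 (max_le zero_le_one (min_le_right _ _)) (by linarith)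
    have h5 : clampNl p α μ y - clampNl p α ν y = -((μ - ν) * max 0 (min y 1) ^ p) := by
      unfold clampNl; ring
    rw [h5, abs_neg, abs_mul, abs_of_nonneg (Real.rpow_nonneg h3 p)]
    exact mul_le_of_le_one_right (abs_nonneg _) h4
  calc _ = |(clampNl p α μ x - clampNl p α μ y) + (clampNl p α μ y - clampNl p α ν y)| := by
        congr 1; ring
    _ ≤ _ := (abs_add_le _ _).trans (add_le_add h1 h2)

section Family

variable {d : ℕ} {p α κ : ℝ} {Φ : ℝ → ℝ → ℝ}

theorem exists_abs_profile_sub_le (hP : ProfileParams d p α κ)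
    (hΦ : ∀ μ ∈ Ici (α * (α + 1)), IsNormalizedProfile d p α κ μ (Φ μ)) (M : ℝ) :
    ∃ K, 0 ≤ K ∧ ∀ μ ∈ Icc (α * (α + 1)) M, ∀ ν ∈ Icc (α * (α + 1)) M, ∀ x ∈ Icc (0 : ℝ) 1,
      |Φ μ x - Φ ν x| ≤ K * |μ - ν| ∧
      |clampNl p α μ (Φ μ x) - clampNl p α ν (Φ ν x)| ≤ K * |μ - ν| := by
  have hα := hP.alpha_pos
  have hp := hP.one_lt
  set l := α * (α + 1) + |M| * p + 1 with hl
  have hM : 0 ≤ |M| * p := by positivity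
  have hα2 : 0 < α * (α + 1) := by positivity
  have hl1 : 1 ≤ l := by rw [hl]; linarith
  have key : ∀ μ ∈ Icc (α * (α + 1)) M, ∀ x y ν : ℝ,
      |clampNl p α μ x - clampNl p α ν y| ≤ l * |x - y| + |μ - ν| := fun μ hμ x y ν => by
    refine (abs_clampNl_sub_clampNl_le hp hα (hα2.le.trans hμ.1)).trans ?_
    gcongr
    have : μ * p ≤ |M| * p :=
      mul_le_mul_of_nonneg_right (hμ.2.trans (le_abs_self M)) (by linarith)
    linarith
  have hE : 0 ≤ expWeight κ (2 * l) 1 := (expWeight_pos _ _).le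
  refine ⟨l * expWeight κ (2 * l) 1 + 1 + expWeight κ (2 * l) 1, by positivity,
    fun μ hμ ν hν x hx => ?_⟩
  have h1 := hΦ μ hμ.1
  have h2 := hΦ ν hν.1
  have h3 := volterra_stability (d := d) hP.kappa_pos hP.kappa_lt_one hl1 (abs_nonneg (μ - ν))
    h1.continuousOn h2.continuousOn (h1.continuousOn_nl hP) (h2.continuousOn_nl hP) h1.eq h2.eq
    (fun y _ => key μ hμ (Φ μ y) (Φ ν y) ν) hx
  have h4 := key μ hμ (Φ μ x) (Φ ν x) ν
  have h5 := abs_nonneg (μ - ν)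
  have h6 := mul_nonneg hE h5
  have h7 : l * |Φ μ x - Φ ν x| ≤ l * (|μ - ν| * expWeight κ (2 * l) 1) :=
    mul_le_mul_of_nonneg_left h3 (by linarith)
  have h8 : 0 ≤ l * (expWeight κ (2 * l) 1 * |μ - ν|) := mul_nonneg (by linarith) h6
  constructor <;> nlinarith

theorem continuousOn_uncurry_profile (hP : ProfileParams d p α κ)
    (hΦ : ∀ μ ∈ Ici (α * (α + 1)), IsNormalizedProfile d p α κ μ (Φ μ)) :
    ContinuousOn (fun q : ℝ × ℝ => Φ q.1 q.2) (Ici (α * (α + 1)) ×ˢ Icc 0 1) :=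
  continuousOn_uncurry_of_locally_lipschitz (fun μ hμ => (hΦ μ hμ).continuousOn) fun M => by
    obtain ⟨K, -, hK⟩ := exists_abs_profile_sub_le hP hΦ M
    exact ⟨K, fun μ hμ ν hν x hx => (hK μ hμ ν hν x hx).1⟩

theorem continuousOn_uncurry_rpow_mul_fluxOp (hP : ProfileParams d p α κ)
    (hΦ : ∀ μ ∈ Ici (α * (α + 1)), IsNormalizedProfile d p α κ μ (Φ μ)) :
    ContinuousOn (fun q : ℝ × ℝ => q.2 ^ (-α) * fluxOp d κ (fun y => clampNl p α q.1 (Φ q.1 y)) q.2)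
      (Ici (α * (α + 1)) ×ˢ Icc 0 1) := by
  have hαd : α < d := by linarith [hP.alpha_lt]
  refine continuousOn_uncurry_of_locally_lipschitz
    (F := fun μ x => x ^ (-α) * fluxOp d κ (fun y => clampNl p α μ (Φ μ y)) x)
    (fun μ hμ => continuousOn_rpow_mul_fluxOp hP.kappa_pos hP.kappa_lt_one hαd
      ((hΦ μ hμ).continuousOn_nl hP)) fun M => ?_
  obtain ⟨K, hK0, hK⟩ := exists_abs_profile_sub_le hP hΦ M
  refine ⟨K / κ, fun μ hμ ν hν x hx => ?_⟩
  rw [← mul_sub, fluxOp_sub hP.kappa_pos hP.kappa_lt_one ((hΦ μ hμ.1).continuousOn_nl hP)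
    ((hΦ ν hν.1).continuousOn_nl hP) hx]
  have h0 : 0 ≤ K * |μ - ν| := mul_nonneg hK0 (abs_nonneg _)
  refine (abs_rpow_mul_fluxOp_le hP.kappa_pos hP.kappa_lt_one hαd hx h0
    fun y hy => (hK μ hμ ν hν y ⟨hy.1, hy.2.trans hx.2⟩).2).trans ?_
  have h1 : 0 ≤ K * |μ - ν| / κ := div_nonneg h0 hP.kappa_pos.le
  calc _ ≤ K * |μ - ν| / κ := mul_le_of_le_one_right h1 hx.2
    _ = _ := by ring

variable {c : ℝ → ℝ}

theorem continuousOn_uncurry_ssV (hP : ProfileParams d p α κ)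
    (hΦ : ∀ μ ∈ Ici (α * (α + 1)), IsNormalizedProfile d p α κ μ (Φ μ))
    (hc : ContinuousOn c (Ici (α * (α + 1)))) :
    ContinuousOn (fun q : ℝ × ℝ => ssV α (c q.1) (Φ q.1) q.2)
      (Ici (α * (α + 1)) ×ˢ Icc 0 1) := by
  unfold ssV
  exact ((hc.comp continuousOn_fst fun q hq => hq.1).mul (continuousOn_snd.rpow_const
    fun _ _ => Or.inr hP.alpha_pos.le)).mul (continuousOn_uncurry_profile hP hΦ)

theorem continuousOn_uncurry_ssP (hP : ProfileParams d p α κ)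
    (hΦ : ∀ μ ∈ Ici (α * (α + 1)), IsNormalizedProfile d p α κ μ (Φ μ))
    (hc : ContinuousOn c (Ici (α * (α + 1)))) :
    ContinuousOn (fun q : ℝ × ℝ => ssP d p α κ q.1 (c q.1) (Φ q.1) q.2)
      (Ici (α * (α + 1)) ×ˢ Icc 0 1) := by
  unfold ssP
  have hαd := hP.alpha_lt
  refine (hc.comp continuousOn_fst fun q hq => hq.1).mul ((continuousOn_const.mul
    (((continuousOn_snd.rpow_const fun _ _ => Or.inr (by linarith)).mul ?_).mul
      (continuousOn_uncurry_profile hP hΦ))).add (continuousOn_uncurry_rpow_mul_fluxOp hP hΦ))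
  exact ContinuousOn.rpow_const (by fun_prop) fun _ _ => Or.inr hP.kappa_pos.le

end Family

/-- The trajectory `(ssV - b, ssP)` as a complex number. -/
noncomputable def ssZ (d : ℕ) (p α κ b μ c : ℝ) (φ : ℝ → ℝ) (x : ℝ) : ℂ :=
  ((ssV α c φ x - b : ℝ) : ℂ) - ((ssP d p α κ μ c φ x : ℝ) : ℂ) * Complex.I

section SsZ

variable {d : ℕ} {p α κ b μ c : ℝ} {φ : ℝ → ℝ}

@[simp] theorem ssZ_re (x : ℝ) : (ssZ d p α κ b μ c φ x).re = ssV α c φ x - b := by simp [ssZ]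

@[simp] theorem ssZ_im (x : ℝ) : (ssZ d p α κ b μ c φ x).im = -ssP d p α κ μ c φ x := by simp [ssZ]

theorem ssV_zero (hα : 0 < α) : ssV α c φ 0 = 0 := by simp [ssV, Real.zero_rpow hα.ne']

theorem ssP_zero (hP : ProfileParams d p α κ) : ssP d p α κ μ c φ 0 = 0 := by
  have : (d : ℝ) - 1 - α ≠ 0 := by linarith [hP.alpha_lt]
  simp [ssP, fluxOp, Real.zero_rpow this]

theorem exp_log_add_pi_mul_I (hb : 0 < b) :
    Complex.exp (Real.log b + Real.pi * Complex.I) = -(b : ℂ) := by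
  rw [Complex.exp_add, Complex.exp_pi_mul_I, ← Complex.ofReal_exp, Real.exp_log hb]
  simp

theorem IsNormalizedProfile.angle_deriv_pos (hP : ProfileParams d p α κ) (hμ : α * (α + 1) ≤ μ)
    (hφ : IsNormalizedProfile d p α κ μ φ) (hc : 0 < c) (hcμ : c ^ (p - 1) = μ)
    (hb : 0 < b) (hbβ : b ^ (p - 1) = α * (d - 1 - α)) {L : ℝ → ℂ}
    (hL : ContinuousOn L (Icc 0 1))
    (hexp : ∀ x ∈ Icc (0 : ℝ) 1, Complex.exp (L x) = ssZ d p α κ b μ c φ x) {x : ℝ}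
    (hx : x ∈ Ioo (0 : ℝ) 1) : ∃ θ', 0 < θ' ∧ HasDerivAt (fun x => (L x).im) θ' x := by
  have hx2 : (0 : ℝ) < 1 - x ^ 2 := by nlinarith [hx.1, hx.2]
  have h1 := (hφ.hasDerivAt_ssV' (c := c) hP hx).sub_const b
  have h2 := hφ.hasDerivAt_ssP hP hμ hc hcμ hx
  have h3 := h1.ofReal_comp.sub (h2.ofReal_comp.mul_const Complex.I)
  have h4 : HasDerivAt L _ x := hasDerivAt_of_exp_eq (Z := ssZ d p α κ b μ c φ)
    (hL.continuousAt (Icc_mem_nhds hx.1 hx.2))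
    (by filter_upwards [isOpen_Ioo.mem_nhds hx] with y hy using hexp y (Ioo_subset_Icc_self hy)) h3
  refine ⟨_, ?_, Complex.imCLM.hasFDerivAt.comp_hasDerivAt x h4⟩
  set A := x ^ (-(d - 1 - 2 * α) - 1) * (1 - x ^ 2) ^ (-κ) with hA
  set B := x ^ (d - 1 - 2 * α - 1) * (1 - x ^ 2) ^ (κ - 1) with hB
  have hA0 : 0 < A := mul_pos (Real.rpow_pos_of_pos hx.1 _) (Real.rpow_pos_of_pos hx2 _)
  have hB0 : 0 < B := mul_pos (Real.rpow_pos_of_pos hx.1 _) (Real.rpow_pos_of_pos hx2 _)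
  set V := ssV α c φ x with hV
  set P := ssP d p α κ μ c φ x with hPd
  set f := potNl p (α * (d - 1 - α)) V with hf
  have hz : ssZ d p α κ b μ c φ x ≠ 0 := by
    rw [← hexp x (Ioo_subset_Icc_self hx)]; exact Complex.exp_ne_zero _
  have hn := Complex.normSq_pos.2 hz
  rw [Complex.imCLM_apply, Complex.div_im]
  simp only [ssZ_re, ssZ_im, ← hV, ← hPd, Complex.sub_re, Complex.sub_im, Complex.ofReal_re,
    Complex.ofReal_im, Complex.mul_re, Complex.mul_im, Complex.I_re, Complex.I_im]
  rw [← sub_div]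
  refine div_pos ?_ hn
  have hVpos : 0 < V := mul_pos (mul_pos hc (Real.rpow_pos_of_pos hx.1 _))
    (hφ.pos hP hμ (Ioo_subset_Icc_self hx))
  have key : 0 < A * P ^ 2 + B * (f * (V - b)) := by
    by_cases hVb : V = b
    · have hP0 : P ≠ 0 := fun h => hφ.not_rest hP hμ hc hcμ hb hbβ (Ioo_subset_Icc_self hx) ⟨hVb, h⟩
      rw [hVb]
      have := mul_pos hA0 (by positivity : 0 < P ^ 2)
      linarith
    · have h5 := mul_pos hB0 (potNl_mul_sub_pos hb hbβ hP.one_lt hVpos hVb)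
      have h6 := mul_nonneg hA0.le (sq_nonneg P)
      linarith
  linear_combination key

end SsZ

theorem exists_angle {d : ℕ} {p α κ b : ℝ} {c : ℝ → ℝ} {Φ : ℝ → ℝ → ℝ}
    (hP : ProfileParams d p α κ)
    (hΦ : ∀ μ ∈ Ici (α * (α + 1)), IsNormalizedProfile d p α κ μ (Φ μ))
    (hcc : ContinuousOn c (Ici (α * (α + 1)))) (hc : ∀ μ ∈ Ici (α * (α + 1)), 0 < c μ)
    (hcμ : ∀ μ ∈ Ici (α * (α + 1)), c μ ^ (p - 1) = μ)
    (hb : 0 < b) (hbβ : b ^ (p - 1) = α * (d - 1 - α)) :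
    ∃ θ : ℝ → ℝ → ℝ,
      ContinuousOn (fun q : ℝ × ℝ => θ q.1 q.2) (Ici (α * (α + 1)) ×ˢ Icc 0 1) ∧
      ∀ μ ∈ Ici (α * (α + 1)), θ μ 0 = Real.pi ∧ StrictMonoOn (θ μ) (Icc 0 1) ∧
        ∀ x ∈ Icc (0 : ℝ) 1, ∃ r > 0, ssV α (c μ) (Φ μ) x - b = r * Real.cos (θ μ x) ∧
          -ssP d p α κ μ (c μ) (Φ μ) x = r * Real.sin (θ μ x) := by
  obtain ⟨L, hLc, hL0, hL⟩ := exists_continuous_log (a := α * (α + 1))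
    (Z := fun μ => ssZ d p α κ b μ (c μ) (Φ μ)) (l := Real.log b + Real.pi * Complex.I)
    (by
      unfold ssZ
      exact (Complex.continuous_ofReal.comp_continuousOn
        ((continuousOn_uncurry_ssV hP hΦ hcc).sub continuousOn_const)).sub
          ((Complex.continuous_ofReal.comp_continuousOn
            (continuousOn_uncurry_ssP hP hΦ hcc)).mul continuousOn_const))
    (fun μ hμ x hx h => by
      refine (hΦ μ hμ).not_rest hP hμ (hc μ hμ) (hcμ μ hμ) hb hbβ hx ⟨?_, ?_⟩
      · have := congrArg Complex.re h
        simp at this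
        linarith
      · have := congrArg Complex.im h
        simpa using this)
    (fun μ hμ => by
      rw [exp_log_add_pi_mul_I hb, ssZ, ssV_zero hP.alpha_pos, ssP_zero hP]
      simp)
  refine ⟨fun μ x => (L μ x).im, Complex.continuous_im.comp_continuousOn hLc, fun μ hμ => ?_⟩
  have hLμ : ContinuousOn (L μ) (Icc 0 1) :=
    hLc.comp (f := fun x => (μ, x)) (by fun_prop) fun x hx => ⟨hμ, hx⟩
  refine ⟨by simp [hL0 μ hμ], ?_, fun x hx => ?_⟩
  · refine strictMonoOn_of_deriv_pos (convex_Icc 0 1)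
      (Complex.continuous_im.comp_continuousOn hLμ) fun x hx => ?_
    rw [interior_Icc] at hx
    obtain ⟨θ', h1, h2⟩ := (hΦ μ hμ).angle_deriv_pos hP hμ (hc μ hμ) (hcμ μ hμ) hb hbβ hLμ
      (hL μ hμ) hx
    rw [h2.deriv]
    exact h1
  · have h := hL μ hμ x hx
    refine ⟨Real.exp (L μ x).re, Real.exp_pos _, ?_, ?_⟩
    · rw [← Complex.exp_re, h, ssZ_re]
    · rw [← Complex.exp_im, h, ssZ_im]

theorem ProfileParams.gamma_pos {d : ℕ} {p α κ : ℝ} (hP : ProfileParams d p α κ) :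
    0 < (d : ℝ) - 1 - 2 * α := by linarith [hP.two_alpha, hP.kappa_lt]

theorem ProfileParams.gamma_lt_one {d : ℕ} {p α κ : ℝ} (hP : ProfileParams d p α κ) :
    (d : ℝ) - 1 - 2 * α < 1 := by linarith [hP.two_alpha, hP.kappa_pos]

theorem sq_rpow {x : ℝ} (hx : 0 ≤ x) (a : ℝ) : (x ^ 2) ^ a = (x ^ a) ^ 2 := by
  rw [← Real.rpow_natCast, ← Real.rpow_natCast, ← Real.rpow_mul hx, ← Real.rpow_mul hx, mul_comm]

theorem rpow_two_mul {x : ℝ} (hx : 0 ≤ x) (a : ℝ) : x ^ (2 * a) = (x ^ a) ^ 2 := by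
  rw [← Real.rpow_natCast, ← Real.rpow_mul hx, mul_comm, Nat.cast_ofNat]

namespace IsNormalizedProfile

variable {d : ℕ} {p α κ μ c : ℝ} {φ : ℝ → ℝ}

theorem abs_profDeriv_le (hP : ProfileParams d p α κ) (hμ : α * (α + 1) ≤ μ)
    (hφ : IsNormalizedProfile d p α κ μ φ) {x : ℝ} (hx : x ∈ Icc (0 : ℝ) (1 / 2)) :
    |profDeriv d p α κ μ φ x| ≤ 2 * μ * x / κ := by
  have hα := hP.alpha_pos
  have hκ := hP.kappa_pos
  have hμ0 : 0 < μ := lt_of_lt_of_le (by positivity) hμ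
  have hx1 : x ∈ Icc (0 : ℝ) 1 := ⟨hx.1, by linarith [hx.2]⟩
  have h1 := abs_fluxOp_div_le (d := d) hκ hP.kappa_lt_one (G := μ)
    (g := fun y => clampNl p α μ (φ y)) hx1 hμ0.le (fun y hy => by
      have hy1 : y ∈ Icc (0 : ℝ) 1 := ⟨hy.1, hy.2.trans hx1.2⟩
      have h0 := (hφ.pos hP hμ hy1).le
      have h1 := hφ.le_one hP hμ hy1
      have h2 : φ y ^ p ≤ 1 := Real.rpow_le_one h0 h1 (by linarith [hP.one_lt])
      have h3 := Real.rpow_nonneg h0 p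
      have h4 : 0 < α * (α + 1) := by positivity
      rw [clampNl_of_mem h0 h1, abs_le]
      constructor <;> nlinarith)
  refine h1.trans ?_
  have h2 : (1 - x) ^ (-κ) ≤ 2 := by
    have h3 : (1 - x) ^ (-κ) ≤ (1 - x) ^ (-1 : ℝ) :=
      Real.rpow_le_rpow_of_exponent_ge (by linarith [hx.2]) (by linarith [hx.1])
        (by linarith [hP.kappa_lt])
    refine h3.trans ?_
    rw [Real.rpow_neg_one]
    exact inv_le_of_inv_le₀ (by norm_num) (by linarith [hx.2])
  calc μ * (x * ((1 - x) ^ (-κ) / κ)) ≤ μ * (x * (2 / κ)) := by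
        have := hx.1
        gcongr
    _ = _ := by ring

theorem one_sub_le (hP : ProfileParams d p α κ) (hμ : α * (α + 1) ≤ μ)
    (hφ : IsNormalizedProfile d p α κ μ φ) {x : ℝ} (hx : x ∈ Ioc (0 : ℝ) (1 / 2)) :
    1 - φ x ≤ 2 * μ * x ^ 2 / κ := by
  have hα := hP.alpha_pos
  have hκ := hP.kappa_pos
  have hμ0 : 0 < μ := lt_of_lt_of_le (by positivity) hμ
  obtain ⟨y, hy, hyd⟩ := exists_hasDerivAt_eq_slope φ (profDeriv d p α κ μ φ) hx.1
    (hφ.continuousOn.mono (Icc_subset_Icc le_rfl (by linarith [hx.2])))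
    (fun y hy => hφ.hasDerivAt hP ⟨hy.1, by linarith [hx.2, hy.2]⟩)
  have h1 := hφ.abs_profDeriv_le hP hμ (x := y) ⟨hy.1.le, by linarith [hx.2, hy.2]⟩
  rw [hyd, hφ.zero, sub_zero, abs_div, abs_of_pos hx.1, div_le_iff₀ hx.1] at h1
  have h2 := neg_abs_le (φ x - 1)
  have h3 : 2 * μ * y / κ * x ≤ 2 * μ * x / κ * x := by
    have := hy.2.le
    have := hx.1.le
    gcongr
  calc 1 - φ x ≤ 2 * μ * x / κ * x := by linarith
    _ = _ := by ring

theorem le_ssW (hP : ProfileParams d p α κ) (hμ : α * (α + 1) ≤ μ)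
    (hφ : IsNormalizedProfile d p α κ μ φ) (hc : 0 < c) {x : ℝ}
    (hx : x ∈ Ioc (0 : ℝ) (1 / 2)) (h1 : 2 * μ * x ^ 2 / κ ≤ 1 / 4)
    (h2 : 2 * μ * x ^ 2 / κ ≤ α / 4) : α / 2 * (c * x ^ α) ≤ ssW d p α κ μ c φ x := by
  have hα := hP.alpha_pos
  have h3 := hφ.one_sub_le hP hμ hx
  have h4 := (abs_le.1 (hφ.abs_profDeriv_le hP hμ (Ioc_subset_Icc_self hx))).1
  have h5 : x * -(2 * μ * x / κ) ≤ x * profDeriv d p α κ μ φ x :=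
    mul_le_mul_of_nonneg_left h4 hx.1.le
  have h6 : x * -(2 * μ * x / κ) = -(2 * μ * x ^ 2 / κ) := by ring
  have h7 : 0 < c * x ^ α := mul_pos hc (Real.rpow_pos_of_pos hx.1 _)
  rw [ssW, mul_comm]
  refine mul_le_mul_of_nonneg_left ?_ h7.le
  nlinarith

theorem ssE_le (hP : ProfileParams d p α κ) (hμ : α * (α + 1) ≤ μ)
    (hφ : IsNormalizedProfile d p α κ μ φ) (hc : 0 < c) (hcμ : c ^ (p - 1) = μ) {x : ℝ}
    (hx : x ∈ Ioc (0 : ℝ) (1 / 4)) (h1 : 2 * μ * (2 * x) ^ 2 / κ ≤ 1 / 4)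
    (h2 : 2 * μ * (2 * x) ^ 2 / κ ≤ α / 4) :
    ssE d p α κ μ c φ x ≤
      -((d - 1 - 2 * α) * α / 8 * (μ * x ^ 2) ^ α * (1 - (1 / 2) ^ (2 * α))) := by
  have hα := hP.alpha_pos
  have hκ := hP.kappa_pos
  have hγ := hP.gamma_pos
  have hμ0 : 0 < μ := lt_of_lt_of_le (by positivity) hμ
  set k := ((d : ℝ) - 1 - 2 * α) * α / 8 * c ^ 2 with hk
  have hanti := antitoneOn_of_hasDerivAt_nonpos (a := 0) (b := 2 * x)
    (e := fun y => ssE d p α κ μ c φ y + k * y ^ (2 * α))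
    (e' := fun y => -((d - 1 - 2 * α) * ssW d p α κ μ c φ y ^ 2 / y) +
      k * (2 * α * y ^ (2 * α - 1)))
    (fun y hy => (hφ.hasDerivAt_ssE hP hμ hc hcμ ⟨hy.1, by linarith [hy.2, hx.2]⟩).add
      ((Real.hasDerivAt_rpow_const (Or.inl hy.1.ne')).const_mul k))
    (fun y hy => by
      have hle : 2 * μ * y ^ 2 / κ ≤ 2 * μ * (2 * x) ^ 2 / κ := by
        have := hy.1.le
        have := hy.2.le
        gcongr
      have hW := hφ.le_ssW hP hμ hc (x := y) ⟨hy.1, by linarith [hy.2, hx.2]⟩ (hle.trans h1)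
        (hle.trans h2)
      have hyα := Real.rpow_pos_of_pos hy.1 α
      have hW2 := pow_le_pow_left₀ (by positivity) hW 2
      rw [Real.rpow_sub_one hy.1.ne', rpow_two_mul hy.1.le]
      have h3 : -((d - 1 - 2 * α) * ssW d p α κ μ c φ y ^ 2 / y) +
          k * (2 * α * ((y ^ α) ^ 2 / y)) =
          -((d - 1 - 2 * α) * (ssW d p α κ μ c φ y ^ 2 - (α / 2 * (c * y ^ α)) ^ 2) / y) := by
        rw [hk]; ring
      rw [h3, neg_nonpos]
      exact div_nonneg (mul_nonneg hγ.le (by linarith)) hy.1.le)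
  have h3 := hanti (a := x / 2) (b := x) ⟨by linarith [hx.1], by linarith [hx.1]⟩
    ⟨hx.1, by linarith [hx.1]⟩ (by linarith [hx.1])
  simp only at h3
  have h4 := hφ.ssE_neg hP hμ hc hcμ (x := x / 2) ⟨by linarith [hx.1], by linarith [hx.1, hx.2]⟩
  have h5 : (x / 2) ^ (2 * α) = x ^ (2 * α) * (1 / 2) ^ (2 * α) := by
    rw [← Real.mul_rpow hx.1.le (by norm_num)]; congr 1; ring
  have h6 : (μ * x ^ 2) ^ α = c ^ 2 * x ^ (2 * α) := by
    rw [Real.mul_rpow hμ0.le (by positivity), sq_rpow hx.1.le, rpow_two_mul hx.1.le, ← hcμ,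
      ← Real.rpow_mul hc.le, mul_comm (p - 1), hP.alpha_mul, Real.rpow_two]
  rw [h5] at h3
  rw [h6]
  linear_combination h3 + h4 + x ^ (2 * α) * (1 / 2) ^ (2 * α) * hk - x ^ (2 * α) * hk

end IsNormalizedProfile

/-- Uniformly in the parameter, the trajectory keeps away from the origin once
`x` exceeds a fixed multiple of `1/√μ`. -/
theorem exists_ssV_lower_bound {d : ℕ} {p α κ : ℝ} (hP : ProfileParams d p α κ) :
    ∃ η > 0, ∃ v₀ > 0, ∀ μ c φ, α * (α + 1) ≤ μ → IsNormalizedProfile d p α κ μ φ → 0 < c →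
      c ^ (p - 1) = μ → ∀ x ∈ Ico (η / √μ) 1, v₀ ≤ ssV α c φ x := by
  have hα := hP.alpha_pos
  have hκ := hP.kappa_pos
  have hγ := hP.gamma_pos
  set s := min (α * (α + 1) / 16) (min (κ / 32) (α * κ / 32)) with hs
  have hs0 : 0 < s := by positivity
  have hs1 : s ≤ α * (α + 1) / 16 := min_le_left _ _
  have hs2 : s ≤ κ / 32 := (min_le_right _ _).trans (min_le_left _ _)
  have hs3 : s ≤ α * κ / 32 := (min_le_right _ _).trans (min_le_right _ _)
  set E := ((d : ℝ) - 1 - 2 * α) * α / 8 * s ^ α * (1 - (1 / 2) ^ (2 * α)) with hE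
  have hE0 : 0 < E := by
    have h1 : (1 / 2 : ℝ) ^ (2 * α) < 1 :=
      Real.rpow_lt_one (by norm_num) (by norm_num) (by positivity)
    have h2 := Real.rpow_pos_of_pos hs0 α
    have h3 : 0 < 1 - (1 / 2 : ℝ) ^ (2 * α) := by linarith
    positivity
  have hev : ∀ᶠ v in nhds (0 : ℝ), -E < pot p (α * (d - 1 - α)) v := by
    have := (continuous_pot (β := α * (d - 1 - α)) hP.one_lt).tendsto 0
    rw [pot_zero] at this
    exact this.eventually (lt_mem_nhds (by linarith))
  obtain ⟨v₀, hv₀, hball⟩ := Metric.eventually_nhds_iff.1 hev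
  refine ⟨√s, Real.sqrt_pos.2 hs0, v₀, hv₀, fun μ c φ hμ hφ hc hcμ x hx => ?_⟩
  have hμ0 : 0 < μ := lt_of_lt_of_le (by positivity) hμ
  set y := √s / √μ with hy
  have hy0 : 0 < y := div_pos (Real.sqrt_pos.2 hs0) (Real.sqrt_pos.2 hμ0)
  have hy2 : μ * y ^ 2 = s := by
    rw [hy, div_pow, Real.sq_sqrt hs0.le, Real.sq_sqrt hμ0.le]
    field_simp
  have hy4 : y ≤ 1 / 4 := by
    have : y ^ 2 ≤ (1 / 4) ^ 2 := by
      by_contra h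
      push Not at h
      nlinarith
    exact le_of_sq_le_sq this (by norm_num)
  have e1 : 2 * μ * (2 * y) ^ 2 / κ = 8 * s / κ := by rw [← hy2]; ring
  have h1 := hφ.ssE_le hP hμ hc hcμ ⟨hy0, hy4⟩
    (by rw [e1, div_le_iff₀ hκ]; linarith) (by rw [e1, div_le_iff₀ hκ]; linarith)
  rw [hy2, ← hE] at h1
  have hx1 : x ∈ Ioo (0 : ℝ) 1 := ⟨hy0.trans_le hx.1, hx.2⟩
  have h2 := hφ.antitoneOn_ssE hP hμ hc hcμ ⟨hy0, by linarith⟩ hx1 hx.1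
  have h3 := IsNormalizedProfile.pot_ssV_le_ssE (p := p) (κ := κ) (μ := μ) (c := c) (φ := φ)
    (d := d) (α := α) hx1
  by_contra hlt
  push Not at hlt
  have hV : 0 < ssV α c φ x := mul_pos (mul_pos hc (Real.rpow_pos_of_pos hx1.1 _))
    (hφ.pos hP hμ (Ioo_subset_Icc_self hx1))
  have := hball (y := ssV α c φ x) (by rwa [Real.dist_eq, sub_zero, abs_of_pos hV])
  linarith

theorem monotoneOn_Icc_of_hasDerivAt {e e' : ℝ → ℝ} {a b : ℝ}
    (hd : ∀ x ∈ Icc a b, HasDerivAt e (e' x) x) (hn : ∀ x ∈ Icc a b, 0 ≤ e' x) :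
    MonotoneOn e (Icc a b) := by
  refine monotoneOn_of_deriv_nonneg (convex_Icc a b)
    (fun y hy => (hd y hy).continuousAt.continuousWithinAt) (fun y hy => ?_) fun y hy => ?_
  · exact (hd y (interior_subset hy)).differentiableAt.differentiableWithinAt
  · rw [(hd y (interior_subset hy)).deriv]
    exact hn y (interior_subset hy)

/-- Near and above the rest point, the nonlinearity is at least linear with slope one. -/
theorem exists_sq_le_potNl_mul {p β b : ℝ} (hp : 1 < p) (hb : 0 < b) (hbβ : b ^ (p - 1) = β)
    (h1 : 1 < (p - 1) * β) :
    ∃ δ > 0, ∀ v, b - δ ≤ v → (v - b) ^ 2 ≤ potNl p β v * (v - b) := by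
  have hcont : ContinuousAt (fun v : ℝ => p * v ^ (p - 1) - β) b :=
    ((Real.continuousAt_rpow_const _ _ (Or.inl hb.ne')).const_mul p).sub continuousAt_const
  have hev : ∀ᶠ v in nhds b, 1 < p * v ^ (p - 1) - β := by
    refine hcont.eventually (lt_mem_nhds ?_)
    simp only [hbβ]
    linarith
  obtain ⟨δ, hδ, hball⟩ := Metric.eventually_nhds_iff.1 hev
  set δ' := min (δ / 2) (b / 2) with hδ'
  have hδ0 : 0 < δ' := lt_min (by linarith) (by linarith)
  have hδ1 : δ' ≤ δ / 2 := min_le_left _ _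
  have hδ2 : δ' ≤ b / 2 := min_le_right _ _
  have hslope : ∀ v, b - δ' ≤ v → 0 ≤ p * v ^ (p - 1) - β - 1 := fun v hv => by
    have h2 := hball (y := b - δ') (by rw [Real.dist_eq, abs_lt]; constructor <;> linarith)
    have h3 := Real.rpow_le_rpow (by linarith) hv (by linarith : 0 ≤ p - 1)
    nlinarith
  have hd : ∀ v, b - δ' ≤ v →
      HasDerivAt (fun v => potNl p β v - v) (p * v ^ (p - 1) - β - 1) v := fun v hv => by
    have hv0 : 0 < v := by linarith
    have h2 := ((Real.hasDerivAt_rpow_const (x := v) (p := p) (Or.inl hv0.ne')).sub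
      ((hasDerivAt_id v).const_mul β)).sub (hasDerivAt_id v)
    rw [mul_one] at h2
    refine h2.congr_of_eventuallyEq ?_
    filter_upwards [lt_mem_nhds hv0] with u hu
    simp [potNl, max_eq_right hu.le]
  have hmono : MonotoneOn (fun v => potNl p β v - v) (Ici (b - δ')) := fun u hu v hv huv =>
    monotoneOn_Icc_of_hasDerivAt (a := u) (b := v) (fun w hw => hd w (le_trans hu hw.1))
      (fun w hw => hslope w (le_trans hu hw.1)) ⟨le_rfl, huv⟩ ⟨huv, le_rfl⟩ huv
  refine ⟨δ', hδ0, fun v hv => ?_⟩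
  have hbm : b ∈ Ici (b - δ') := by simp [hδ0.le]
  have h0 := potNl_eq_zero hb hbβ
  rcases le_total v b with h | h
  · have := hmono hv hbm h
    simp only [h0] at this
    nlinarith
  · have := hmono hbm hv h
    simp only [h0] at this
    nlinarith

theorem ProfileParams.one_lt_slope {d : ℕ} {p α κ : ℝ} (hP : ProfileParams d p α κ) :
    1 < (p - 1) * (α * (d - 1 - α)) := by
  have h1 : (p - 1) * (α * (d - 1 - α)) = 2 * (d - 1 - α) := by rw [← hP.alpha_mul]; ring
  have h2 : (2 : ℝ) ≤ d := by exact_mod_cast hP.two_le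
  rw [h1]
  linarith [hP.two_alpha, hP.kappa_lt]

namespace IsNormalizedProfile

variable {d : ℕ} {p α κ μ c b : ℝ} {φ : ℝ → ℝ}

theorem ssV_pos (hP : ProfileParams d p α κ) (hμ : α * (α + 1) ≤ μ)
    (hφ : IsNormalizedProfile d p α κ μ φ) (hc : 0 < c) {x : ℝ} (hx : x ∈ Ioc (0 : ℝ) 1) :
    0 < ssV α c φ x :=
  mul_pos (mul_pos hc (Real.rpow_pos_of_pos hx.1 _)) (hφ.pos hP hμ (Ioc_subset_Icc_self hx))

/-- A Riccati comparison: where the nonlinearity is superlinear, `ssV - b` cannot keep a sign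
over a logarithmic length `2π`. -/
theorem log_sub_log_lt (hP : ProfileParams d p α κ) (hμ : α * (α + 1) ≤ μ)
    (hφ : IsNormalizedProfile d p α κ μ φ) (hc : 0 < c) (hcμ : c ^ (p - 1) = μ) {x₁ x₂ : ℝ}
    (h0 : 0 < x₁) (h12 : x₁ ≤ x₂) (h2 : x₂ ≤ 1 / 2)
    (hne : ∀ x ∈ Icc x₁ x₂, ssV α c φ x ≠ b)
    (hsup : ∀ x ∈ Icc x₁ x₂, (ssV α c φ x - b) ^ 2 ≤
      potNl p (α * (d - 1 - α)) (ssV α c φ x) * (ssV α c φ x - b)) :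
    Real.log x₂ - Real.log x₁ < 2 * Real.pi := by
  set V := ssV α c φ with hV
  set W := ssW d p α κ μ c φ with hW
  have hin : ∀ x ∈ Icc x₁ x₂, x ∈ Ioo (0 : ℝ) 1 := fun x hx =>
    ⟨h0.trans_le hx.1, by linarith [hx.2]⟩
  have hmono := monotoneOn_Icc_of_hasDerivAt (a := x₁) (b := x₂)
    (e := fun x => -(2 * Real.arctan (W x / (V x - b)) + Real.log x))
    (fun x hx => (((((hφ.hasDerivAt_ssW hP hμ hc hcμ (hin x hx)).div
      ((hφ.hasDerivAt_ssV (c := c) hP (hin x hx)).sub_const b)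
      (sub_ne_zero.2 (hne x hx))).arctan).const_mul 2).add
      (Real.hasDerivAt_log (hin x hx).1.ne')).neg)
    (fun x hx => by
      have hx0 := (hin x hx).1
      have hx2 : (0 : ℝ) < 1 - x ^ 2 := by nlinarith [hx0, (hin x hx).2]
      have hs := hsup x hx
      have hu := sub_ne_zero.2 (hne x hx)
      simp only [Pi.div_apply, ← hV, ← hW] at hs hu ⊢
      set f := potNl p (α * (d - 1 - α)) (V x) with hf
      set u := V x - b with hu'
      set w := W x with hw
      have hn : 0 < u ^ 2 + w ^ 2 := by positivity
      have hγ := hP.gamma_pos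
      have hγ1 := hP.gamma_lt_one
      set γ := (d : ℝ) - 1 - 2 * α with hγd
      have key : -(2 * (1 / (1 + (w / u) ^ 2) * ((-((γ - x ^ 2) * w + f) / (x * (1 - x ^ 2)) * u -
          w * (w / x)) / u ^ 2)) + x⁻¹) =
          (2 * (γ - x ^ 2) * w * u + 2 * (f * u - u ^ 2) + (1 + x ^ 2) * u ^ 2
            + (1 - x ^ 2) * w ^ 2) / (x * (1 - x ^ 2) * (u ^ 2 + w ^ 2)) := by
        have e1 : 1 + (w / u) ^ 2 = (u ^ 2 + w ^ 2) / u ^ 2 := by field_simp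
        rw [e1]
        have := hn.ne'
        have := hx2.ne'
        field_simp
        ring
      rw [key]
      refine div_nonneg ?_ (by positivity)
      have hx4 : x ^ 2 ≤ 1 / 4 := by nlinarith [hx.2, h2]
      have hq : (γ - x ^ 2) ^ 2 ≤ (1 - x ^ 2) * (1 + x ^ 2) := by nlinarith [sq_nonneg x]
      have hq2 : 0 ≤ (1 - x ^ 2) * (2 * (γ - x ^ 2) * w * u + (1 + x ^ 2) * u ^ 2
          + (1 - x ^ 2) * w ^ 2) := by
        nlinarith [sq_nonneg ((1 - x ^ 2) * w + (γ - x ^ 2) * u),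
          mul_nonneg (sub_nonneg.2 hq) (sq_nonneg u)]
      have hq3 := nonneg_of_mul_nonneg_right hq2 hx2
      linarith)
  have h3 := hmono ⟨le_rfl, h12⟩ ⟨h12, le_rfl⟩ h12
  simp only at h3
  have h4 := Real.arctan_lt_pi_div_two (W x₁ / (V x₁ - b))
  have h5 := Real.neg_pi_div_two_lt_arctan (W x₂ / (V x₂ - b))
  linarith

theorem sq_ssW_le (hP : ProfileParams d p α κ) (hμ : α * (α + 1) ≤ μ)
    (hφ : IsNormalizedProfile d p α κ μ φ) (hc : 0 < c) (hcμ : c ^ (p - 1) = μ)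
    (hb : 0 < b) (hbβ : b ^ (p - 1) = α * (d - 1 - α)) {x : ℝ} (hx : x ∈ Ioc (0 : ℝ) (1 / 2)) :
    ssW d p α κ μ c φ x ^ 2 ≤ 4 * -pot p (α * (d - 1 - α)) b := by
  have hx1 : x ∈ Ioo (0 : ℝ) 1 := ⟨hx.1, by linarith [hx.2]⟩
  have h1 := hφ.ssE_neg hP hμ hc hcμ hx1
  have h2 := pot_le_pot hb hbβ hP.one_lt (hφ.ssV_pos hP hμ hc (Ioo_subset_Ioc_self hx1)).le
  rw [ssE] at h1
  have h3 : x ^ 2 ≤ 1 / 4 := by nlinarith [hx.1, hx.2]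
  nlinarith [sq_nonneg (ssW d p α κ μ c φ x)]

end IsNormalizedProfile

namespace IsNormalizedProfile

variable {d : ℕ} {p α κ μ c b : ℝ} {φ : ℝ → ℝ}

theorem ssW_pos_iff_ssP {x : ℝ} (hx : x ∈ Ioo (0 : ℝ) 1) :
    0 < ssW d p α κ μ c φ x ↔ 0 < ssP d p α κ μ c φ x := by
  have hx2 : (0 : ℝ) < 1 - x ^ 2 := by nlinarith [hx.1, hx.2]
  rw [ssP_eq hx]
  have := mul_pos (Real.rpow_pos_of_pos hx.1 (d - 1 - 2 * α)) (Real.rpow_pos_of_pos hx2 κ)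
  exact (mul_pos_iff_of_pos_left this).symm

/-- Below the rest point the trajectory first decreases and then increases. -/
theorem ssV_le_max (hP : ProfileParams d p α κ) (hμ : α * (α + 1) ≤ μ)
    (hφ : IsNormalizedProfile d p α κ μ φ) (hc : 0 < c) (hcμ : c ^ (p - 1) = μ)
    (hbβ : b ^ (p - 1) = α * (d - 1 - α)) {x₁ x₂ : ℝ}
    (h0 : 0 < x₁) (h2 : x₂ < 1) (hlt : ∀ x ∈ Icc x₁ x₂, ssV α c φ x < b) {x : ℝ}
    (hx : x ∈ Icc x₁ x₂) : ssV α c φ x ≤ max (ssV α c φ x₁) (ssV α c φ x₂) := by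
  have hin : ∀ x ∈ Icc x₁ x₂, x ∈ Ioo (0 : ℝ) 1 := fun x hx =>
    ⟨h0.trans_le hx.1, hx.2.trans_lt h2⟩
  have hP_mono : MonotoneOn (ssP d p α κ μ c φ) (Icc x₁ x₂) :=
    monotoneOn_Icc_of_hasDerivAt (fun y hy => hφ.hasDerivAt_ssP hP hμ hc hcμ (hin y hy))
      fun y hy => by
        have hy1 := hin y hy
        have hx2 : (0 : ℝ) < 1 - y ^ 2 := by nlinarith [hy1.1, hy1.2]
        have h3 := potNl_neg hbβ hP.one_lt (hφ.ssV_pos hP hμ hc (Ioo_subset_Ioc_self hy1))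
          (hlt y hy)
        have h4 := mul_pos (Real.rpow_pos_of_pos hy1.1 (d - 1 - 2 * α - 1))
          (Real.rpow_pos_of_pos hx2 (κ - 1))
        rw [neg_nonneg]
        exact (mul_neg_of_pos_of_neg h4 h3).le
  rcases le_or_gt (ssW d p α κ μ c φ x) 0 with hw | hw
  · refine le_max_of_le_left ?_
    have h3 : MonotoneOn (fun y => -ssV α c φ y) (Icc x₁ x) :=
      monotoneOn_Icc_of_hasDerivAt (e' := fun y => -(ssW d p α κ μ c φ y / y))
        (fun y hy => (hφ.hasDerivAt_ssV hP (hin y ⟨hy.1, hy.2.trans hx.2⟩)).neg) fun y hy => by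
          have hy' : y ∈ Icc x₁ x₂ := ⟨hy.1, hy.2.trans hx.2⟩
          have h5 : ssW d p α κ μ c φ y ≤ 0 := by
            by_contra h
            push Not at h
            exact absurd ((ssW_pos_iff_ssP (hin x hx)).2
              (((ssW_pos_iff_ssP (hin y hy')).1 h).trans_le (hP_mono hy' hx hy.2))) (not_lt.2 hw)
          rw [neg_nonneg]
          exact div_nonpos_of_nonpos_of_nonneg h5 (hin y hy').1.le
    exact neg_le_neg_iff.1 (h3 ⟨le_rfl, hx.1⟩ ⟨hx.1, le_rfl⟩ hx.1)
  · refine le_max_of_le_right ?_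
    have h3 : MonotoneOn (ssV α c φ) (Icc x x₂) :=
      monotoneOn_Icc_of_hasDerivAt
        (fun y hy => hφ.hasDerivAt_ssV hP (hin y ⟨hx.1.trans hy.1, hy.2⟩))
        fun y hy => by
          have hy' : y ∈ Icc x₁ x₂ := ⟨hx.1.trans hy.1, hy.2⟩
          exact div_nonneg ((ssW_pos_iff_ssP (hin y hy')).2
            (((ssW_pos_iff_ssP (hin x hx)).1 hw).trans_le
              (hP_mono hx hy' hy.1))).le (hin y hy').1.le
    exact h3 ⟨le_rfl, hx.2⟩ ⟨hx.2, le_rfl⟩ hx.2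

/-- The logarithmic time spent away from the rest point, below it, is bounded. -/
theorem mul_log_sub_log_le (hP : ProfileParams d p α κ) (hμ : α * (α + 1) ≤ μ)
    (hφ : IsNormalizedProfile d p α κ μ φ) (hc : 0 < c) (hcμ : c ^ (p - 1) = μ)
    (hb : 0 < b) (hbβ : b ^ (p - 1) = α * (d - 1 - α)) {x₁ x₂ m C : ℝ}
    (h0 : 0 < x₁) (h12 : x₁ ≤ x₂) (h2 : x₂ ≤ 1 / 2) (hC0 : 0 ≤ C)
    (hC : 4 * -pot p (α * (d - 1 - α)) b ≤ C ^ 2)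
    (hlt : ∀ x ∈ Icc x₁ x₂, ssV α c φ x < b)
    (hm : ∀ x ∈ Icc x₁ x₂, m ≤ -potNl p (α * (d - 1 - α)) (ssV α c φ x)) :
    m * (Real.log x₂ - Real.log x₁) ≤ 3 * C + b := by
  have hin : ∀ x ∈ Icc x₁ x₂, x ∈ Ioo (0 : ℝ) 1 := fun x hx =>
    ⟨h0.trans_le hx.1, by linarith [hx.2]⟩
  have hW : ∀ x ∈ Icc x₁ x₂, |ssW d p α κ μ c φ x| ≤ C := fun x hx =>
    abs_le_of_sq_le_sq ((hφ.sq_ssW_le hP hμ hc hcμ hb hbβ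
      ⟨(hin x hx).1, hx.2.trans h2⟩).trans hC) hC0
  have hγ := hP.gamma_pos
  have hγ1 := hP.gamma_lt_one
  set γ := (d : ℝ) - 1 - 2 * α with hγd
  have hmono := monotoneOn_Icc_of_hasDerivAt (a := x₁) (b := x₂)
    (e := fun x => (1 - x ^ 2) * ssW d p α κ μ c φ x + γ * ssV α c φ x - m * Real.log x + C * x)
    (fun x hx => ((((((hasDerivAt_id x).pow 2).const_sub 1).mul
      (hφ.hasDerivAt_ssW hP hμ hc hcμ (hin x hx))).add
      ((hφ.hasDerivAt_ssV (c := c) hP (hin x hx)).const_mul γ)).sub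
      ((Real.hasDerivAt_log (hin x hx).1.ne').const_mul m)).add ((hasDerivAt_id x).const_mul C))
    (fun x hx => by
      have hx0 := (hin x hx).1
      have hx2 : (0 : ℝ) < 1 - x ^ 2 := by nlinarith [hx0, (hin x hx).2]
      have hw := hW x hx
      have hmx := hm x hx
      simp only [id, Pi.pow_apply]
      rw [← hγd]
      set w := ssW d p α κ μ c φ x with hwd
      set f := potNl p (α * (d - 1 - α)) (ssV α c φ x) with hfd
      have key : -(((2 : ℕ) : ℝ) * x ^ (2 - 1) * 1) * w + (1 - x ^ 2) *
          (-((γ - x ^ 2) * w + f) / (x * (1 - x ^ 2))) + γ * (w / x) - m * x⁻¹ + C * 1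
          = (-f - m + x * (C - x * w)) / x := by
        have := hx2.ne'
        field_simp
        push_cast
        ring
      refine le_of_le_of_eq ?_ key.symm
      have hw' := abs_le.1 hw
      have : x * w ≤ C := by nlinarith [(hin x hx).2]
      exact div_nonneg (by nlinarith [mul_nonneg hx0.le (sub_nonneg.2 this)]) hx0.le)
  have h3 := hmono ⟨le_rfl, h12⟩ ⟨h12, le_rfl⟩ h12
  simp only at h3
  have m1 : x₁ ∈ Icc x₁ x₂ := ⟨le_rfl, h12⟩
  have m2 : x₂ ∈ Icc x₁ x₂ := ⟨h12, le_rfl⟩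
  have hbd : ∀ x ∈ Icc x₁ x₂, |(1 - x ^ 2) * ssW d p α κ μ c φ x| ≤ C := fun x hx => by
    have hx2 : (0 : ℝ) < 1 - x ^ 2 := by nlinarith [(hin x hx).1, (hin x hx).2]
    rw [abs_mul, abs_of_pos hx2]
    calc _ ≤ 1 * C := mul_le_mul (by nlinarith [(hin x hx).1]) (hW x hx) (abs_nonneg _) zero_le_one
      _ = C := one_mul C
  have e1 := abs_le.1 (hbd x₁ m1)
  have e2 := abs_le.1 (hbd x₂ m2)
  have e3 := hφ.ssV_pos hP hμ hc (Ioo_subset_Ioc_self (hin x₁ m1))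
  have e4 := hlt x₂ m2
  have e5 : γ * ssV α c φ x₂ ≤ b := by
    have := hφ.ssV_pos hP hμ hc (Ioo_subset_Ioc_self (hin x₂ m2))
    nlinarith
  have e6 : 0 ≤ γ * ssV α c φ x₁ := by positivity
  have e7 : C * (x₂ - x₁) ≤ C * 1 := mul_le_mul_of_nonneg_left (by linarith) hC0
  linarith

end IsNormalizedProfile

theorem exists_crossing_window {d : ℕ} {p α κ b v₀ : ℝ} (hP : ProfileParams d p α κ)
    (hb : 0 < b) (hbβ : b ^ (p - 1) = α * (d - 1 - α)) (hv₀ : 0 < v₀) :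
    ∃ T > 0, ∀ μ c φ, α * (α + 1) ≤ μ → IsNormalizedProfile d p α κ μ φ → 0 < c →
      c ^ (p - 1) = μ → ∀ x₁ x₂, 0 < x₁ → x₁ ≤ x₂ → x₂ ≤ 1 / 2 → T ≤ Real.log x₂ - Real.log x₁ →
        (∀ x ∈ Icc x₁ x₂, v₀ ≤ ssV α c φ x) → ∃ x ∈ Icc x₁ x₂, ssV α c φ x = b := by
  obtain ⟨δ, hδ, hsup⟩ := exists_sq_le_potNl_mul hP.one_lt hb hbβ hP.one_lt_slope
  have hpi := Real.pi_pos
  obtain ⟨m, hm0, hm⟩ : ∃ m > 0, ∀ v ∈ Icc v₀ (b - δ), m ≤ -potNl p (α * (d - 1 - α)) v := by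
    rcases (Icc v₀ (b - δ)).eq_empty_or_nonempty with h | h
    · exact ⟨1, one_pos, by simp [h]⟩
    · obtain ⟨z, hz, hmin⟩ := isCompact_Icc.exists_isMinOn h
        (continuous_potNl (β := α * (d - 1 - α)) hP.one_lt).neg.continuousOn
      exact ⟨_, neg_pos.2 (potNl_neg hbβ hP.one_lt (hv₀.trans_le hz.1) (by linarith [hz.2])),
        fun v hv => hmin hv⟩
  set C := √(4 * -pot p (α * (d - 1 - α)) b) with hC
  have hC0 : 0 ≤ C := Real.sqrt_nonneg _
  have hCsq : 4 * -pot p (α * (d - 1 - α)) b ≤ C ^ 2 :=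
    (Real.sq_sqrt (by linarith [pot_min_neg hb hbβ hP.one_lt])).ge
  have hK0 : 0 < (3 * C + b + 1) / m := by positivity
  refine ⟨4 * Real.pi + (3 * C + b + 1) / m, by positivity,
    fun μ c φ hμ hφ hc hcμ x₁ x₂ h0 h12 h2 hT hv => ?_⟩
  by_contra! hne
  have hcont : ContinuousOn (ssV α c φ) (Icc x₁ x₂) :=
    (hφ.continuousOn_ssV hP).mono (Icc_subset_Icc h0.le (by linarith))
  -- on every window of logarithmic length `2π` the trajectory is far below the rest point
  have hfar : ∀ y₁ y₂, x₁ ≤ y₁ → y₁ ≤ y₂ → y₂ ≤ x₂ →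
      2 * Real.pi ≤ Real.log y₂ - Real.log y₁ → ∃ t ∈ Icc y₁ y₂, ssV α c φ t < b - δ := by
    intro y₁ y₂ h3 h4 h5 h6
    by_contra! hnear
    have hsub : ∀ x ∈ Icc y₁ y₂, x ∈ Icc x₁ x₂ := fun x hx => ⟨h3.trans hx.1, hx.2.trans h5⟩
    have := hφ.log_sub_log_lt hP hμ hc hcμ (b := b) (h0.trans_le h3) h4 (h5.trans h2)
      (fun x hx => hne x (hsub x hx)) fun x hx => hsup _ (hnear x hx)
    linarith
  have hx₂ : 0 < x₂ := h0.trans_le h12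
  have hl1 : Real.log (x₁ * Real.exp (2 * Real.pi)) = Real.log x₁ + 2 * Real.pi := by
    rw [Real.log_mul h0.ne' (Real.exp_pos _).ne', Real.log_exp]
  have hl2 : Real.log (x₂ * Real.exp (-(2 * Real.pi))) = Real.log x₂ - 2 * Real.pi := by
    rw [Real.log_mul hx₂.ne' (Real.exp_pos _).ne', Real.log_exp]; ring
  have hp1 : 0 < x₁ * Real.exp (2 * Real.pi) := by positivity
  have hp2 : 0 < x₂ * Real.exp (-(2 * Real.pi)) := by positivity
  have hle1 : x₁ * Real.exp (2 * Real.pi) ≤ x₂ := by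
    rw [← Real.log_le_log_iff hp1 hx₂, hl1]; linarith
  have hle2 : x₁ ≤ x₂ * Real.exp (-(2 * Real.pi)) := by
    rw [← Real.log_le_log_iff h0 hp2, hl2]; linarith
  obtain ⟨t₁, ht₁, hV₁⟩ := hfar x₁ (x₁ * Real.exp (2 * Real.pi)) le_rfl
    (by rw [← Real.log_le_log_iff h0 hp1, hl1]; linarith) hle1 (by rw [hl1]; linarith)
  obtain ⟨t₂, ht₂, hV₂⟩ := hfar (x₂ * Real.exp (-(2 * Real.pi))) x₂ hle2
    (by rw [← Real.log_le_log_iff hp2 hx₂, hl2]; linarith) le_rfl (by rw [hl2]; linarith)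
  have ht1pos : 0 < t₁ := h0.trans_le ht₁.1
  have hlt₁ := Real.log_le_log ht1pos ht₁.2
  have hlt₂ := Real.log_le_log hp2 ht₂.1
  rw [hl1] at hlt₁
  rw [hl2] at hlt₂
  have ht12 : t₁ ≤ t₂ := by
    rw [← Real.log_le_log_iff ht1pos (hp2.trans_le ht₂.1)]
    linarith
  have hsub : ∀ x ∈ Icc t₁ t₂, x ∈ Icc x₁ x₂ := fun x hx => ⟨ht₁.1.trans hx.1, hx.2.trans ht₂.2⟩
  have hlt : ∀ x ∈ Icc t₁ t₂, ssV α c φ x < b := fun x hx => by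
    by_contra! h
    have hsub2 : Icc t₁ x ⊆ Icc x₁ x₂ := fun y hy => hsub y ⟨hy.1, hy.2.trans hx.2⟩
    obtain ⟨z, hz, hz2⟩ := intermediate_value_Icc hx.1 (hcont.mono hsub2)
      ⟨(by linarith : ssV α c φ t₁ ≤ b), h⟩
    exact hne z (hsub2 hz) hz2
  have hfin := hφ.mul_log_sub_log_le hP hμ hc hcμ hb hbβ (m := m) ht1pos ht12
    (ht₂.2.trans h2) hC0 hCsq hlt fun x hx => hm _ ⟨hv x (hsub x hx),
      (hφ.ssV_le_max hP hμ hc hcμ hbβ ht1pos (by linarith [ht₂.2]) hlt hx).trans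
        (max_le hV₁.le hV₂.le)⟩
  have : (3 * C + b + 1) / m * m ≤ (Real.log t₂ - Real.log t₁) * m :=
    mul_le_mul_of_nonneg_right (by linarith) hm0.le
  rw [div_mul_cancel₀ _ hm0.ne'] at this
  linarith

theorem add_pi_le_of_cos_eq_zero {s t : ℝ} (hs : Real.cos s = 0) (ht : Real.cos t = 0)
    (hst : s < t) : s + Real.pi ≤ t := by
  obtain ⟨j, rfl⟩ := Real.cos_eq_zero_iff.1 hs
  obtain ⟨k, rfl⟩ := Real.cos_eq_zero_iff.1 ht
  have hpi := Real.pi_pos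
  have h1 : (j : ℝ) < k := by
    by_contra! h
    nlinarith
  have h2 : (j : ℝ) + 1 ≤ k := by exact_mod_cast h1
  nlinarith

section Shooting

variable {d : ℕ} {p α κ b : ℝ} {c : ℝ → ℝ} {Φ θ : ℝ → ℝ → ℝ}

theorem exists_le_angle (hP : ProfileParams d p α κ)
    (hΦ : ∀ μ ∈ Ici (α * (α + 1)), IsNormalizedProfile d p α κ μ (Φ μ))
    (hc : ∀ μ ∈ Ici (α * (α + 1)), 0 < c μ) (hcμ : ∀ μ ∈ Ici (α * (α + 1)), c μ ^ (p - 1) = μ)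
    (hb : 0 < b) (hbβ : b ^ (p - 1) = α * (d - 1 - α))
    (hθ0 : ∀ μ ∈ Ici (α * (α + 1)), θ μ 0 = Real.pi)
    (hmono : ∀ μ ∈ Ici (α * (α + 1)), StrictMonoOn (θ μ) (Icc 0 1))
    (hcos : ∀ μ ∈ Ici (α * (α + 1)), ∀ x ∈ Icc (0 : ℝ) 1,
      ssV α (c μ) (Φ μ) x = b ↔ Real.cos (θ μ x) = 0) (K : ℕ) :
    ∃ μ ∈ Ici (α * (α + 1)), (K + 1) * Real.pi ≤ θ μ 1 := by
  obtain ⟨η, hη, v₀, hv₀, hlow⟩ := exists_ssV_lower_bound hP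
  obtain ⟨T, hT, hwin⟩ := exists_crossing_window hP hb hbβ hv₀
  have hα := hP.alpha_pos
  set R := 2 * η * Real.exp (T * (2 * K + 1)) with hR
  have hR0 : 0 < R := by positivity
  set μ := max (α * (α + 1)) (R ^ 2) with hμd
  have hμ : μ ∈ Ici (α * (α + 1)) := mem_Ici.2 (le_max_left _ _)
  have hRμ : R ≤ √μ := Real.le_sqrt_of_sq_le (le_max_right _ _)
  have hμs : 0 < √μ := hR0.trans_le hRμ
  set y := η / √μ with hy
  have hy0 : 0 < y := by positivity
  have hyR : y * Real.exp (T * (2 * K + 1)) ≤ 1 / 2 := by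
    rw [hy, div_mul_eq_mul_div, div_le_iff₀ hμs]
    linarith
  have hpi := Real.pi_pos
  have key : ∀ k : ℕ, k ≤ K → ∃ z, y ≤ z ∧ z ≤ y * Real.exp (T * (2 * k + 1)) ∧
      ssV α (c μ) (Φ μ) z = b ∧ (k + 1) * Real.pi ≤ θ μ z := by
    have hbound : ∀ k : ℕ, k ≤ K → y * Real.exp (T * (2 * k + 1)) ≤ 1 / 2 := fun k hk => by
      refine le_trans ?_ hyR
      have : (k : ℝ) ≤ K := by exact_mod_cast hk
      gcongr
    have hzero : ∀ k : ℕ, k ≤ K → ∃ z ∈ Icc (y * Real.exp (T * (2 * k)))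
        (y * Real.exp (T * (2 * k + 1))), ssV α (c μ) (Φ μ) z = b := fun k hk => by
      have h1 : y ≤ y * Real.exp (T * (2 * k)) :=
        le_mul_of_one_le_right hy0.le (Real.one_le_exp (by positivity))
      refine hwin μ (c μ) (Φ μ) hμ (hΦ μ hμ) (hc μ hμ) (hcμ μ hμ) _ _ (by positivity)
        (by gcongr; linarith) (hbound k hk) ?_ fun x hx => hlow μ (c μ) (Φ μ) hμ (hΦ μ hμ)
          (hc μ hμ) (hcμ μ hμ) x ⟨h1.trans hx.1, by linarith [hbound k hk, hx.2]⟩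
      rw [Real.log_mul hy0.ne' (Real.exp_pos _).ne', Real.log_mul hy0.ne' (Real.exp_pos _).ne',
        Real.log_exp, Real.log_exp]
      linarith
    intro k
    induction k with
    | zero =>
      intro hk
      obtain ⟨z, hz, hz2⟩ := hzero 0 hk
      have hz1 : y ≤ z := by simpa using hz.1
      refine ⟨z, hz1, hz.2, hz2, ?_⟩
      have h1 : z ≤ 1 := hz.2.trans ((hbound 0 hk).trans (by norm_num))
      have := (hmono μ hμ).monotoneOn ⟨le_rfl, zero_le_one⟩ ⟨hy0.le.trans hz1, h1⟩
        (hy0.le.trans hz1)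
      rw [hθ0 μ hμ] at this
      simpa using this
    | succ k ih =>
      intro hk
      obtain ⟨z, hz1, hz2, hz3, hz4⟩ := ih (by omega)
      obtain ⟨z', hz', hz'2⟩ := hzero (k + 1) hk
      have hzz : z < z' := by
        refine hz2.trans_lt (lt_of_lt_of_le ?_ hz'.1)
        have : T * (2 * k + 1) < T * (2 * ((k + 1 : ℕ) : ℝ)) := by push_cast; nlinarith
        exact mul_lt_mul_of_pos_left (Real.exp_lt_exp.2 this) hy0
      have h1 : z' ≤ 1 := by linarith [hbound (k + 1) hk, hz'.2]
      have hzm : z ∈ Icc (0 : ℝ) 1 := ⟨hy0.le.trans hz1, hzz.le.trans h1⟩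
      have hzm' : z' ∈ Icc (0 : ℝ) 1 := ⟨hzm.1.trans hzz.le, h1⟩
      refine ⟨z', hz1.trans hzz.le, hz'.2, hz'2, ?_⟩
      have := add_pi_le_of_cos_eq_zero ((hcos μ hμ z hzm).1 hz3) ((hcos μ hμ z' hzm').1 hz'2)
        (hmono μ hμ hzm hzm' hzz)
      push_cast
      linarith
  obtain ⟨z, hz1, hz2, -, hz4⟩ := key K le_rfl
  refine ⟨μ, hμ, hz4.trans ((hmono μ hμ).monotoneOn ⟨hy0.le.trans hz1, ?_⟩
    ⟨zero_le_one, le_rfl⟩ ?_)⟩ <;> linarith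

theorem angle_le_two_pi (hP : ProfileParams d p α κ)
    (hΦ : IsNormalizedProfile d p α κ (α * (α + 1)) (Φ (α * (α + 1))))
    (hc : 0 < c (α * (α + 1))) (hθc : ContinuousOn (θ (α * (α + 1))) (Icc 0 1))
    (hθ0 : θ (α * (α + 1)) 0 = Real.pi)
    (hsin : ∀ x ∈ Icc (0 : ℝ) 1, ssP d p α κ (α * (α + 1)) (c (α * (α + 1))) (Φ (α * (α + 1))) x = 0
      ↔ Real.sin (θ (α * (α + 1)) x) = 0) :
    θ (α * (α + 1)) 1 ≤ 2 * Real.pi := by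
  by_contra! h
  have hpi := Real.pi_pos
  obtain ⟨x, hx, hx2⟩ := intermediate_value_Ioo zero_le_one hθc
    (⟨by rw [hθ0]; linarith, h⟩ : 2 * Real.pi ∈ Ioo _ _)
  have h1 := (hsin x (Ioo_subset_Icc_self hx)).2 (by rw [hx2]; exact Real.sin_two_pi)
  have h2 : fluxOp d κ (fun y => clampNl p α (α * (α + 1)) (Φ (α * (α + 1)) y)) x = 0 := by
    unfold fluxOp
    rw [intervalIntegral.integral_congr (g := fun _ => 0)]
    · simp
    · intro y hy
      rw [uIcc_of_le hx.1.le] at hy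
      simp only
      rw [hΦ.eq_one hP ⟨hy.1, hy.2.trans hx.2.le⟩, clampNl_of_mem zero_le_one le_rfl]
      simp
  rw [ssP, h2, hΦ.eq_one hP (Ioo_subset_Icc_self hx)] at h1
  have hx2 : (0 : ℝ) < 1 - x ^ 2 := by nlinarith [hx.1, hx.2]
  have h3 := Real.rpow_pos_of_pos hx.1 (d - 1 - α)
  have h4 := Real.rpow_pos_of_pos hx2 κ
  have h5 := hP.alpha_pos
  have : 0 < c (α * (α + 1)) *
      (α * (x ^ ((d : ℝ) - 1 - α) * (1 - x ^ 2) ^ κ * 1) + x ^ (-α) * 0) := by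
    rw [mul_zero, add_zero, mul_one]; positivity
  exact this.ne' h1

/-- Parameters for which the profile extends smoothly through the light cone. -/
theorem exists_regular_profiles (hP : ProfileParams d p α κ)
    (hb : 0 < b) (hbβ : b ^ (p - 1) = α * (d - 1 - α)) :
    ∃ (μ : ℕ → ℝ) (φ : ℕ → ℝ → ℝ), Tendsto μ atTop atTop ∧ ∀ n : ℕ, α * (α + 1) ≤ μ n ∧
      IsNormalizedProfile d p α κ (μ n) (φ n) ∧
      fluxOp d κ (fun y => clampNl p α (μ n) (φ n y)) 1 = 0 ∧
      {x ∈ Ioo (0 : ℝ) 1 | ssV α (μ n ^ (1 / (p - 1))) (φ n) x = b}.encard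
        = ((n + 1 : ℕ) : ℕ∞) := by
  have hα := hP.alpha_pos
  have hp := hP.one_lt
  have hl0 : 0 < α * (α + 1) := by positivity
  have hpos : ∀ μ ∈ Ici (α * (α + 1)), 0 < μ := fun μ hμ => hl0.trans_le hμ
  choose Φ hΦ using fun μ : Ici (α * (α + 1)) =>
    hP.exists_normalizedProfile (μ := μ) (hpos μ μ.2).le
  set Ψ : ℝ → ℝ → ℝ := fun μ => Φ ⟨max (α * (α + 1)) μ, mem_Ici.2 (le_max_left _ _)⟩ with hΨd
  have hΨ : ∀ μ ∈ Ici (α * (α + 1)), IsNormalizedProfile d p α κ μ (Ψ μ) := fun μ hμ => by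
    have h := hΦ ⟨max (α * (α + 1)) μ, mem_Ici.2 (le_max_left _ _)⟩
    have e : max (α * (α + 1)) μ = μ := max_eq_right hμ
    simp only [hΨd]
    convert h using 1
    exact e.symm
  set c : ℝ → ℝ := fun μ => μ ^ (1 / (p - 1)) with hcd
  have hcc : ContinuousOn c (Ici (α * (α + 1))) :=
    continuousOn_id.rpow_const fun μ hμ => Or.inl (hpos μ hμ).ne'
  have hc : ∀ μ ∈ Ici (α * (α + 1)), 0 < c μ := fun μ hμ => Real.rpow_pos_of_pos (hpos μ hμ) _
  have hcμ : ∀ μ ∈ Ici (α * (α + 1)), c μ ^ (p - 1) = μ := fun μ hμ => by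
    rw [hcd, ← Real.rpow_mul (hpos μ hμ).le, one_div_mul_cancel (by linarith), Real.rpow_one]
  obtain ⟨θ, hθc, hθ⟩ := exists_angle hP hΨ hcc hc hcμ hb hbβ
  have hcos : ∀ μ ∈ Ici (α * (α + 1)), ∀ x ∈ Icc (0 : ℝ) 1,
      ssV α (c μ) (Ψ μ) x = b ↔ Real.cos (θ μ x) = 0 := fun μ hμ x hx => by
    obtain ⟨r, hr, h1, -⟩ := (hθ μ hμ).2.2 x hx
    rw [← sub_eq_zero, h1, mul_eq_zero, or_iff_right hr.ne']
  have hsin : ∀ μ ∈ Ici (α * (α + 1)), ∀ x ∈ Icc (0 : ℝ) 1,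
      ssP d p α κ μ (c μ) (Ψ μ) x = 0 ↔ Real.sin (θ μ x) = 0 := fun μ hμ x hx => by
    obtain ⟨r, hr, -, h1⟩ := (hθ μ hμ).2.2 x hx
    rw [← neg_eq_zero, h1, mul_eq_zero, or_iff_right hr.ne']
  have hθμ : ∀ μ ∈ Ici (α * (α + 1)), ContinuousOn (θ μ) (Icc 0 1) := fun μ hμ =>
    hθc.comp (f := fun x => (μ, x)) (by fun_prop) fun x hx => ⟨hμ, hx⟩
  have hend : ContinuousOn (fun μ => θ μ 1) (Ici (α * (α + 1))) :=
    hθc.comp (f := fun μ => (μ, (1 : ℝ))) (by fun_prop) fun μ hμ => ⟨hμ, by simp⟩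
  have hmem : α * (α + 1) ∈ Ici (α * (α + 1)) := mem_Ici.2 le_rfl
  have hpi := Real.pi_pos
  have hex : ∀ n : ℕ, ∃ μ ∈ Ici (α * (α + 1)), θ μ 1 = (n + 2) * Real.pi := fun n => by
    obtain ⟨M, hM, hM2⟩ := exists_le_angle hP hΨ hc hcμ hb hbβ (fun μ hμ => (hθ μ hμ).1)
      (fun μ hμ => (hθ μ hμ).2.1) hcos (n + 1)
    have h0 := angle_le_two_pi (c := c) (θ := θ) hP (hΨ _ hmem) (hc _ hmem) (hθμ _ hmem)
      (hθ _ hmem).1 (hsin _ hmem)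
    obtain ⟨μ, hμ, hμ2⟩ := intermediate_value_Icc hM (hend.mono Icc_subset_Ici_self)
      (⟨by nlinarith [(n.cast_nonneg : (0 : ℝ) ≤ n)], by push_cast at hM2; linarith⟩ :
        ((n : ℝ) + 2) * Real.pi ∈ Icc _ _)
    exact ⟨μ, hμ.1, hμ2⟩
  choose μ hμ hμ2 using hex
  refine ⟨μ, fun n => Ψ (μ n), ?_, fun n => ⟨hμ n, hΨ _ (hμ n), ?_, ?_⟩⟩
  · refine tendsto_atTop.2 fun M => ?_
    obtain ⟨B, hB⟩ := isCompact_Icc.exists_bound_of_continuousOn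
      (hend.mono (Icc_subset_Ici_self : Icc _ M ⊆ _))
    obtain ⟨n₀, hn₀⟩ := exists_nat_gt (B / Real.pi)
    filter_upwards [eventually_ge_atTop n₀] with n hn
    by_contra! h
    have h1 := (le_abs_self _).trans (hB (μ n) ⟨hμ n, h.le⟩)
    rw [hμ2, div_lt_iff₀ hpi] at *
    have h2 : (n₀ : ℝ) ≤ n := by exact_mod_cast hn
    nlinarith
  · have h1 := (hsin (μ n) (hμ n) 1 (by simp)).2 (by
      rw [hμ2]; exact_mod_cast Real.sin_nat_mul_pi (n + 2))
    have hc0 := hc _ (hμ n)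
    rw [ssP] at h1
    simpa [Real.zero_rpow hP.kappa_pos.ne', hc0.ne'] using h1
  · rw [← encard_cos_eq_zero (hθ _ (hμ n)).2.1 (hθμ _ (hμ n)) (hθ _ (hμ n)).1 (hμ2 n)]
    congr 1
    ext x
    simp only [mem_ofPred_eq]
    exact and_congr_right fun hx => hcos _ (hμ n) x (Ioo_subset_Icc_self hx)

end Shooting

/-- The nonlinearity of the profile equation on positive functions. -/
noncomputable def profileNl (p α u : ℝ) : ℝ := α * (α + 1) * u - u ^ p

/-- `V` is the derivative of `U` at `x`, and `U` satisfies the profile equation there. -/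
def IsProfileJet (d : ℕ) (p α : ℝ) (U V : ℝ → ℝ) (x : ℝ) : Prop :=
  HasDerivAt U (V x) x ∧ ∃ v, HasDerivAt V v x ∧
    (1 - x ^ 2) * v + (d / x - 2 * (α + 1) * x) * V x = profileNl p α (U x)

theorem exists_analytic_profileNl_ode {p α κ u₀ w₀ k : ℝ} {m C₁ C₂ : ℂ → ℂ} {mr R₁ R₂ : ℝ → ℝ}
    (hκ : 0 < κ) (hu : 0 < u₀) (hm : Differentiable ℂ m) (hmr : ∀ x : ℝ, m x = mr x)
    (hC₁ : AnalyticAt ℂ C₁ 0) (hC₂ : AnalyticAt ℂ C₂ 0) (hR₁ : ∀ t : ℝ, C₁ t = R₁ t)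
    (hR₂ : ∀ t : ℝ, C₂ t = R₂ t) :
    ∃ r > 0, ∃ y U : ℝ → ℝ, AnalyticOnNhd ℝ U (Ioo (-r) r) ∧ U 0 = u₀ ∧
      ∀ t ∈ Ioo (-r) r, HasDerivAt U (w₀ + mr t * y t) t ∧ DifferentiableAt ℝ y t ∧
        t * deriv y t + κ * y t = R₁ t * profileNl p α (U t) + R₂ t * (k + t * y t) := by
  have hfst : AnalyticAt ℂ (fun q : ℂ × ℂ × ℂ => q.1) (0, (u₀ : ℂ), 0) := analyticAt_fst
  have hsnd : AnalyticAt ℂ (fun q : ℂ × ℂ × ℂ => q.2) (0, (u₀ : ℂ), 0) := analyticAt_snd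
  have hU : AnalyticAt ℂ (fun q : ℂ × ℂ × ℂ => q.2.1) (0, (u₀ : ℂ), 0) :=
    AnalyticAt.fun_comp (g := Prod.fst) analyticAt_fst hsnd
  have hz : AnalyticAt ℂ (fun q : ℂ × ℂ × ℂ => q.2.2) (0, (u₀ : ℂ), 0) :=
    AnalyticAt.fun_comp (g := Prod.snd) analyticAt_snd hsnd
  have hpow : AnalyticAt ℂ (fun q : ℂ × ℂ × ℂ => q.2.1 ^ (p : ℂ)) (0, (u₀ : ℂ), 0) :=
    hU.cpow analyticAt_const (Complex.ofReal_mem_slitPlane.2 hu)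
  refine exists_real_analytic_singular_ode
    (H := fun q => C₁ q.1 * ((α : ℂ) * (α + 1) * q.2.1 - q.2.1 ^ (p : ℂ)) + C₂ q.1 * (k + q.2.2))
    (h := fun t U z => R₁ t * profileNl p α U + R₂ t * (k + z)) hκ hm hmr ?_ ?_
  · exact ((hC₁.fun_comp (f := fun q : ℂ × ℂ × ℂ => q.1) hfst).mul
      ((analyticAt_const.mul hU).sub hpow)).add
      ((hC₂.fun_comp (f := fun q : ℂ × ℂ × ℂ => q.1) hfst).mul (analyticAt_const.add hz))
  · have hc : ContinuousAt (fun q : ℝ × ℝ × ℝ => q.2.1) (0, u₀, 0) := by fun_prop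
    filter_upwards [hc.eventually (lt_mem_nhds hu)] with q hq
    simp only [hR₁, hR₂, profileNl]
    rw [← Complex.ofReal_cpow hq.le]
    push_cast
    rfl

/-- Local analytic solutions of the profile equation at any point of `[0,1]`. -/
theorem exists_local_profile {d : ℕ} {p α κ u₀ w₀ x₀ : ℝ} (hP : ProfileParams d p α κ)
    (hu : 0 < u₀) (hx₀ : x₀ ∈ Icc (0 : ℝ) 1) :
    ∃ r > 0, ∃ U V : ℝ → ℝ, AnalyticOnNhd ℝ U (Ioo (x₀ - r) (x₀ + r)) ∧ U x₀ = u₀ ∧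
      (x₀ ∈ Ioo (0 : ℝ) 1 → V x₀ = w₀) ∧ ContinuousOn V (Ioo (x₀ - r) (x₀ + r)) ∧
      ∀ x ∈ Ioo (x₀ - r) (x₀ + r), 0 < x → IsProfileJet d p α U V x := by
  have key : ∀ {r y₀ : ℝ} {mr : ℝ → ℝ} {y U : ℝ → ℝ}, 0 < r → Differentiable ℝ mr →
      AnalyticOnNhd ℝ U (Ioo (-r) r) → U 0 = u₀ → (x₀ ∈ Ioo (0 : ℝ) 1 → y₀ + mr 0 * y 0 = w₀) →
      (∀ t ∈ Ioo (-r) r, HasDerivAt U (y₀ + mr t * y t) t ∧ DifferentiableAt ℝ y t ∧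
        (0 < x₀ + t → (1 - (x₀ + t) ^ 2) * (deriv mr t * y t + mr t * deriv y t) +
          (d / (x₀ + t) - 2 * (α + 1) * (x₀ + t)) * (y₀ + mr t * y t) = profileNl p α (U t))) →
      ∃ r > 0, ∃ U V : ℝ → ℝ, AnalyticOnNhd ℝ U (Ioo (x₀ - r) (x₀ + r)) ∧ U x₀ = u₀ ∧
      (x₀ ∈ Ioo (0 : ℝ) 1 → V x₀ = w₀) ∧ ContinuousOn V (Ioo (x₀ - r) (x₀ + r)) ∧
      ∀ x ∈ Ioo (x₀ - r) (x₀ + r), 0 < x → IsProfileJet d p α U V x := by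
    intro r y₀ mr y U hr hmr hU hU0 hw h
    have hmem : ∀ x ∈ Ioo (x₀ - r) (x₀ + r), x - x₀ ∈ Ioo (-r) r := fun x hx =>
      ⟨by linarith [hx.1], by linarith [hx.2]⟩
    have hV : ∀ x ∈ Ioo (x₀ - r) (x₀ + r), HasDerivAt (fun x => y₀ + mr (x - x₀) * y (x - x₀))
        (deriv mr (x - x₀) * y (x - x₀) + mr (x - x₀) * deriv y (x - x₀)) x := fun x hx => by
      have h1 := ((hmr (x - x₀)).hasDerivAt.mul (h _ (hmem x hx)).2.1.hasDerivAt).const_add y₀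
      exact h1.comp_sub_const x x₀
    refine ⟨r, hr, fun x => U (x - x₀), fun x => y₀ + mr (x - x₀) * y (x - x₀), ?_,
      by simpa using hU0,
      fun hx => by simpa using hw hx, fun x hx => (hV x hx).continuousAt.continuousWithinAt,
      fun x hx hx0 => ⟨(h _ (hmem x hx)).1.comp_sub_const x x₀, _, hV x hx, ?_⟩⟩
    · intro x hx
      exact (hU _ (hmem x hx)).fun_comp (f := fun x => x - x₀) (analyticAt_id.sub analyticAt_const)
    · have := (h _ (hmem x hx)).2.2 (by linarith)
      simpa using this
  have hd := hP.two_le_real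
  rcases hx₀.1.eq_or_lt with h0 | h0
  · subst h0
    obtain ⟨r, hr, y, U, hU, hU0, h⟩ := exists_analytic_profileNl_ode (p := p) (α := α)
      (κ := d) (u₀ := u₀) (w₀ := 0) (k := 0) (m := fun _ => 1) (mr := fun _ => 1)
      (C₁ := fun t => t / (1 - t ^ 2)) (C₂ := fun t => (2 * (α + 1) - d) * t / (1 - t ^ 2))
      (R₁ := fun t => t / (1 - t ^ 2)) (R₂ := fun t => (2 * (α + 1) - d) * t / (1 - t ^ 2))
      (by linarith) hu (by fun_prop) (by simp) (by fun_prop (disch := simp))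
      (by fun_prop (disch := simp)) (by simp) (by simp)
    refine key (y₀ := 0) (mr := fun _ => 1) (y := y) (r := min r 1)
      (lt_min hr one_pos) (by fun_prop)
      (hU.mono (Ioo_subset_Ioo (neg_le_neg (min_le_left _ _)) (min_le_left _ _))) hU0
      (fun h => absurd h.1 (lt_irrefl _)) fun t ht => ?_
    obtain ⟨h1, h2, h3⟩ := h t ⟨by linarith [ht.1, min_le_left r 1],
      ht.2.trans_le (min_le_left _ _)⟩
    refine ⟨h1, h2, fun ht0 => ?_⟩
    have ht1 : t < 1 := ht.2.trans_le (min_le_right _ _)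
    rw [zero_add] at ht0
    have h4 : 1 - t ^ 2 ≠ 0 := by nlinarith
    simp only [deriv_const, zero_add, zero_mul, one_mul]
    have h5 : profileNl p α (U t) =
      ((1 - t ^ 2) * (t / (1 - t ^ 2) * profileNl p α (U t))) / t := by field_simp
    have h6 : t / (1 - t ^ 2) * profileNl p α (U t) = t * deriv y t + d * y t -
      (2 * (α + 1) - d) * t / (1 - t ^ 2) * (0 + t * y t) := by linarith
    rw [h5, h6]
    field_simp
    ring
  rcases hx₀.2.eq_or_lt with h1 | h1
  · subst h1
    obtain ⟨r, hr, y, U, hU, hU0, h⟩ := exists_analytic_profileNl_ode (p := p) (α := α)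
      (κ := κ) (u₀ := u₀) (w₀ := 0) (k := 0) (m := fun _ => 1) (mr := fun _ => 1)
      (C₁ := fun t => -1 / (2 + t)) (C₂ := fun t => (κ - 2 * (α + 1) - d / (1 + t)) / (2 + t))
      (R₁ := fun t => -1 / (2 + t)) (R₂ := fun t => (κ - 2 * (α + 1) - d / (1 + t)) / (2 + t))
      hP.kappa_pos hu (by fun_prop) (by simp) (by fun_prop (disch := simp))
      (by fun_prop (disch := simp)) (by simp) (by simp)
    refine key (y₀ := 0) (mr := fun _ => 1) (y := y) (r := r) hr (by fun_prop) hU hU0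
      (fun h => absurd h.2 (lt_irrefl _)) fun t ht => ?_
    obtain ⟨h1, h2, h3⟩ := h t ht
    refine ⟨h1, h2, fun ht0 => ?_⟩
    have h4 : 2 + t ≠ 0 := by linarith
    have h7 := ht0.ne'
    simp only [deriv_const, zero_add, zero_mul, one_mul]
    have h5 : profileNl p α (U t) = -(2 + t) * (-1 / (2 + t) * profileNl p α (U t)) := by
      field_simp
    have h6 : -1 / (2 + t) * profileNl p α (U t) = t * deriv y t + κ * y t -
      (κ - 2 * (α + 1) - d / (1 + t)) / (2 + t) * (0 + t * y t) := by linarith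
    have h8 := hP.two_alpha
    have h9 : (d : ℝ) = 2 * α + 2 - 2 * κ := by linarith
    rw [h5, h6, h9]
    field_simp
    ring
  · have hne : (1 - x₀ ^ 2) ≠ 0 := by nlinarith
    have hne' : (1 - (x₀ : ℂ) ^ 2) ≠ 0 := by exact_mod_cast hne
    have h0' : (x₀ : ℂ) ≠ 0 := by exact_mod_cast h0.ne'
    obtain ⟨r, hr, y, U, hU, hU0, h⟩ := exists_analytic_profileNl_ode (p := p) (α := α)
      (κ := 1) (u₀ := u₀) (w₀ := w₀) (k := w₀) (m := fun t => t) (mr := fun t => t)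
      (C₁ := fun t => 1 / (1 - (x₀ + t) ^ 2))
      (C₂ := fun t => -(d / (x₀ + t) - 2 * (α + 1) * (x₀ + t)) / (1 - (x₀ + t) ^ 2))
      (R₁ := fun t => 1 / (1 - (x₀ + t) ^ 2))
      (R₂ := fun t => -(d / (x₀ + t) - 2 * (α + 1) * (x₀ + t)) / (1 - (x₀ + t) ^ 2))
      one_pos hu (by fun_prop) (by simp) (by fun_prop (disch := simpa))
      (by fun_prop (disch := first | simpa | simp [h0.ne'])) (by simp) (by simp)
    refine key (y₀ := w₀) (mr := fun t => t) (y := y) (r := min r (1 - x₀))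
      (lt_min hr (by linarith)) (by fun_prop)
      (hU.mono (Ioo_subset_Ioo (neg_le_neg (min_le_left _ _)) (min_le_left _ _))) hU0
      (by simp) fun t ht => ?_
    obtain ⟨h1, h2, h3⟩ := h t ⟨by linarith [ht.1, min_le_left r (1 - x₀)],
      ht.2.trans_le (min_le_left _ _)⟩
    refine ⟨h1, h2, fun ht0 => ?_⟩
    have ht1 : t < 1 - x₀ := ht.2.trans_le (min_le_right _ _)
    have h4 : 1 - (x₀ + t) ^ 2 ≠ 0 := by nlinarith
    simp only [deriv_id'', one_mul]
    have h5 : profileNl p α (U t) =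
      (1 - (x₀ + t) ^ 2) * (1 / (1 - (x₀ + t) ^ 2) * profileNl p α (U t)) := by field_simp
    have h6 : 1 / (1 - (x₀ + t) ^ 2) * profileNl p α (U t) = t * deriv y t + 1 * y t -
      -(d / (x₀ + t) - 2 * (α + 1) * (x₀ + t)) / (1 - (x₀ + t) ^ 2) * (w₀ + t * y t) := by linarith
    rw [h5, h6]
    field_simp
    ring

theorem IsProfileJet.hasDerivAt_wA_mul {d : ℕ} {p α κ x : ℝ} {U V : ℝ → ℝ}
    (hP : ProfileParams d p α κ) (h : IsProfileJet d p α U V x) (hx : x ∈ Ioo (0 : ℝ) 1) :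
    HasDerivAt (fun y => wA d κ y * V y) (wB d κ x * profileNl p α (U x)) x := by
  obtain ⟨-, v, hv, he⟩ := h
  refine ((hasDerivAt_wA hx).mul hv).congr_deriv ?_
  have hx2 : 1 - x ^ 2 ≠ 0 := by nlinarith [hx.1, hx.2]
  have hx0 : x ≠ 0 := hx.1.ne'
  have h1 := hP.two_alpha
  have h2 : (d : ℝ) = 2 * α + 2 - 2 * κ := by linarith
  rw [← he, wA_eq hx, h2]
  field_simp
  ring

theorem continuous_wA {d : ℕ} {κ : ℝ} (hκ : 0 ≤ κ) : Continuous (wA d κ) := by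
  unfold wA
  exact (continuous_pow d).mul ((by fun_prop : Continuous fun x : ℝ => 1 - x ^ 2).rpow_const
    fun _ => Or.inr hκ)

/-- Near any point of `[0,1]`, on either side, the weights are controlled by powers of the
distance. -/
theorem exists_weight_bounds {d : ℕ} {κ σ x₀ : ℝ} (hd : 2 ≤ d) (hκ : 0 < κ) (hκ1 : κ < 1)
    (hσ : (σ = 1 ∧ x₀ ∈ Ico (0 : ℝ) 1) ∨ (σ = -1 ∧ x₀ ∈ Ioc (0 : ℝ) 1)) :
    ∃ r C s : ℝ, 0 < r ∧ 0 < C ∧ 0 < s ∧ ∀ t ∈ Ioo 0 r, x₀ + σ * t ∈ Ioo (0 : ℝ) 1 ∧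
      (wA d κ (x₀ + σ * t))⁻¹ ≤ C * t ^ (-s) ∧ wB d κ (x₀ + σ * t) ≤ C * t ^ (s - 1) := by
  have hreg : x₀ ∈ Ioo (0 : ℝ) 1 → |σ| = 1 → ∃ r C s : ℝ, 0 < r ∧ 0 < C ∧ 0 < s ∧
      ∀ t ∈ Ioo 0 r, x₀ + σ * t ∈ Ioo (0 : ℝ) 1 ∧
      (wA d κ (x₀ + σ * t))⁻¹ ≤ C * t ^ (-s) ∧ wB d κ (x₀ + σ * t) ≤ C * t ^ (s - 1) := by
    intro hx hs1
    have hline : ContinuousAt (fun t : ℝ => x₀ + σ * t) 0 := by fun_prop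
    have hline' : Tendsto (fun t : ℝ => x₀ + σ * t) (nhds 0) (nhds x₀) := by
      simpa using hline.tendsto
    have hA : ContinuousAt (fun x => (wA d κ x)⁻¹) x₀ :=
      ((continuous_wA hκ.le).continuousAt).inv₀ (wA_pos hx).ne'
    have hB : ContinuousAt (wB d κ) x₀ := continuousOn_wB.continuousAt (isOpen_Ioo.mem_nhds hx)
    obtain ⟨r, hr, h⟩ := Metric.eventually_nhds_iff_ball.1
      ((hline'.eventually (isOpen_Ioo.mem_nhds hx)).and
      (((hA.tendsto.comp hline').eventually (gt_mem_nhds (lt_add_one _))).and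
        ((hB.tendsto.comp hline').eventually (gt_mem_nhds (lt_add_one _)))))
    set C := max 1 (max ((wA d κ x₀)⁻¹ + 1) (wB d κ x₀ + 1)) with hC
    have hC1 : 1 ≤ C := le_max_left _ _
    refine ⟨min r 1, C, 1, lt_min hr one_pos, by linarith, one_pos, fun t ht => ?_⟩
    obtain ⟨h1, h2, h3⟩ := h t (by
      rw [mem_ball_zero_iff, Real.norm_eq_abs, abs_of_pos ht.1]
      exact ht.2.trans_le (min_le_left _ _))
    simp only [Function.comp_apply] at h2 h3
    refine ⟨h1, ?_, ?_⟩
    · have h4 : 1 ≤ t ^ (-1 : ℝ) := by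
        rw [Real.rpow_neg_one]
        exact (one_le_inv₀ ht.1).2 (ht.2.le.trans (min_le_right _ _))
      have h5 : (wA d κ x₀)⁻¹ + 1 ≤ C := (le_max_left _ _).trans (le_max_right _ _)
      nlinarith
    · have h5 : wB d κ x₀ + 1 ≤ C := (le_max_right _ _).trans (le_max_right _ _)
      simp only [sub_self, Real.rpow_zero]
      linarith
  rcases hσ with ⟨rfl, hx⟩ | ⟨rfl, hx⟩
  · rcases hx.1.eq_or_lt with h0 | h0
    · subst h0
      have hd' : (2 : ℝ) ≤ d := by exact_mod_cast hd
      refine ⟨1 / 2, 2, d, by norm_num, by norm_num, by linarith, fun t ht => ?_⟩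
      rw [zero_add, one_mul]
      have ht2 : 3 / 4 ≤ 1 - t ^ 2 := by nlinarith [ht.1, ht.2]
      have ht3 : 1 - t ^ 2 ≤ 1 := by nlinarith [ht.1, ht.2]
      have h1 : ∀ a : ℝ, -1 ≤ a → (1 - t ^ 2) ^ a ≤ 2 := fun a ha =>
        calc (1 - t ^ 2) ^ a ≤ (1 - t ^ 2) ^ (-1 : ℝ) :=
              Real.rpow_le_rpow_of_exponent_ge (by linarith) ht3 ha
          _ ≤ 2 := by
              rw [Real.rpow_neg_one]
              exact inv_le_of_inv_le₀ (by norm_num) (by linarith)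
      have h2 := h1 (-κ) (by linarith)
      have h3 := h1 (κ - 1) (by linarith)
      have htd := pow_pos ht.1 d
      refine ⟨⟨ht.1, by linarith [ht.2]⟩, ?_, ?_⟩
      · rw [wA, mul_inv, ← Real.rpow_neg (by linarith), Real.rpow_neg ht.1.le, Real.rpow_natCast,
          mul_comm]
        gcongr
      · rw [wB, mul_comm]
        have h4 : t ^ d ≤ t ^ ((d : ℝ) - 1) := by
          rw [← Real.rpow_natCast]
          exact Real.rpow_le_rpow_of_exponent_ge ht.1 (by linarith [ht.2]) (by linarith)
        gcongr
    · exact hreg ⟨h0, hx.2⟩ (by simp)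
  · rcases hx.2.eq_or_lt with h1 | h1
    · subst h1
      refine ⟨1 / 2, 2 ^ d, κ, by norm_num, by positivity, hκ, fun t ht => ?_⟩
      have hx1 : (1 : ℝ) / 2 ≤ 1 + -1 * t := by linarith [ht.2]
      have hx2 : 1 + -1 * t ≤ 1 := by linarith [ht.1]
      have hx3 : 0 < 1 + -1 * t := by linarith
      have e : 1 - (1 + -1 * t) ^ 2 = t * (2 - t) := by ring
      have h2t : 1 ≤ 2 - t := by linarith [ht.2]
      refine ⟨⟨hx3, by linarith [ht.1]⟩, ?_, ?_⟩
      · have h3 : 0 < t * (2 - t) := mul_pos ht.1 (by linarith)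
        have h4 : ((1 + -1 * t) ^ d)⁻¹ ≤ 2 ^ d := by
          rw [← inv_pow]
          gcongr
          exact inv_le_of_inv_le₀ (by norm_num) (by linarith)
        have h5 := Real.rpow_le_one_of_one_le_of_nonpos h2t (by linarith : -κ ≤ 0)
        have h6 := Real.rpow_pos_of_pos ht.1 (-κ)
        rw [wA, e, mul_inv, ← Real.rpow_neg h3.le, Real.mul_rpow ht.1.le (by linarith)]
        calc _ ≤ 2 ^ d * (t ^ (-κ) * 1) := by gcongr
          _ = _ := by ring
      · have h4 : (1 + -1 * t) ^ d ≤ 2 ^ d := by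
          gcongr
          linarith
        have h5 := Real.rpow_le_one_of_one_le_of_nonpos h2t (by linarith : κ - 1 ≤ 0)
        have h6 := Real.rpow_pos_of_pos ht.1 (κ - 1)
        rw [wB, e, Real.mul_rpow ht.1.le (by linarith)]
        calc _ ≤ 2 ^ d * (t ^ (κ - 1) * 1) := by gcongr
          _ = _ := by ring
    · exact hreg ⟨hx.1, h1⟩ (by simp)

theorem exists_lipschitz_profileNl {p α u₀ : ℝ} (hu : 0 < u₀) :
    ∃ L > 0, ∀ᶠ q in nhds (u₀, u₀), |profileNl p α q.1 - profileNl p α q.2| ≤ L * |q.1 - q.2| := by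
  have hf : ContDiffAt ℝ 1 (profileNl p α) u₀ := by
    unfold profileNl
    exact (contDiffAt_const.mul contDiffAt_id).sub (Real.contDiffAt_rpow_const_of_ne hu.ne')
  obtain ⟨K, t, ht, hK⟩ := hf.exists_lipschitzOnWith
  refine ⟨K + 1, by positivity, ?_⟩
  filter_upwards [prod_mem_nhds ht ht] with q hq
  have := hK.dist_le_mul _ hq.1 _ hq.2
  rw [Real.dist_eq, Real.dist_eq] at this
  nlinarith [abs_nonneg (q.1 - q.2)]

/-- One-sided uniqueness for the profile equation at a point of `[0,1]`. -/
theorem exists_eq_of_isProfileJet {d : ℕ} {p α κ σ x₀ r : ℝ} {u F U V : ℝ → ℝ}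
    (hP : ProfileParams d p α κ)
    (hσ : (σ = 1 ∧ x₀ ∈ Ico (0 : ℝ) 1) ∨ (σ = -1 ∧ x₀ ∈ Ioc (0 : ℝ) 1))
    (hu : ContinuousOn u (Icc 0 1)) (hF : ContinuousOn F (Icc 0 1))
    (hu' : ∀ x ∈ Ioo (0 : ℝ) 1, HasDerivAt u (F x / wA d κ x) x)
    (hF' : ∀ x ∈ Ioo (0 : ℝ) 1, HasDerivAt F (wB d κ x * profileNl p α (u x)) x)
    (hr : 0 < r) (hU : ContinuousOn U (Ioo (x₀ - r) (x₀ + r)))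
    (hV : ContinuousOn V (Ioo (x₀ - r) (x₀ + r)))
    (hUV : ∀ x ∈ Ioo (x₀ - r) (x₀ + r), 0 < x → IsProfileJet d p α U V x)
    (h0 : U x₀ = u x₀) (hpos : 0 < u x₀) (hF0 : F x₀ = wA d κ x₀ * V x₀) :
    ∃ ε > 0, ∀ t ∈ Icc 0 ε, u (x₀ + σ * t) = U (x₀ + σ * t) := by
  obtain ⟨r₁, C, s, hr₁, hC, hs, hw⟩ := exists_weight_bounds hP.two_le hP.kappa_pos
    hP.kappa_lt_one hσ
  have hx₀ : x₀ ∈ Icc (0 : ℝ) 1 := by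
    rcases hσ with h | h
    exacts [Ico_subset_Icc_self h.2, Ioc_subset_Icc_self h.2]
  have hσ1 : |σ| = 1 := by rcases hσ with h | h <;> simp [h.1]
  obtain ⟨L, hL, hlip⟩ := exists_lipschitz_profileNl (p := p) (α := α) hpos
  set ρ := min (r₁ / 2) (r / 2) with hρ
  have hρ0 : 0 < ρ := by positivity
  have hρ1 : ρ < r₁ := (min_le_left _ _).trans_lt (by linarith)
  have hρ2 : ρ < r := (min_le_right _ _).trans_lt (by linarith)
  have hmaps : MapsTo (fun t => x₀ + σ * t) (Icc 0 ρ) (Icc 0 1) := fun t ht => by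
    rcases ht.1.eq_or_lt with h | h
    · simpa [← h] using hx₀
    · exact Ioo_subset_Icc_self (hw t ⟨h, ht.2.trans_lt hρ1⟩).1
  have hmaps' : MapsTo (fun t => x₀ + σ * t) (Icc 0 ρ) (Ioo (x₀ - r) (x₀ + r)) := fun t ht => by
    have h1 : |σ * t| < r := by
      rw [abs_mul, hσ1, one_mul, abs_of_nonneg ht.1]; exact ht.2.trans_lt hρ2
    obtain ⟨h2, h3⟩ := abs_lt.1 h1
    exact ⟨by simp only; linarith, by simp only; linarith⟩
  have hline : ContinuousOn (fun t => x₀ + σ * t) (Icc 0 ρ) := by fun_prop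
  have hcu := hu.comp hline hmaps
  have hcF := hF.comp hline hmaps
  have hcU := hU.comp hline hmaps'
  have hcG := (continuous_wA (d := d) hP.kappa_pos.le).continuousOn.mul hV |>.comp hline hmaps'
  have hpair := ((hcu 0 ⟨le_rfl, hρ0.le⟩).prodMk (hcU 0 ⟨le_rfl, hρ0.le⟩)).eventually
    (p := fun q => |profileNl p α q.1 - profileNl p α q.2| ≤ L * |q.1 - q.2|) (by
      simpa [h0] using hlip)
  obtain ⟨ρ', hρ', hball⟩ := Metric.eventually_nhds_iff_ball.1 (eventually_nhdsWithin_iff.1 hpair)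
  set R := min ρ ρ' with hR
  have hR0 : 0 < R := lt_min hρ0 hρ'
  have hRρ : R ≤ ρ := min_le_left _ _
  have hin : ∀ t ∈ Ioo 0 R, t ∈ Ioo 0 r₁ ∧ t ∈ Icc 0 ρ := fun t ht =>
    ⟨⟨ht.1, ht.2.trans (hRρ.trans_lt hρ1)⟩, ht.1.le, ht.2.le.trans hRρ⟩
  have hlin : ∀ t : ℝ, HasDerivAt (fun t => x₀ + σ * t) σ t := fun t => by
    simpa using ((hasDerivAt_id t).const_mul σ).const_add x₀
  refine (eq_zero_of_singular_system (r := R) (C := C * (L + 1)) (s := s)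
    (δ := fun t => u (x₀ + σ * t) - U (x₀ + σ * t))
    (Δ := fun t => F (x₀ + σ * t) - wA d κ (x₀ + σ * t) * V (x₀ + σ * t))
    (δ' := fun t => (F (x₀ + σ * t) / wA d κ (x₀ + σ * t) - V (x₀ + σ * t)) * σ)
    (Δ' := fun t => (wB d κ (x₀ + σ * t) * profileNl p α (u (x₀ + σ * t)) -
      wB d κ (x₀ + σ * t) * profileNl p α (U (x₀ + σ * t))) * σ)
    hR0 (by positivity) hs ((hcu.sub hcU).mono (Icc_subset_Icc le_rfl hRρ))
    ((hcF.sub hcG).mono (Icc_subset_Icc le_rfl hRρ)) (by simp [h0]) (by simp [hF0])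
    (fun t ht => ?_) (fun t ht => ?_) (fun t ht => ?_) fun t ht => ?_).imp
    fun ε h => ⟨h.1, fun t ht => sub_eq_zero.1 (h.2.2 t ht).1⟩
  · have h1 := (hw t (hin t ht).1).1
    have h2 := hUV _ (hmaps' (hin t ht).2) h1.1
    exact ((hu' _ h1).sub h2.1).comp t (hlin t)
  · have h1 := (hw t (hin t ht).1).1
    have h2 := (hUV _ (hmaps' (hin t ht).2) h1.1).hasDerivAt_wA_mul hP h1
    exact ((hF' _ h1).sub h2).comp t (hlin t)
  · obtain ⟨h1, h2, -⟩ := hw t (hin t ht).1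
    have hA := wA_pos (d := d) (κ := κ) h1
    have e : F (x₀ + σ * t) / wA d κ (x₀ + σ * t) - V (x₀ + σ * t) = (wA d κ (x₀ + σ * t))⁻¹ *
        (F (x₀ + σ * t) - wA d κ (x₀ + σ * t) * V (x₀ + σ * t)) := by field_simp
    rw [abs_mul, hσ1, mul_one, e, abs_mul, abs_of_pos (inv_pos.2 hA)]
    refine mul_le_mul_of_nonneg_right (h2.trans ?_) (abs_nonneg _)
    have := Real.rpow_pos_of_pos ht.1 (-s)
    gcongr
    nlinarith
  · obtain ⟨h1, -, h3⟩ := hw t (hin t ht).1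
    have hB := wB_nonneg (d := d) (κ := κ) (Ioo_subset_Icc_self h1)
    have hb := hball t (by
      rw [mem_ball_zero_iff, Real.norm_eq_abs, abs_of_pos ht.1]
      exact ht.2.trans_le (min_le_right _ _)) (hin t ht).2
    simp only [Function.comp_apply] at hb
    rw [abs_mul, hσ1, mul_one, ← mul_sub, abs_mul, abs_of_nonneg hB]
    have := Real.rpow_pos_of_pos ht.1 (s - 1)
    calc _ ≤ (C * t ^ (s - 1)) * (L * |u (x₀ + σ * t) - U (x₀ + σ * t)|) := by gcongr
      _ ≤ (C * t ^ (s - 1)) * ((L + 1) * |u (x₀ + σ * t) - U (x₀ + σ * t)|) := by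
        gcongr
        linarith
      _ = _ := by ring

namespace IsNormalizedProfile

variable {d : ℕ} {p α κ μ c : ℝ} {φ : ℝ → ℝ}

theorem mul_clampNl (hP : ProfileParams d p α κ) (hμ : α * (α + 1) ≤ μ)
    (hφ : IsNormalizedProfile d p α κ μ φ) (hc : 0 < c) (hcμ : c ^ (p - 1) = μ) {x : ℝ}
    (hx : x ∈ Icc (0 : ℝ) 1) : c * clampNl p α μ (φ x) = profileNl p α (c * φ x) := by
  have h0 := hφ.pos hP hμ hx
  rw [clampNl_of_mem h0.le (hφ.le_one hP hμ hx), profileNl, Real.mul_rpow hc.le h0.le, ← hcμ,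
    Real.rpow_sub_one hc.ne']
  field_simp

theorem hasDerivAt_mul (hP : ProfileParams d p α κ) (hφ : IsNormalizedProfile d p α κ μ φ) {x : ℝ}
    (hx : x ∈ Ioo (0 : ℝ) 1) : HasDerivAt (fun y => c * φ y)
      (c * fluxOp d κ (fun y => clampNl p α μ (φ y)) x / wA d κ x) x :=
  ((hφ.hasDerivAt hP hx).const_mul c).congr_deriv (by rw [profDeriv, mul_div_assoc])

theorem isProfileJet (hP : ProfileParams d p α κ) (hμ : α * (α + 1) ≤ μ)
    (hφ : IsNormalizedProfile d p α κ μ φ) (hc : 0 < c) (hcμ : c ^ (p - 1) = μ) {x : ℝ}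
    (hx : x ∈ Ioo (0 : ℝ) 1) :
    IsProfileJet d p α (fun y => c * φ y) (fun y => c * profDeriv d p α κ μ φ y) x := by
  refine ⟨(hφ.hasDerivAt hP hx).const_mul c, _, (hφ.hasDerivAt_profDeriv hP hx).const_mul c, ?_⟩
  rw [← hφ.mul_clampNl hP hμ hc hcμ (Ioo_subset_Icc_self hx)]
  have hx2 : 1 - x ^ 2 ≠ 0 := by nlinarith [hx.1, hx.2]
  have hx0 : x ≠ 0 := hx.1.ne'
  field_simp
  ring

/-- Near every point of `[0,1]` a regular profile coincides, on either side inside `(0,1)`, with an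
analytic local solution. -/
theorem exists_local_eq (hP : ProfileParams d p α κ) (hμ : α * (α + 1) ≤ μ)
    (hφ : IsNormalizedProfile d p α κ μ φ) (hc : 0 < c) (hcμ : c ^ (p - 1) = μ)
    (hflux : fluxOp d κ (fun y => clampNl p α μ (φ y)) 1 = 0) {x₀ : ℝ}
    (hx₀ : x₀ ∈ Icc (0 : ℝ) 1) :
    ∃ r > 0, ∃ U V : ℝ → ℝ, AnalyticOnNhd ℝ U (Ioo (x₀ - r) (x₀ + r)) ∧ U x₀ = c * φ x₀ ∧
      (∀ x ∈ Ioo (x₀ - r) (x₀ + r), 0 < x → IsProfileJet d p α U V x) ∧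
      (x₀ < 1 → ∃ ε > 0, ∀ t ∈ Icc 0 ε, c * φ (x₀ + t) = U (x₀ + t)) ∧
      (0 < x₀ → ∃ ε > 0, ∀ t ∈ Icc 0 ε, c * φ (x₀ - t) = U (x₀ - t)) := by
  have hpos : 0 < c * φ x₀ := mul_pos hc (hφ.pos hP hμ hx₀)
  obtain ⟨r, hr, U, V, hU, hU0, hV0, hV, hJ⟩ := exists_local_profile
    (w₀ := c * profDeriv d p α κ μ φ x₀) hP hpos hx₀
  have hd : d ≠ 0 := by have := hP.two_le; omega
  have hF0 : c * fluxOp d κ (fun y => clampNl p α μ (φ y)) x₀ = wA d κ x₀ * V x₀ := by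
    rcases hx₀.1.eq_or_lt with h0 | h0
    · subst h0
      simp [fluxOp, wA, hd]
    rcases hx₀.2.eq_or_lt with h1 | h1
    · subst h1
      simp [hflux, wA, Real.zero_rpow hP.kappa_pos.ne']
    · have hA := wA_pos (d := d) (κ := κ) (x := x₀) ⟨h0, h1⟩
      rw [hV0 ⟨h0, h1⟩, profDeriv]
      field_simp
  have key : ∀ σ : ℝ, (σ = 1 ∧ x₀ ∈ Ico (0 : ℝ) 1) ∨ (σ = -1 ∧ x₀ ∈ Ioc (0 : ℝ) 1) →
      ∃ ε > 0, ∀ t ∈ Icc 0 ε, c * φ (x₀ + σ * t) = U (x₀ + σ * t) := fun σ hσ =>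
    exists_eq_of_isProfileJet (u := fun x => c * φ x)
      (F := fun x => c * fluxOp d κ (fun y => clampNl p α μ (φ y)) x) hP hσ
      (continuousOn_const.mul hφ.continuousOn)
      (continuousOn_const.mul
        (continuousOn_fluxOp hP.kappa_pos hP.kappa_lt_one (hφ.continuousOn_nl hP)))
      (fun x hx => hφ.hasDerivAt_mul hP hx)
      (fun x hx => ((hasDerivAt_fluxOp (d := d) hP.kappa_pos hP.kappa_lt_one
        (hφ.continuousOn_nl hP) hx).const_mul c).congr_deriv (by
          rw [← hφ.mul_clampNl hP hμ hc hcμ (Ioo_subset_Icc_self hx)]; ring))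
      hr hU.continuousOn hV hJ hU0 hpos hF0
  refine ⟨r, hr, U, V, hU, hU0, hJ, fun h => ?_, fun h => ?_⟩
  · simpa using key 1 (Or.inl ⟨rfl, hx₀.1, h⟩)
  · simpa [← sub_eq_add_neg] using key (-1) (Or.inr ⟨rfl, h, hx₀.2⟩)

end IsNormalizedProfile

theorem eventually_eq_of_sub {f g : ℝ → ℝ} {x₀ : ℝ}
    (h : ∃ ε > 0, ∀ t ∈ Icc (0 : ℝ) ε, f (x₀ - t) = g (x₀ - t)) :
    ∃ ε > 0, ∀ x ∈ Icc (x₀ - ε) x₀, f x = g x := by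
  obtain ⟨ε, hε, h⟩ := h
  refine ⟨ε, hε, fun x hx => ?_⟩
  simpa using h (x₀ - x) ⟨by linarith [hx.2], by linarith [hx.1]⟩

theorem eventually_eq_of_add {f g : ℝ → ℝ} {x₀ : ℝ}
    (h : ∃ ε > 0, ∀ t ∈ Icc (0 : ℝ) ε, f (x₀ + t) = g (x₀ + t)) :
    ∃ ε > 0, ∀ x ∈ Icc x₀ (x₀ + ε), f x = g x := by
  obtain ⟨ε, hε, h⟩ := h
  refine ⟨ε, hε, fun x hx => ?_⟩
  simpa using h (x - x₀) ⟨by linarith [hx.1], by linarith [hx.2]⟩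

theorem IsProfileJet.congr {d : ℕ} {p α x : ℝ} {U V u : ℝ → ℝ} (h : IsProfileJet d p α U V x)
    (hu : u =ᶠ[nhds x] U) : IsProfileJet d p α u V x := by
  obtain ⟨h1, v, hv, h2⟩ := h
  exact ⟨h1.congr_of_eventuallyEq hu, v, hv, by rw [h2, hu.eq_of_nhds]⟩

/-- A regular profile extends to an analytic positive solution past the light cone. -/
theorem IsNormalizedProfile.exists_extension {d : ℕ} {p α κ μ c : ℝ} {φ : ℝ → ℝ}
    (hP : ProfileParams d p α κ) (hμ : α * (α + 1) ≤ μ)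
    (hφ : IsNormalizedProfile d p α κ μ φ) (hc : 0 < c) (hcμ : c ^ (p - 1) = μ)
    (hflux : fluxOp d κ (fun y => clampNl p α μ (φ y)) 1 = 0) :
    ∃ ρ > 1, ∃ u : ℝ → ℝ, AnalyticOn ℝ u (Ico 0 ρ) ∧ (∀ x ∈ Ico 0 ρ, 0 < u x) ∧
      (∀ x ∈ Ioo 0 ρ, ∃ V : ℝ → ℝ, ∀ᶠ y in nhds x, IsProfileJet d p α u V y) ∧
      ∀ x ∈ Ico (0 : ℝ) 1, u x = c * φ x := by
  obtain ⟨r, hr, U, W, hU, hU1, hJ, -, hle⟩ := hφ.exists_local_eq hP hμ hc hcμ hflux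
    (x₀ := 1) (by simp)
  obtain ⟨ε, hε, hle⟩ := eventually_eq_of_sub (f := fun x => c * φ x) (hle one_pos)
  have hposφ : ∀ x ∈ Icc (0 : ℝ) 1, 0 < c * φ x := fun x hx => mul_pos hc (hφ.pos hP hμ hx)
  have hU1c : ContinuousAt U 1 := (hU 1 ⟨by linarith, by linarith⟩).continuousAt
  obtain ⟨s, hs, hUpos⟩ := Metric.eventually_nhds_iff_ball.1 (hU1c.eventually
    (lt_mem_nhds (by rw [hU1]; exact hposφ 1 (by simp) : (0 : ℝ) < U 1)))
  set u : ℝ → ℝ := fun x => if x < 1 then c * φ x else U x with hu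
  have hu1 : ∀ x < 1, u x = c * φ x := fun x hx => if_pos hx
  have hu2 : ∀ x ≥ 1, u x = U x := fun x hx => if_neg (not_lt.2 hx)
  set ρ := 1 + min r s with hρ
  have hρr : ρ ≤ 1 + r := by linarith [min_le_left r s]
  have hρs : ρ ≤ 1 + s := by linarith [min_le_right r s]
  have hevl : ∀ x, x < 1 → u =ᶠ[nhds x] fun x => c * φ x := fun x hx => by
    filter_upwards [gt_mem_nhds hx] with y hy using hu1 y hy
  have hevr : ∀ x, 1 ≤ x → u =ᶠ[nhds x] U := fun x hx => by
    filter_upwards [lt_mem_nhds (by linarith : 1 - ε < x)] with y hy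
    rcases lt_or_ge y 1 with h | h
    · exact (hu1 y h).trans (hle y ⟨hy.le, h.le⟩)
    · exact hu2 y h
  refine ⟨ρ, by have := lt_min hr hs; linarith, u, fun x hx => ?_, fun x hx => ?_, fun x hx => ?_,
    fun x hx => hu1 x hx.2⟩
  · rcases lt_or_ge x 1 with h1 | h1
    · obtain ⟨r', hr', U', -, hU', -, -, hadd, hsub⟩ := hφ.exists_local_eq hP hμ hc hcμ hflux
        (x₀ := x) ⟨hx.1, h1.le⟩
      have hxa : AnalyticAt ℝ U' x := hU' x ⟨by linarith, by linarith⟩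
      obtain ⟨e, he, hadd⟩ := eventually_eq_of_add (f := fun x => c * φ x) (hadd h1)
      rcases hx.1.eq_or_lt with h0 | h0
      · refine hxa.analyticWithinAt.congr_of_eventuallyEq ?_
          ((hu1 x h1).trans (hadd x ⟨le_rfl, by linarith⟩))
        filter_upwards [self_mem_nhdsWithin, mem_nhdsWithin_of_mem_nhds (hevl x h1),
          mem_nhdsWithin_of_mem_nhds (gt_mem_nhds (by linarith : x < x + e))] with y hy hy1 hy2
        exact hy1.trans (hadd y ⟨h0 ▸ hy.1, hy2.le⟩)
      · obtain ⟨e', he', hsub⟩ := eventually_eq_of_sub (f := fun x => c * φ x) (hsub h0)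
        refine (hxa.congr ?_).analyticWithinAt
        filter_upwards [hevl x h1, gt_mem_nhds (by linarith : x < x + e),
          lt_mem_nhds (by linarith : x - e' < x)] with y hy1 hy2 hy3
        rw [hy1]
        rcases le_total x y with h | h
        · exact (hadd y ⟨h, hy2.le⟩).symm
        · exact (hsub y ⟨hy3.le, h⟩).symm
    · exact ((hU x ⟨by linarith, hx.2.trans_le hρr⟩).congr (hevr x h1).symm).analyticWithinAt
  · rcases lt_or_ge x 1 with h1 | h1
    · rw [hu1 x h1]; exact hposφ x ⟨hx.1, h1.le⟩
    · rw [hu2 x h1]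
      refine hUpos x ?_
      rw [Metric.mem_ball, Real.dist_eq, abs_lt]
      constructor <;> linarith [hx.2]
  · rcases lt_or_ge x 1 with h1 | h1
    · refine ⟨fun y => c * profDeriv d p α κ μ φ y, ?_⟩
      filter_upwards [isOpen_Ioo.mem_nhds (⟨hx.1, h1⟩ : x ∈ Ioo 0 1)] with y hy
      exact (hφ.isProfileJet hP hμ hc hcμ hy).congr (hevl y hy.2)
    · refine ⟨W, ?_⟩
      filter_upwards [isOpen_Ioo.mem_nhds (⟨by linarith, hx.2.trans_le hρr⟩ :
        x ∈ Ioo (1 - r) (1 + r)), lt_mem_nhds hx.1, (hevr x h1).eventuallyEq_nhds] with y hy hy0 hy1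
      exact (hJ y hy hy0).congr hy1

theorem isSolOn_of_isProfileJet {N : ℕ} {p : ℝ} (hN : 1 ≤ N) {u : ℝ → ℝ} {s : Set ℝ}
    (hpos : ∀ x ∈ s, 0 < u x) (h : ∀ x ∈ s, ∃ V : ℝ → ℝ, ∀ᶠ y in nhds x,
      IsProfileJet (N - 1) p (alphaP p) u V y) : IsSolOn N p u s := by
  intro x hx
  obtain ⟨V, hV⟩ := h x hx
  obtain ⟨h1, v, hv, he⟩ := hV.self_of_nhds
  have hd : deriv u =ᶠ[nhds x] V := hV.mono fun y hy => hy.1.deriv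
  have hpow : |u x| ^ (p - 1) * u x = u x ^ p := by
    rw [abs_of_pos (hpos x hx), ← Real.rpow_add_one (hpos x hx).ne', sub_add_cancel]
  rw [hd.deriv_eq, hv.deriv, h1.deriv, hpow]
  rw [profileNl, Nat.cast_sub hN, Nat.cast_one] at he
  linarith

theorem profileParams_of_bounds {N : ℕ} {p : ℝ}
    (hNp : (N = 3 ∧ 5 < p) ∨
      (4 ≤ N ∧ 1 + 4 / ((N : ℝ) - 2) < p ∧ p < 1 + 4 / ((N : ℝ) - 3))) :
    3 ≤ N ∧ ProfileParams (N - 1) p (alphaP p) (alphaP p - ((N - 1 : ℕ) - 2) / 2) := by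
  have hN : 3 ≤ N := by omega
  have hcast : ((N - 1 : ℕ) : ℝ) = N - 1 := by rw [Nat.cast_sub (by omega), Nat.cast_one]
  have hN' : (3 : ℝ) ≤ N := by exact_mod_cast hN
  have key : 1 < p ∧ (N : ℝ) - 3 < 2 * alphaP p ∧ 2 * alphaP p < N - 2 := by
    rw [alphaP]
    rcases hNp with ⟨rfl, hp⟩ | ⟨h4, hp1, hp2⟩
    · have hp0 : 0 < p - 1 := by linarith
      have e : 2 * (2 / (p - 1)) = 4 / (p - 1) := by ring
      rw [e, div_lt_iff₀ hp0]
      have : 0 < 4 / (p - 1) := by positivity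
      exact ⟨by linarith, by push_cast; linarith, by push_cast; linarith⟩
    · have h4' : (4 : ℝ) ≤ N := by exact_mod_cast h4
      have h2 : 0 < (N : ℝ) - 2 := by linarith
      have h3 : 0 < (N : ℝ) - 3 := by linarith
      have hp0 : 0 < p - 1 := by
        have : 0 < 4 / ((N : ℝ) - 2) := by positivity
        linarith
      have e : 2 * (2 / (p - 1)) = 4 / (p - 1) := by ring
      have h5 : 4 / ((N : ℝ) - 2) < p - 1 := by linarith
      have h6 : p - 1 < 4 / ((N : ℝ) - 3) := by linarith
      rw [div_lt_iff₀ h2] at h5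
      rw [lt_div_iff₀ h3] at h6
      rw [e, div_lt_iff₀ hp0, lt_div_iff₀ hp0]
      exact ⟨by linarith, by linarith, by linarith⟩
  obtain ⟨hp, h1, h2⟩ := key
  have hp0 : p - 1 ≠ 0 := by linarith
  refine ⟨hN, by omega, hp, ?_, rfl, ?_, ?_⟩
  · rw [alphaP]; field_simp
  · rw [hcast]; linarith
  · rw [hcast]; linarith

theorem stmt0 (N : ℕ) (p : ℝ)
    (hNp : (N = 3 ∧ 5 < p) ∨
      (4 ≤ N ∧ 1 + 4 / ((N : ℝ) - 2) < p ∧ p < 1 + 4 / ((N : ℝ) - 3))) :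
    ∃ (ρ : ℕ → ℝ) (u : ℕ → ℝ → ℝ),
      (∀ n : ℕ,
        1 < ρ n ∧
        AnalyticOn ℝ (u n) (Ico 0 (ρ n)) ∧
        (∀ x ∈ Ico (0 : ℝ) (ρ n), 0 < u n x) ∧
        IsSolOn N p (u n) (Ioo 0 (ρ n)) ∧
        {x ∈ Ioo (0 : ℝ) 1 | u n x - uInf N p x = 0}.encard = ((n + 1 : ℕ) : ℕ∞)) ∧
      Tendsto (fun n => u n 0) atTop atTop := by
  obtain ⟨hN, hP⟩ := profileParams_of_bounds hNp
  set d := N - 1 with hd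
  have hcast : (d : ℝ) = N - 1 := by rw [hd, Nat.cast_sub (by omega), Nat.cast_one]
  have hp := hP.one_lt
  have hα := hP.alpha_pos
  have hβ := hP.beta_pos
  have e : (d : ℝ) - 1 - alphaP p = N - 2 - alphaP p := by rw [hcast]; ring
  have hhalf : alphaP p / 2 * (p - 1) = 1 := by linarith [hP.alpha_mul]
  have hb : 0 < bInf N p := by
    rw [bInf, ← e]; exact Real.rpow_pos_of_pos hβ _
  have hbβ : bInf N p ^ (p - 1) = alphaP p * (d - 1 - alphaP p) := by
    rw [bInf, ← e, ← Real.rpow_mul hβ.le, hhalf, Real.rpow_one]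
  obtain ⟨μ, φ, hμ, h⟩ := exists_regular_profiles hP hb hbβ
  have hμ0 : ∀ n, 0 < μ n := fun n => lt_of_lt_of_le (by positivity) (h n).1
  have hcμ : ∀ n, (μ n ^ (1 / (p - 1))) ^ (p - 1) = μ n := fun n => by
    rw [← Real.rpow_mul (hμ0 n).le, one_div_mul_cancel (by linarith), Real.rpow_one]
  choose ρ hρ u hu hpos hjet hφ using fun n => (h n).2.1.exists_extension hP (h n).1
    (Real.rpow_pos_of_pos (hμ0 n) _) (hcμ n) (h n).2.2.1
  refine ⟨ρ, u, fun n => ⟨hρ n, hu n, hpos n, isSolOn_of_isProfileJet (by omega)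
    (fun x hx => hpos n x (Ioo_subset_Ico_self hx)) (hjet n), ?_⟩, ?_⟩
  · rw [← (h n).2.2.2]
    congr 1
    ext x
    simp only [mem_ofPred_eq]
    refine and_congr_right fun hx => ?_
    have hxα := Real.rpow_pos_of_pos hx.1 (alphaP p)
    rw [hφ n x (Ioo_subset_Ico_self hx), uInf, ssV, Real.rpow_neg hx.1.le, sub_eq_zero,
      ← div_eq_mul_inv, eq_div_iff hxα.ne']
    constructor <;> intro h' <;> linarith
  · have h1 : ∀ n, u n 0 = μ n ^ (1 / (p - 1)) := fun n => by
      rw [hφ n 0 (by simp), (h n).2.1.zero, mul_one]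
    simp only [h1]
    exact (tendsto_rpow_atTop (one_div_pos.2 (by linarith))).comp hμ
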